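/- For every C^∞ function μ : ℂ → ℂ with sup |μ| < 1 there exists a C^∞ diffeomorphism Φ : ℂ → ℂ with Φ(0) = 0 and Φ(1) = 1 such that ∂Φ/∂z̄(z) = μ(z)·∂Φ/∂z(z) and ∂Φ/∂z(z) ≠ 0 for every z ∈ ℂ. -/

import Mathlib

open MeasureTheory

/-- The Wirtinger derivative `∂f/∂z = (1/2)(∂f/∂x − i ∂f/∂y)` of `f` at `z`,
where `∂f/∂x`, `∂f/∂y` are the directional derivatives in directions `1`, `i`. -/
noncomputable def wderiv (f : ℂ → ℂ) (z : ℂ) : ℂ :=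
  (fderiv ℝ f z 1 - Complex.I * fderiv ℝ f z Complex.I) / 2

/-- The Wirtinger derivative `∂f/∂z̄ = (1/2)(∂f/∂x + i ∂f/∂y)` of `f` at `z`. -/
noncomputable def wderivBar (f : ℂ → ℂ) (z : ℂ) : ℂ :=
  (fderiv ℝ f z 1 + Complex.I * fderiv ℝ f z Complex.I) / 2

namespace SRM

open Complex

notation "Smo" => ContDiff ℝ ((⊤ : ℕ∞) : WithTop ℕ∞)

lemma clm_eq (L : ℂ →L[ℝ] ℂ) (w : ℂ) :
    L w = (L 1 - I * L I) / 2 * w + (L 1 + I * L I) / 2 * (starRingEnd ℂ) w := by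
  have h : w = (w.re : ℝ) • (1 : ℂ) + (w.im : ℝ) • I := by
    simp [Complex.re_add_im]
  have h1 : L w = (w.re : ℂ) * L 1 + (w.im : ℂ) * L I := by
    conv_lhs => rw [h]
    rw [map_add, map_smul, map_smul]; simp
  have h2 : w = (w.re : ℂ) + (w.im : ℂ) * I := (Complex.re_add_im w).symm
  have h3 : (starRingEnd ℂ) w = (w.re : ℂ) - (w.im : ℂ) * I := by
    apply Complex.ext <;> simp
  rw [h1, h3]
  conv_rhs => rw [h2]
  simp only [add_re, ofReal_re, mul_re, I_re, mul_zero, ofReal_im, I_im, mul_one, sub_self, add_zero, add_im, mul_im, zero_add]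
  linear_combination ((w.im : ℂ) * L I) * I_sq

lemma fd_eq (f : ℂ → ℂ) (z w : ℂ) :
    fderiv ℝ f z w = wderiv f z * w + wderivBar f z * (starRingEnd ℂ) w :=
  clm_eq (fderiv ℝ f z) w

lemma fd_one (f : ℂ → ℂ) (z : ℂ) : fderiv ℝ f z 1 = wderiv f z + wderivBar f z := by
  simp [fd_eq]

lemma fd_I (f : ℂ → ℂ) (z : ℂ) : fderiv ℝ f z I = I * (wderiv f z - wderivBar f z) := by
  simp [fd_eq]; ring

lemma wd_of {f : ℂ → ℂ} {L : ℂ →L[ℝ] ℂ} {z : ℂ} (h : HasFDerivAt f L z) :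
    wderiv f z = (L 1 - I * L I) / 2 := by rw [wderiv, h.fderiv]

lemma wdb_of {f : ℂ → ℂ} {L : ℂ →L[ℝ] ℂ} {z : ℂ} (h : HasFDerivAt f L z) :
    wderivBar f z = (L 1 + I * L I) / 2 := by rw [wderivBar, h.fderiv]

lemma _root_.ContDiff.da {f : ℂ → ℂ} (h : Smo f) (z : ℂ) : DifferentiableAt ℝ f z :=
  h.contDiffAt.differentiableAt (by simp)

lemma wd_congr {f g : ℂ → ℂ} {z : ℂ} (h : f =ᶠ[nhds z] g) : wderiv f z = wderiv g z := by
  rw [wderiv, wderiv, h.fderiv_eq]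

lemma wdb_congr {f g : ℂ → ℂ} {z : ℂ} (h : f =ᶠ[nhds z] g) : wderivBar f z = wderivBar g z := by
  rw [wderivBar, wderivBar, h.fderiv_eq]

lemma wd_add {f g : ℂ → ℂ} {z : ℂ} (hf : DifferentiableAt ℝ f z) (hg : DifferentiableAt ℝ g z) :
    wderiv (fun x => f x + g x) z = wderiv f z + wderiv g z := by
  rw [wd_of (hf.hasFDerivAt.fun_add hg.hasFDerivAt)]; simp [wderiv]; ring

lemma wdb_add {f g : ℂ → ℂ} {z : ℂ} (hf : DifferentiableAt ℝ f z) (hg : DifferentiableAt ℝ g z) :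
    wderivBar (fun x => f x + g x) z = wderivBar f z + wderivBar g z := by
  rw [wdb_of (hf.hasFDerivAt.fun_add hg.hasFDerivAt)]; simp [wderivBar]; ring

lemma wd_sub {f g : ℂ → ℂ} {z : ℂ} (hf : DifferentiableAt ℝ f z) (hg : DifferentiableAt ℝ g z) :
    wderiv (fun x => f x - g x) z = wderiv f z - wderiv g z := by
  rw [wd_of (hf.hasFDerivAt.fun_sub hg.hasFDerivAt)]; simp [wderiv]; ring

lemma wdb_sub {f g : ℂ → ℂ} {z : ℂ} (hf : DifferentiableAt ℝ f z) (hg : DifferentiableAt ℝ g z) :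
    wderivBar (fun x => f x - g x) z = wderivBar f z - wderivBar g z := by
  rw [wdb_of (hf.hasFDerivAt.fun_sub hg.hasFDerivAt)]; simp [wderivBar]; ring

lemma wd_mul {f g : ℂ → ℂ} {z : ℂ} (hf : DifferentiableAt ℝ f z) (hg : DifferentiableAt ℝ g z) :
    wderiv (fun x => f x * g x) z = f z * wderiv g z + wderiv f z * g z := by
  rw [wd_of (hf.hasFDerivAt.fun_mul hg.hasFDerivAt)]; simp [wderiv]; ring

lemma wdb_mul {f g : ℂ → ℂ} {z : ℂ} (hf : DifferentiableAt ℝ f z) (hg : DifferentiableAt ℝ g z) :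
    wderivBar (fun x => f x * g x) z = f z * wderivBar g z + wderivBar f z * g z := by
  rw [wdb_of (hf.hasFDerivAt.fun_mul hg.hasFDerivAt)]; simp [wderivBar]; ring

lemma wd_comp {f φ : ℂ → ℂ} {d z : ℂ} (hφ : HasDerivAt φ d (f z)) (hf : DifferentiableAt ℝ f z) :
    wderiv (fun x => φ (f x)) z = d * wderiv f z := by
  have h := (hφ.hasFDerivAt.restrictScalars ℝ).comp z hf.hasFDerivAt
  have : HasFDerivAt (fun x => φ (f x)) _ z := h
  rw [wd_of this]; simp [wderiv]; ring

lemma wdb_comp {f φ : ℂ → ℂ} {d z : ℂ} (hφ : HasDerivAt φ d (f z)) (hf : DifferentiableAt ℝ f z) :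
    wderivBar (fun x => φ (f x)) z = d * wderivBar f z := by
  have h := (hφ.hasFDerivAt.restrictScalars ℝ).comp z hf.hasFDerivAt
  have : HasFDerivAt (fun x => φ (f x)) _ z := h
  rw [wdb_of this]; simp [wderivBar]; ring

lemma wd_const (c z : ℂ) : wderiv (fun _ => c) z = 0 := by simp [wderiv]
lemma wdb_const (c z : ℂ) : wderivBar (fun _ => c) z = 0 := by simp [wderivBar]

lemma smo_fd {f : ℂ → ℂ} (h : Smo f) (e : ℂ) : Smo (fun z => fderiv ℝ f z e) :=
  (h.fderiv_right (m := ((⊤ : ℕ∞) : WithTop ℕ∞)) (by simp)).clm_apply contDiff_const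

lemma smo_wd {f : ℂ → ℂ} (h : Smo f) : Smo (wderiv f) :=
  ((smo_fd h 1).sub (contDiff_const.mul (smo_fd h I))).div_const 2

lemma smo_wdb {f : ℂ → ℂ} (h : Smo f) : Smo (wderivBar f) :=
  ((smo_fd h 1).add (contDiff_const.mul (smo_fd h I))).div_const 2

lemma cs_fd {f : ℂ → ℂ} (h : HasCompactSupport f) (e : ℂ) :
    HasCompactSupport (fun z => fderiv ℝ f z e) := h.fderiv_apply ℝ e

lemma cs_wd {f : ℂ → ℂ} (h : HasCompactSupport f) : HasCompactSupport (wderiv f) := by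
  refine (h.fderiv ℝ).mono ?_
  intro z hz hz'
  apply hz; simp [wderiv, hz']

lemma cs_wdb {f : ℂ → ℂ} (h : HasCompactSupport f) : HasCompactSupport (wderivBar f) := by
  refine (h.fderiv ℝ).mono ?_
  intro z hz hz'
  apply hz; simp [wderivBar, hz']

lemma fd_symm {f : ℂ → ℂ} (h : Smo f) (z a b : ℂ) :
    fderiv ℝ (fun w => fderiv ℝ f w a) z b = fderiv ℝ (fun w => fderiv ℝ f w b) z a := by
  have hs := (h.contDiffAt (x := z)).isSymmSndFDerivAt (by simpa using (WithTop.coe_le_coe.2 (le_top : (2 : ℕ∞) ≤ ⊤)))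
  have hd : DifferentiableAt ℝ (fderiv ℝ f) z :=
    (h.fderiv_right (m := ((⊤ : ℕ∞) : WithTop ℕ∞)) (by simp)).contDiffAt.differentiableAt (by simp)
  have e : ∀ a b : ℂ, fderiv ℝ (fun w => fderiv ℝ f w a) z b = fderiv ℝ (fderiv ℝ f) z b a := by
    intro a b
    have := (hd.hasFDerivAt.clm_apply (hasFDerivAt_const a z)).fderiv
    rw [this]; simp
  rw [e, e]; exact hs b a

lemma fd_wd {f : ℂ → ℂ} (h : Smo f) (z e : ℂ) :
    fderiv ℝ (wderiv f) z e = wderiv (fun w => fderiv ℝ f w e) z := by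
  have h1 := ((smo_fd h 1).da z).hasFDerivAt
  have hI := ((smo_fd h I).da z).hasFDerivAt
  have : HasFDerivAt (wderiv f) _ z := (h1.sub (hI.const_mul I)).mul_const (2⁻¹ : ℂ)
  rw [this.fderiv, wderiv, fd_symm h z e 1, fd_symm h z e I]
  simp; ring

lemma fd_wdb {f : ℂ → ℂ} (h : Smo f) (z e : ℂ) :
    fderiv ℝ (wderivBar f) z e = wderivBar (fun w => fderiv ℝ f w e) z := by
  have h1 := ((smo_fd h 1).da z).hasFDerivAt
  have hI := ((smo_fd h I).da z).hasFDerivAt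
  have : HasFDerivAt (wderivBar f) _ z := (h1.add (hI.const_mul I)).mul_const (2⁻¹ : ℂ)
  rw [this.fderiv, wderivBar, fd_symm h z e 1, fd_symm h z e I]
  simp; ring

lemma wdb_wd {f : ℂ → ℂ} (h : Smo f) (z : ℂ) :
    wderivBar (wderiv f) z = wderiv (wderivBar f) z := by
  rw [wderivBar, wderiv, fd_wd h, fd_wd h, fd_wdb h, fd_wdb h]
  simp only [wderiv, wderivBar]
  rw [fd_symm h z I 1]
  ring

lemma normSq_id (a b : ℂ) : ‖a‖ ^ 2 - ‖b‖ ^ 2 =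
    (a + b).re * (I * (a - b)).im - (I * (a - b)).re * (a + b).im := by
  rw [← Complex.normSq_eq_norm_sq, ← Complex.normSq_eq_norm_sq, normSq_apply, normSq_apply]
  simp; ring

/-- real Jacobian -/
noncomputable def Jac (f : ℂ → ℂ) (z : ℂ) : ℝ := ‖wderiv f z‖ ^ 2 - ‖wderivBar f z‖ ^ 2

lemma clm_det (L : ℂ →L[ℝ] ℂ) : L.det = (L 1).re * (L I).im - (L I).re * (L 1).im := by
  rw [ContinuousLinearMap.det, ← LinearMap.det_toMatrix Complex.basisOneI, Matrix.det_fin_two]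
  simp [LinearMap.toMatrix_apply]

lemma det_fd (f : ℂ → ℂ) (z : ℂ) : (fderiv ℝ f z).det = Jac f z := by
  rw [clm_det, Jac, normSq_id, ← fd_one, ← fd_I]

lemma Jac_nonneg {f : ℂ → ℂ} {z m : ℂ} (hm : ‖m‖ ≤ 1) (h : wderivBar f z = m * wderiv f z) :
    0 ≤ Jac f z := by
  rw [Jac, h, norm_mul, mul_pow]
  have : ‖m‖ ^ 2 ≤ 1 := by nlinarith [norm_nonneg m]
  nlinarith [sq_nonneg ‖wderiv f z‖]

lemma Jac_lower {f : ℂ → ℂ} {z m : ℂ} {k : ℝ} (hm : ‖m‖ ≤ k) (_hk : k < 1)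
    (h : wderivBar f z = m * wderiv f z) :
    (1 - k ^ 2) * ‖wderiv f z‖ ^ 2 ≤ Jac f z := by
  rw [Jac, h, norm_mul, mul_pow]
  have : ‖m‖ ^ 2 ≤ k ^ 2 := by nlinarith [norm_nonneg m]
  nlinarith [sq_nonneg ‖wderiv f z‖]

lemma norm_fd_le (f : ℂ → ℂ) (z : ℂ) : ‖fderiv ℝ f z‖ ≤ ‖wderiv f z‖ + ‖wderivBar f z‖ := by
  refine ContinuousLinearMap.opNorm_le_bound _ (by positivity) fun w => ?_
  rw [fd_eq]
  refine (norm_add_le _ _).trans ?_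
  rw [norm_mul, norm_mul, RCLike.norm_conj, add_mul]

lemma fd_eq_zero {f : ℂ → ℂ} {z : ℂ} (h1 : wderiv f z = 0) (h2 : wderivBar f z = 0) :
    fderiv ℝ f z = 0 := by
  ext w; simp [fd_eq, h1, h2]

end SRM

namespace SRM
open Complex Filter Topology

lemma exists_cutoff : ∃ η : ℂ → ℝ, ContDiff ℝ ((⊤ : ℕ∞) : WithTop ℕ∞) η ∧ (∀ z, ‖z‖ ≤ 1 → η z = 1) ∧
    (∀ z, 2 ≤ ‖z‖ → η z = 0) ∧ (∀ z, 0 ≤ η z ∧ η z ≤ 1) ∧ HasCompactSupport η := by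
  let b : ContDiffBump (0 : ℂ) := ⟨1, 2, by norm_num, by norm_num⟩
  refine ⟨b, b.contDiff, fun z hz => b.one_of_mem_closedBall (by simpa using hz), fun z hz =>
    b.zero_of_le_dist (by simpa using hz), fun z => ⟨b.nonneg, b.le_one⟩, b.hasCompactSupport⟩

lemma exists_cutoffs : ∃ η : ℕ → ℂ → ℝ, ∃ C : ℝ, 0 ≤ C ∧
    (∀ n, ContDiff ℝ ((⊤ : ℕ∞) : WithTop ℕ∞) (η n)) ∧
    (∀ (n : ℕ) (z : ℂ), ‖z‖ ≤ (n + 1 : ℝ) → η n z = 1) ∧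
    (∀ n z, 0 ≤ η n z ∧ η n z ≤ 1) ∧ (∀ n, HasCompactSupport (η n)) ∧
    (∀ (n : ℕ) (z : ℂ), ‖z‖ < (n + 1 : ℝ) → fderiv ℝ (η n) z = 0) ∧
    (∀ (n : ℕ) (z : ℂ), 2 * (n + 1 : ℝ) < ‖z‖ → fderiv ℝ (η n) z = 0) ∧
    (∀ (n : ℕ) (z : ℂ), ‖fderiv ℝ (η n) z‖ ≤ C / (n + 1)) := by
  obtain ⟨η, h1, h2, h3, h4, h5⟩ := exists_cutoff
  have hcont : Continuous (fderiv ℝ η) := h1.continuous_fderiv (by simp)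
  obtain ⟨C, hC⟩ := (h5.fderiv ℝ).exists_bound_of_continuous hcont
  have hn : ∀ n : ℕ, (0 : ℝ) < n + 1 := fun n => by positivity
  have hnorm : ∀ (n : ℕ) (z : ℂ), ‖((n + 1 : ℝ)⁻¹) • z‖ = ‖z‖ / (n + 1) := by
    intro n z
    rw [norm_smul, norm_inv, Real.norm_of_nonneg (hn n).le, div_eq_inv_mul]
  refine ⟨fun n z => η (((n + 1 : ℝ)⁻¹) • z), C, (norm_nonneg _).trans (hC 0), ?_, ?_, ?_, ?_, ?_, ?_, ?_⟩
  · intro n; exact h1.comp (contDiff_const_smul _)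
  · intro n z hz; apply h2; rw [hnorm, div_le_one (hn n)]; exact hz
  · intro n z; exact h4 _
  · intro n; exact h5.comp_smul (inv_ne_zero (hn n).ne')
  · intro n z hz
    have : (fun z => η (((n + 1 : ℝ)⁻¹) • z)) =ᶠ[𝓝 z] fun _ => 1 := by
      have : ∀ᶠ y in 𝓝 z, ‖y‖ < (n + 1 : ℝ) := continuous_norm.continuousAt.eventually_lt continuousAt_const hz
      filter_upwards [this] with y hy
      apply h2; rw [hnorm, div_le_one (hn n)]; exact hy.le
    rw [this.fderiv_eq]; simp
  · intro n z hz
    have : (fun z => η (((n + 1 : ℝ)⁻¹) • z)) =ᶠ[𝓝 z] fun _ => 0 := by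
      have : ∀ᶠ y in 𝓝 z, 2 * (n + 1 : ℝ) < ‖y‖ := continuousAt_const.eventually_lt continuous_norm.continuousAt hz
      filter_upwards [this] with y hy
      apply h3; rw [hnorm, le_div_iff₀ (hn n)]; exact hy.le
    rw [this.fderiv_eq]; simp
  · intro n z
    rw [fderiv_comp_smul, norm_smul, norm_inv, Real.norm_of_nonneg (hn n).le, div_eq_inv_mul]
    gcongr; exact hC _

theorem div_lemma {X Y : ℂ → ℝ} (hX : ContDiff ℝ 1 X) (hY : ContDiff ℝ 1 Y)
    (iX : Integrable (fun z => X z ^ 2)) (iY : Integrable (fun z => Y z ^ 2))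
    (iD : Integrable (fun z => fderiv ℝ X z 1 + fderiv ℝ Y z I)) :
    ∫ z, (fderiv ℝ X z 1 + fderiv ℝ Y z I) = 0 := by
  obtain ⟨η, C, hC0, hsm, h1, h01, hcs, hd1, hd2, hdb⟩ := exists_cutoffs
  have cX := hX.continuous
  have cY := hY.continuous
  have cdX : ∀ e, Continuous fun z => fderiv ℝ X z e := fun e =>
    (hX.continuous_fderiv (by simp)).clm_apply continuous_const
  have cdY : ∀ e, Continuous fun z => fderiv ℝ Y z e := fun e =>
    (hY.continuous_fderiv (by simp)).clm_apply continuous_const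
  have cdη : ∀ n e, Continuous fun z => fderiv ℝ (η n) z e := fun n e =>
    ((hsm n).continuous_fderiv (by simp)).clm_apply continuous_const
  have csd : ∀ n e, HasCompactSupport fun z => fderiv ℝ (η n) z e := fun n e => (hcs n).fderiv_apply ℝ e
  -- limits
  have lim1 : Tendsto (fun n => ∫ z, η n z * (fderiv ℝ X z 1 + fderiv ℝ Y z I)) atTop
      (𝓝 (∫ z, (fderiv ℝ X z 1 + fderiv ℝ Y z I))) := by
    refine tendsto_integral_of_dominated_convergence
      (fun z => ‖fderiv ℝ X z 1 + fderiv ℝ Y z I‖) (fun n => ?_) iD.norm (fun n => ?_) ?_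
    · exact ((hsm n).continuous.mul ((cdX 1).add (cdY I))).aestronglyMeasurable
    · refine Eventually.of_forall fun z => ?_
      rw [norm_mul, Real.norm_of_nonneg (h01 n z).1]
      exact mul_le_of_le_one_left (norm_nonneg _) (h01 n z).2
    · refine Eventually.of_forall fun z => ?_
      refine tendsto_const_nhds.congr' ?_
      obtain ⟨N, hN⟩ := exists_nat_ge ‖z‖
      filter_upwards [eventually_ge_atTop N] with n hn
      rw [h1 n z, one_mul]
      have : (N : ℝ) ≤ n := by exact_mod_cast hn
      linarith
  let R := fun z => X z ^ 2 + Y z ^ 2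
  have iR : Integrable R := iX.add iY
  have lim2 : Tendsto (fun n : ℕ => ∫ z, Set.indicator {z : ℂ | (n + 1 : ℝ) ≤ ‖z‖} R z) atTop (𝓝 0) := by
    rw [← integral_zero ℂ ℝ (μ := volume)]
    refine tendsto_integral_of_dominated_convergence
      (fun z => ‖R z‖) (fun n => ?_) iR.norm (fun n => ?_) ?_
    · exact (iR.indicator (measurableSet_le measurable_const measurable_norm)).aestronglyMeasurable
    · exact Eventually.of_forall fun z => norm_indicator_le_norm_self _ _
    · refine Eventually.of_forall fun z => ?_
      refine tendsto_const_nhds.congr' ?_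
      obtain ⟨N, hN⟩ := exists_nat_ge ‖z‖
      filter_upwards [eventually_ge_atTop N] with n hn
      rw [Set.indicator_of_notMem]
      have : (N : ℝ) ≤ n := by exact_mod_cast hn
      simp only [Set.mem_ofPred_eq, not_le]
      linarith
  have ibp : ∀ n, ∫ z, η n z * (fderiv ℝ X z 1 + fderiv ℝ Y z I) =
      - ∫ z, (fderiv ℝ (η n) z 1 * X z + fderiv ℝ (η n) z I * Y z) := by
    intro n
    have dη : ∀ z, DifferentiableAt ℝ (η n) z := fun z => (hsm n).contDiffAt.differentiableAt (by simp)
    have a1 : Integrable fun z => η n z * fderiv ℝ X z 1 :=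
      ((hsm n).continuous.mul (cdX 1)).integrable_of_hasCompactSupport ((hcs n).mul_right)
    have a2 : Integrable fun z => η n z * fderiv ℝ Y z I :=
      ((hsm n).continuous.mul (cdY I)).integrable_of_hasCompactSupport ((hcs n).mul_right)
    have b1 : Integrable fun z => fderiv ℝ (η n) z 1 * X z :=
      ((cdη n 1).mul cX).integrable_of_hasCompactSupport ((csd n 1).mul_right)
    have b2 : Integrable fun z => fderiv ℝ (η n) z I * Y z :=
      ((cdη n I).mul cY).integrable_of_hasCompactSupport ((csd n I).mul_right)
    have c1 : Integrable fun z => η n z * X z :=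
      ((hsm n).continuous.mul cX).integrable_of_hasCompactSupport ((hcs n).mul_right)
    have c2 : Integrable fun z => η n z * Y z :=
      ((hsm n).continuous.mul cY).integrable_of_hasCompactSupport ((hcs n).mul_right)
    simp_rw [mul_add]
    rw [integral_add a1 a2, integral_add b1 b2,
      integral_mul_fderiv_eq_neg_fderiv_mul_of_integrable b1 a1 c1 (fun z _ => dη z)
        (fun z _ => hX.contDiffAt.differentiableAt (by simp)),
      integral_mul_fderiv_eq_neg_fderiv_mul_of_integrable b2 a2 c2 (fun z _ => dη z)
        (fun z _ => hY.contDiffAt.differentiableAt (by simp))]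
    ring
  let V : ℝ := (volume (Metric.closedBall (0 : ℂ) 1)).toReal
  have key : ∀ δ : ℝ, 0 < δ → ∀ n : ℕ, ‖∫ z, η n z * (fderiv ℝ X z 1 + fderiv ℝ Y z I)‖ ≤
      δ * (2 * C ^ 2 * (4 * V)) + (1 / δ) * ∫ z, Set.indicator {z : ℂ | (n + 1 : ℝ) ≤ ‖z‖} R z := by
    intro δ hδ n
    rw [ibp n, norm_neg]
    let B := fun z => δ * Set.indicator (Metric.closedBall (0 : ℂ) (2 * (n + 1 : ℝ))) (fun _ => 2 * (C / (n + 1)) ^ 2) z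
      + (1 / δ) * Set.indicator {z : ℂ | (n + 1 : ℝ) ≤ ‖z‖} R z
    have iind : Integrable (Set.indicator {z : ℂ | (n + 1 : ℝ) ≤ ‖z‖} R) :=
      iR.indicator (measurableSet_le measurable_const measurable_norm)
    have icst : Integrable (Set.indicator (Metric.closedBall (0 : ℂ) (2 * (n + 1 : ℝ))) (fun _ => 2 * (C / (n + 1 : ℝ)) ^ 2)) := by
      rw [integrable_indicator_iff measurableSet_closedBall]
      exact integrableOn_const measure_closedBall_lt_top.ne
    have hBint : ∫ z, B z = δ * (2 * C ^ 2 * (4 * V)) + (1 / δ) * ∫ z, Set.indicator {z : ℂ | (n + 1 : ℝ) ≤ ‖z‖} R z := by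
      simp only [B]
      rw [integral_add (icst.const_mul _) (iind.const_mul _), integral_const_mul, integral_const_mul,
        integral_indicator measurableSet_closedBall, setIntegral_const]
      congr 2
      have : volume.real (Metric.closedBall (0 : ℂ) (2 * (n + 1 : ℝ))) = (2 * (n + 1 : ℝ)) ^ 2 * V := by
        rw [Measure.real, Measure.addHaar_closedBall' volume _ (by positivity), Complex.finrank_real_complex,
          ENNReal.toReal_mul, ENNReal.toReal_ofReal (by positivity)]
      rw [this, smul_eq_mul]
      have : (n + 1 : ℝ) ≠ 0 := by positivity
      field_simp; ring
    rw [← hBint]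
    refine norm_integral_le_of_norm_le ((icst.const_mul _).add (iind.const_mul _)) (Eventually.of_forall fun z => ?_)
    have hB0 : 0 ≤ B z := by
      apply add_nonneg <;> apply mul_nonneg
      · exact hδ.le
      · apply Set.indicator_nonneg; intros; positivity
      · positivity
      · apply Set.indicator_nonneg; intros; simp only [R]; positivity
    by_cases hz1 : ‖z‖ < (n + 1 : ℝ)
    · rw [hd1 n z hz1]; simpa using hB0
    by_cases hz2 : 2 * (n + 1 : ℝ) < ‖z‖
    · rw [hd2 n z hz2]; simpa using hB0
    rw [not_lt] at hz1 hz2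
    change _ ≤ B z
    simp only [B]
    rw [Set.indicator_of_mem (by simpa using hz2), Set.indicator_of_mem (by simpa using hz1)]
    have e1 : ‖fderiv ℝ (η n) z 1‖ ≤ C / (n + 1) := by
      refine ((fderiv ℝ (η n) z).le_opNorm 1).trans ?_
      simpa using hdb n z
    have e2 : ‖fderiv ℝ (η n) z I‖ ≤ C / (n + 1) := by
      refine ((fderiv ℝ (η n) z).le_opNorm I).trans ?_
      simpa using hdb n z
    set p := fderiv ℝ (η n) z 1
    set q := fderiv ℝ (η n) z I
    set c := C / (n + 1 : ℝ)
    have e3 : p ^ 2 ≤ c ^ 2 := sq_le_sq' (neg_le_of_abs_le e1) (le_of_abs_le e1)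
    have e4 : q ^ 2 ≤ c ^ 2 := sq_le_sq' (neg_le_of_abs_le e2) (le_of_abs_le e2)
    have amgm : ∀ a b : ℝ, |a * b| ≤ δ * a ^ 2 + (1 / δ) * b ^ 2 := by
      intro a b
      have h3 : (1 / δ) * b ^ 2 = δ * (b / δ) ^ 2 := by field_simp
      have h4 : a * b = δ * (a * (b / δ)) := by field_simp
      rw [h3, h4, abs_mul, abs_of_pos hδ, ← mul_add]
      gcongr
      rw [abs_le]; constructor <;> nlinarith [sq_nonneg (a + b / δ), sq_nonneg (a - b / δ), sq_nonneg a, sq_nonneg (b/δ)]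
    calc ‖p * X z + q * Y z‖ ≤ |p * X z| + |q * Y z| := abs_add_le _ _
      _ ≤ (δ * p ^ 2 + (1 / δ) * X z ^ 2) + (δ * q ^ 2 + (1 / δ) * Y z ^ 2) := add_le_add (amgm _ _) (amgm _ _)
      _ ≤ (δ * c ^ 2 + (1 / δ) * X z ^ 2) + (δ * c ^ 2 + (1 / δ) * Y z ^ 2) := by gcongr
      _ = _ := by simp only [R]; ring
  have key2 : ∀ δ : ℝ, 0 < δ → ‖∫ z, (fderiv ℝ X z 1 + fderiv ℝ Y z I)‖ ≤ δ * (2 * C ^ 2 * (4 * V)) := by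
    intro δ hδ
    have := le_of_tendsto_of_tendsto' lim1.norm ((lim2.const_mul (1 / δ)).const_add _) (key δ hδ)
    simpa using this
  rw [← norm_le_zero_iff]
  refine ge_of_tendsto (x := 𝓝[>] (0 : ℝ)) (f := fun δ => δ * (2 * C ^ 2 * (4 * V))) ?_ ?_
  · have : Tendsto (fun δ : ℝ => δ * (2 * C ^ 2 * (4 * V))) (𝓝 0) (𝓝 (0 * (2 * C ^ 2 * (4 * V)))) :=
      tendsto_id.mul_const _
    rw [zero_mul] at this
    exact this.mono_left nhdsWithin_le_nhds
  · filter_upwards [self_mem_nhdsWithin] with δ hδ using key2 δ hδ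

theorem jac_lemma {a b : ℂ → ℝ} (ha : ContDiff ℝ 1 a) (hb : ContDiff ℝ 2 b)
    (i1 : Integrable (fun z => (a z * fderiv ℝ b z 1) ^ 2))
    (i2 : Integrable (fun z => (a z * fderiv ℝ b z I) ^ 2))
    (iD : Integrable (fun z => fderiv ℝ a z 1 * fderiv ℝ b z I - fderiv ℝ a z I * fderiv ℝ b z 1)) :
    ∫ z, (fderiv ℝ a z 1 * fderiv ℝ b z I - fderiv ℝ a z I * fderiv ℝ b z 1) = 0 := by
  have hdb : ∀ e : ℂ, ContDiff ℝ 1 fun z => fderiv ℝ b z e := fun e =>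
    (hb.fderiv_right (m := 1) (by norm_num)).clm_apply contDiff_const
  have hda : ∀ z, HasFDerivAt a (fderiv ℝ a z) z := fun z =>
    (ha.contDiffAt.differentiableAt (by simp)).hasFDerivAt
  have hdd : ∀ e z, HasFDerivAt (fun z => fderiv ℝ b z e) (fderiv ℝ (fun z => fderiv ℝ b z e) z) z := fun e z =>
    ((hdb e).contDiffAt.differentiableAt (by simp)).hasFDerivAt
  have hsy : ∀ z, fderiv ℝ (fun z => fderiv ℝ b z I) z 1 = fderiv ℝ (fun z => fderiv ℝ b z 1) z I := by
    intro z
    have hs := (hb.contDiffAt (x := z)).isSymmSndFDerivAt (by simp)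
    have hd : DifferentiableAt ℝ (fderiv ℝ b) z :=
      (hb.fderiv_right (m := 1) (by norm_num)).contDiffAt.differentiableAt (by simp)
    have e : ∀ a c : ℂ, fderiv ℝ (fun w => fderiv ℝ b w a) z c = fderiv ℝ (fderiv ℝ b) z c a := by
      intro a c
      rw [(hd.hasFDerivAt.clm_apply (hasFDerivAt_const a z)).fderiv]; simp
    rw [e, e]; exact hs 1 I
  have key : ∀ z, fderiv ℝ (fun z => a z * fderiv ℝ b z I) z 1 + fderiv ℝ (fun z => - (a z * fderiv ℝ b z 1)) z I
      = fderiv ℝ a z 1 * fderiv ℝ b z I - fderiv ℝ a z I * fderiv ℝ b z 1 := by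
    intro z
    rw [((hda z).fun_mul (hdd I z)).fderiv, ((hda z).fun_mul (hdd 1 z)).fun_neg.fderiv]
    simp only [ContinuousLinearMap.add_apply, ContinuousLinearMap.smul_apply, ContinuousLinearMap.neg_apply, smul_eq_mul, hsy]
    ring
  have := div_lemma (X := fun z => a z * fderiv ℝ b z I) (Y := fun z => - (a z * fderiv ℝ b z 1))
    (ha.mul (hdb I)) (ha.mul (hdb 1)).neg i2 (by simpa using i1) (by simpa only [key] using iD)
  simpa only [key] using this

end SRM

namespace SRM
open Complex Filter Topology

/-- smooth with compact support -/
structure Cc (f : ℂ → ℂ) : Prop where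
  s : Smo f
  c : HasCompactSupport f

namespace Cc
variable {f g : ℂ → ℂ}
lemma add (hf : Cc f) (hg : Cc g) : Cc (fun z => f z + g z) := ⟨hf.s.add hg.s, hf.c.add hg.c⟩
lemma sub (hf : Cc f) (hg : Cc g) : Cc (fun z => f z - g z) := ⟨hf.s.sub hg.s, hf.c.sub hg.c⟩
lemma mul_s (hf : Cc f) (hg : Smo g) : Cc (fun z => f z * g z) := ⟨hf.s.mul hg, hf.c.mul_right⟩
lemma s_mul (hf : Smo f) (hg : Cc g) : Cc (fun z => f z * g z) := ⟨hf.mul hg.s, hg.c.mul_left⟩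
lemma fd (hf : Cc f) (e : ℂ) : Cc (fun z => fderiv ℝ f z e) := ⟨smo_fd hf.s e, cs_fd hf.c e⟩
lemma wd (hf : Cc f) : Cc (wderiv f) := ⟨smo_wd hf.s, cs_wd hf.c⟩
lemma wdb (hf : Cc f) : Cc (wderivBar f) := ⟨smo_wdb hf.s, cs_wdb hf.c⟩
lemma int (hf : Cc f) : Integrable f := hf.s.continuous.integrable_of_hasCompactSupport hf.c
lemma zero : Cc (fun _ => 0) := ⟨contDiff_const, HasCompactSupport.zero⟩
end Cc

/-- Cauchy kernel -/
noncomputable def K (w : ℂ) : ℂ := ((Real.pi : ℂ) * w)⁻¹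

lemma K_norm (w : ℂ) : ‖K w‖ = Real.pi⁻¹ * ‖w‖⁻¹ := by
  rw [K, norm_inv, norm_mul, mul_inv, norm_real, Real.norm_of_nonneg Real.pi_pos.le]

lemma K_meas : Measurable K := (measurable_const.mul measurable_id).inv

lemma K_li : LocallyIntegrable K := by
  refine locallyIntegrable_of_norm_le_rpow (C := Real.pi⁻¹) (α := 1) ?_ ?_ ?_ K_meas.aestronglyMeasurable
  · simp
  · simp
  · refine Eventually.of_forall fun x => ?_
    rw [K_norm, Real.rpow_neg_one]

lemma pompeiu0 {g : ℂ → ℂ} (hg : Cc g) : ∫ w, K w * wderivBar g w = - g 0 := by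
  rw [← Complex.integral_comp_polarCoord_symm]
  let P : ℝ × ℝ → ℂ := fun p => p.1 * exp (p.2 * I)
  have hP : ∀ p : ℝ × ℝ, Complex.polarCoord.symm p = P p := by
    intro p; rw [Complex.polarCoord_symm_apply, ofReal_cos, ofReal_sin, ← exp_mul_I]
  let A : ℝ × ℝ → ℂ := fun p => fderiv ℝ g (P p) (exp (p.2 * I))
  let B : ℝ × ℝ → ℂ := fun p => fderiv ℝ g (P p) (I * exp (p.2 * I))
  have cP : Continuous P := by fun_prop
  have cfd := hg.s.continuous_fderiv (by simp)
  have cA : Continuous A := (cfd.comp cP).clm_apply (by fun_prop)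
  have cB : Continuous B := (cfd.comp cP).clm_apply (by fun_prop)
  obtain ⟨R, hR⟩ : ∃ R : ℝ, ∀ z, R ≤ ‖z‖ → fderiv ℝ g z = 0 ∧ g z = 0 := by
    obtain ⟨R, hR⟩ := hg.c.isCompact.isBounded.exists_norm_le
    refine ⟨R + 1, fun z hz => ?_⟩
    have hz' : z ∉ tsupport g := fun h => by linarith [hR z h]
    exact ⟨by rw [← Function.notMem_support]; exact fun h => hz' (support_fderiv_subset ℝ h),
      image_eq_zero_of_notMem_tsupport hz'⟩
  have nP : ∀ p : ℝ × ℝ, ‖P p‖ = |p.1| := by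
    intro p; simp only [P, norm_mul, norm_real, Real.norm_eq_abs, norm_exp_ofReal_mul_I, mul_one]
  have zA : ∀ p : ℝ × ℝ, R ≤ p.1 → A p = 0 := by
    intro p hp; simp only [A]; rw [(hR _ ((nP p).symm ▸ hp.trans (le_abs_self _))).1]; simp
  have zB : ∀ p : ℝ × ℝ, R ≤ p.1 → B p = 0 := by
    intro p hp; simp only [B]; rw [(hR _ ((nP p).symm ▸ hp.trans (le_abs_self _))).1]; simp
  have iAll : ∀ A : ℝ × ℝ → ℂ, Continuous A → (∀ p : ℝ × ℝ, R ≤ p.1 → A p = 0) →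
      IntegrableOn A (Set.Ioi 0 ×ˢ Set.Ioo (-Real.pi) Real.pi) := by
    intro A cA zA
    have h1 : IntegrableOn A ((Set.Icc 0 R) ×ˢ (Set.Icc (-Real.pi) Real.pi)) :=
      cA.continuousOn.integrableOn_compact (isCompact_Icc.prod isCompact_Icc)
    refine h1.of_forall_sdiff_eq_zero (measurableSet_Ioi.prod measurableSet_Ioo) ?_
    rintro ⟨r, θ⟩ ⟨⟨h1, h2⟩, h3⟩
    apply zA
    by_contra hr
    apply h3
    simp only [Set.mem_Ioi, Set.mem_Ioo] at h1 h2
    exact ⟨⟨h1.le, (not_le.1 hr).le⟩, ⟨h2.1.le, h2.2.le⟩⟩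
  have iA := iAll A cA zA
  have iB := iAll B cB zB
  have hG : ∀ r θ : ℝ, HasDerivAt (fun s : ℝ => g (P (s, θ))) (A (r, θ)) r := by
    intro r θ
    have h1 : HasDerivAt (fun s : ℝ => P (s, θ)) (exp (θ * I)) r := by
      have := (ofRealCLM.hasDerivAt (x := r)).mul_const (exp (θ * I))
      simpa [P] using this
    exact ((hg.s.da (P (r, θ))).hasFDerivAt).comp_hasDerivAt r h1
  have hH : ∀ r θ : ℝ, HasDerivAt (fun s : ℝ => g (P (r, s))) (r * B (r, θ)) θ := by
    intro r θ
    have h1 : HasDerivAt (fun s : ℝ => P (r, s)) (r * (I * exp (θ * I))) θ := by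
      have h2 : HasDerivAt (fun s : ℝ => (s : ℂ) * I) (1 * I) θ := (ofRealCLM.hasDerivAt (x := θ)).mul_const I
      have := (h2.cexp).const_mul (r : ℂ)
      refine this.congr_deriv ?_; ring
    have := ((hg.s.da (P (r, θ))).hasFDerivAt).comp_hasDerivAt θ h1
    refine this.congr_deriv ?_
    simp only [B]
    rw [← real_smul, map_smul, real_smul]
  have int1 : ∀ θ : ℝ, ∫ r in Set.Ioi (0 : ℝ), A (r, θ) = - g 0 := by
    intro θ
    have : ∫ r in Set.Ioi (0 : ℝ), A (r, θ) = 0 - g (P (0, θ)) := by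
      refine integral_Ioi_of_hasDerivAt_of_tendsto (hG 0 θ).continuousAt.continuousWithinAt (fun r _ => hG r θ) ?_ ?_
      · have h1 : IntegrableOn (fun r => A (r, θ)) (Set.Icc 0 R) :=
          (cA.comp (by fun_prop : Continuous fun r : ℝ => (r, θ))).continuousOn.integrableOn_compact isCompact_Icc
        refine h1.of_forall_sdiff_eq_zero measurableSet_Ioi ?_
        rintro r ⟨h1, h2⟩
        apply zA
        by_contra hr
        exact h2 ⟨le_of_lt h1, (not_le.1 hr).le⟩
      · refine tendsto_const_nhds.congr' ?_
        filter_upwards [eventually_ge_atTop R] with r hr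
        exact (hR _ ((nP (r, θ)).symm ▸ hr.trans (le_abs_self _))).2.symm
    rw [this]; simp [P]
  have int2 : ∀ r : ℝ, 0 < r → ∫ θ in Set.Ioo (-Real.pi) Real.pi, B (r, θ) = 0 := by
    intro r hr
    rw [← integral_Ioc_eq_integral_Ioo, ← intervalIntegral.integral_of_le (by linarith [Real.pi_pos])]
    have cB' : Continuous fun θ : ℝ => B (r, θ) := cB.comp (by fun_prop)
    have h : ∫ θ in (-Real.pi)..Real.pi, r * B (r, θ) = g (P (r, Real.pi)) - g (P (r, -Real.pi)) :=
      intervalIntegral.integral_eq_sub_of_hasDerivAt (fun θ _ => hH r θ)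
        ((continuous_const.mul cB').intervalIntegrable _ _)
    have hPP : P (r, Real.pi) = P (r, -Real.pi) := by
      simp only [P, exp_pi_mul_I]
      rw [show ((-Real.pi : ℝ) : ℂ) * I = -(Real.pi * I) by push_cast; ring, exp_neg, exp_pi_mul_I]; norm_num
    rw [hPP, sub_self, intervalIntegral.integral_const_mul] at h
    exact (mul_eq_zero.1 h).resolve_left (by exact_mod_cast hr.ne')
  have IA : ∫ p in (Set.Ioi (0:ℝ) ×ˢ Set.Ioo (-Real.pi) Real.pi), A p = (2 * Real.pi) * (- g 0) := by
    rw [Measure.volume_eq_prod, ← setIntegral_prod_swap, setIntegral_prod]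
    · simp only [Prod.swap_prod_mk, int1, setIntegral_const]
      rw [Measure.real, Real.volume_Ioo, ENNReal.toReal_ofReal (by linarith [Real.pi_pos]), real_smul]
      push_cast; ring
    · have := iA
      rw [IntegrableOn, Measure.volume_eq_prod, ← Measure.prod_restrict] at this
      rw [IntegrableOn, ← Measure.prod_restrict]
      exact this.swap
  have IB : ∫ p in (Set.Ioi (0:ℝ) ×ˢ Set.Ioo (-Real.pi) Real.pi), B p = 0 := by
    rw [Measure.volume_eq_prod, setIntegral_prod _ iB]
    rw [setIntegral_congr_fun (g := fun _ => 0) measurableSet_Ioi (fun r hr => int2 r hr)]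
    simp
  have hint : ∀ p ∈ (Set.Ioi (0:ℝ) ×ˢ Set.Ioo (-Real.pi) Real.pi),
      p.1 • (K (Complex.polarCoord.symm p) * wderivBar g (Complex.polarCoord.symm p)) =
      (2 * Real.pi : ℂ)⁻¹ * (A p + I * B p) := by
    rintro ⟨r, θ⟩ ⟨hr, -⟩
    have hr : (r : ℂ) ≠ 0 := by exact_mod_cast (ne_of_gt hr)
    rw [hP]
    simp only [A, B, fd_eq, P, K, map_mul, conj_I, real_smul]
    have he : (starRingEnd ℂ) (exp (θ * I)) = (exp (θ * I))⁻¹ := by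
      rw [← exp_conj, ← exp_neg]; simp
    have h0 := exp_ne_zero (θ * I)
    rw [he]
    generalize exp (θ * I) = E at *
    have hpi : (Real.pi : ℂ) ≠ 0 := by exact_mod_cast Real.pi_ne_zero
    field_simp
    linear_combination (wderivBar g (r * E) - wderiv g (r * E) * E ^ 2) * I_sq
  rw [polarCoord_target, setIntegral_congr_fun (measurableSet_Ioi.prod measurableSet_Ioo) hint,
    integral_const_mul, integral_add iA (iB.const_mul I), integral_const_mul, IA, IB]
  have hpi : (Real.pi : ℂ) ≠ 0 := by exact_mod_cast Real.pi_ne_zero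
  field_simp; simp

open scoped Convolution in
/-- Cauchy transform -/
noncomputable def CT (f : ℂ → ℂ) : ℂ → ℂ := K ⋆[ContinuousLinearMap.mul ℝ ℂ, volume] f

lemma CT_def (f : ℂ → ℂ) (z : ℂ) : CT f z = ∫ w, K w * f (z - w) := rfl

lemma CT_def2 (f : ℂ → ℂ) (z : ℂ) : CT f z = ∫ w, K (z - w) * f w := by
  rw [CT, convolution_eq_swap]; rfl

lemma CT_int {f : ℂ → ℂ} (hf : Continuous f) (hc : HasCompactSupport f) (z : ℂ) :
    Integrable (fun w => K w * f (z - w)) :=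
  hc.convolutionExists_right (ContinuousLinearMap.mul ℝ ℂ) K_li hf z

lemma CT_int2 {f : ℂ → ℂ} (hf : Continuous f) (hc : HasCompactSupport f) (z : ℂ) :
    Integrable (fun w => K (z - w) * f w) := by
  have := (CT_int hf hc z).comp_sub_left z
  simpa using this

lemma CT_smo {f : ℂ → ℂ} (hf : Cc f) : Smo (CT f) :=
  hf.c.contDiff_convolution_right _ K_li hf.s

lemma CT_fd {f : ℂ → ℂ} (hf : Cc f) (z e : ℂ) :
    fderiv ℝ (CT f) z e = CT (fun w => fderiv ℝ f w e) z := by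
  have h1 : ContDiff ℝ 1 f := hf.s.of_le (by simp)
  have := hf.c.hasFDerivAt_convolution_right (ContinuousLinearMap.mul ℝ ℂ) K_li h1 z
  rw [CT, this.fderiv, convolution_precompR_apply _ K_li (hf.c.fderiv ℝ) (hf.s.continuous_fderiv (by simp))]
  rfl

lemma CT_add {f g : ℂ → ℂ} (hf : Cc f) (hg : Cc g) (z : ℂ) :
    CT (fun w => f w + g w) z = CT f z + CT g z := by
  simp only [CT_def, mul_add]
  exact integral_add (CT_int hf.s.continuous hf.c z) (CT_int hg.s.continuous hg.c z)

lemma CT_sub {f g : ℂ → ℂ} (hf : Cc f) (hg : Cc g) (z : ℂ) :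
    CT (fun w => f w - g w) z = CT f z - CT g z := by
  simp only [CT_def, mul_sub]
  exact integral_sub (CT_int hf.s.continuous hf.c z) (CT_int hg.s.continuous hg.c z)

lemma CT_const_mul (c : ℂ) (f : ℂ → ℂ) (z : ℂ) :
    CT (fun w => c * f w) z = c * CT f z := by
  simp only [CT_def, mul_left_comm _ c]
  exact integral_const_mul _ _

lemma CT_wd {f : ℂ → ℂ} (hf : Cc f) (z : ℂ) : wderiv (CT f) z = CT (wderiv f) z := by
  rw [wderiv, CT_fd hf, CT_fd hf, ← CT_const_mul, ← CT_sub (hf.fd 1) (Cc.s_mul contDiff_const (hf.fd I)),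
    div_eq_inv_mul, ← CT_const_mul]
  congr 1; ext w; rw [wderiv]; ring

lemma CT_wdb' {f : ℂ → ℂ} (hf : Cc f) (z : ℂ) : wderivBar (CT f) z = CT (wderivBar f) z := by
  rw [wderivBar, CT_fd hf, CT_fd hf, ← CT_const_mul, ← CT_add (hf.fd 1) (Cc.s_mul contDiff_const (hf.fd I)),
    div_eq_inv_mul, ← CT_const_mul]
  congr 1; ext w; rw [wderivBar]; ring

lemma CT_of_wdb {f : ℂ → ℂ} (hf : Cc f) (z : ℂ) : CT (wderivBar f) z = f z := by
  have hfl : ∀ w, HasFDerivAt (fun w => z - w) (-(ContinuousLinearMap.id ℝ ℂ)) w := fun w => by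
    simpa using (hasFDerivAt_id w).const_sub z
  have hg : Cc (fun w => f (z - w)) := ⟨hf.s.comp (contDiff_const.sub contDiff_id),
    hf.c.comp_homeomorph (Homeomorph.subLeft z)⟩
  have h := pompeiu0 hg
  have h2 : ∀ w, wderivBar (fun w => f (z - w)) w = - wderivBar f (z - w) := by
    intro w
    have := (hf.s.da (z - w)).hasFDerivAt.comp w (hfl w)
    have : HasFDerivAt (fun w => f (z - w)) _ w := this
    rw [wdb_of this, wderivBar]
    simp; ring
  simp only [h2, mul_neg, integral_neg, neg_inj, sub_zero] at h
  rw [CT_def, h]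

lemma CT_wdb {f : ℂ → ℂ} (hf : Cc f) (z : ℂ) : wderivBar (CT f) z = f z := by
  rw [CT_wdb' hf, CT_of_wdb hf]

end SRM

namespace SRM
open Complex Filter Topology

lemma Cc.ball {f : ℂ → ℂ} (hf : HasCompactSupport f) : ∃ R : ℝ, 1 ≤ R ∧ ∀ z, R ≤ ‖z‖ → f z = 0 := by
  obtain ⟨R, hR⟩ := hf.isCompact.isBounded.exists_norm_le
  refine ⟨max 1 (R + 1), le_max_left _ _, fun z hz => ?_⟩
  have hz1 : R + 1 ≤ ‖z‖ := (le_max_right _ _).trans hz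
  exact image_eq_zero_of_notMem_tsupport fun h => by linarith [hR z h]

lemma fd_re {f : ℂ → ℂ} {z : ℂ} (hf : DifferentiableAt ℝ f z) (e : ℂ) :
    fderiv ℝ (fun z => (f z).re) z e = (fderiv ℝ f z e).re := by
  have : HasFDerivAt (fun z => (f z).re) _ z := (reCLM.hasFDerivAt).comp z hf.hasFDerivAt
  rw [this.fderiv]; simp

lemma fd_im {f : ℂ → ℂ} {z : ℂ} (hf : DifferentiableAt ℝ f z) (e : ℂ) :
    fderiv ℝ (fun z => (f z).im) z e = (fderiv ℝ f z e).im := by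
  have : HasFDerivAt (fun z => (f z).im) _ z := (imCLM.hasFDerivAt).comp z hf.hasFDerivAt
  rw [this.fderiv]; simp

theorem jac_zero {f : ℂ → ℂ} (hf : Smo f) {B : ℝ} (hB : ∀ z, ‖f z‖ ≤ B)
    (i1 : Integrable (fun z => ‖wderiv f z‖ ^ 2)) (i2 : Integrable (fun z => ‖wderivBar f z‖ ^ 2)) :
    ∫ z, Jac f z = 0 := by
  have hre : Smo (fun z => (f z).re) := reCLM.contDiff.comp hf
  have him : Smo (fun z => (f z).im) := imCLM.contDiff.comp hf
  have hB0 : 0 ≤ B := (norm_nonneg _).trans (hB 0)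
  have hJ : ∀ z, fderiv ℝ (fun z => (f z).re) z 1 * fderiv ℝ (fun z => (f z).im) z I
      - fderiv ℝ (fun z => (f z).re) z I * fderiv ℝ (fun z => (f z).im) z 1 = Jac f z := by
    intro z
    rw [fd_re (hf.da z), fd_re (hf.da z), fd_im (hf.da z), fd_im (hf.da z), ← clm_det, det_fd]
  have h2 : (2 : WithTop ℕ∞) ≤ ((⊤ : ℕ∞) : WithTop ℕ∞) := by
    simpa using (WithTop.coe_le_coe.2 (le_top : (2 : ℕ∞) ≤ ⊤))
  have hi : ∀ e : ℂ, ‖e‖ = 1 → Integrable (fun z => ((f z).re * fderiv ℝ (fun z => (f z).im) z e) ^ 2) := by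
    intro e he
    refine Integrable.mono' ((i1.add i2).const_mul (2 * B ^ 2)) ?_ (Eventually.of_forall fun z => ?_)
    · refine Continuous.aestronglyMeasurable ?_
      exact (hre.continuous.mul ((him.continuous_fderiv (by simp)).clm_apply continuous_const)).pow 2
    · rw [fd_im (hf.da z), Real.norm_of_nonneg (sq_nonneg _), mul_pow]
      have h1 : (f z).re ^ 2 ≤ B ^ 2 := sq_le_sq' (neg_le_of_abs_le ((abs_re_le_norm _).trans (hB z)))
        (le_of_abs_le ((abs_re_le_norm _).trans (hB z)))
      have h2 : |(fderiv ℝ f z e).im| ≤ ‖wderiv f z‖ + ‖wderivBar f z‖ := by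
        refine (abs_im_le_norm _).trans (((fderiv ℝ f z).le_opNorm e).trans ?_)
        rw [he, mul_one]; exact norm_fd_le f z
      have h3 := sq_le_sq' (neg_le_of_abs_le h2) (le_of_abs_le h2)
      simp only [Pi.add_apply]
      calc _ ≤ B ^ 2 * (‖wderiv f z‖ + ‖wderivBar f z‖) ^ 2 := by gcongr
        _ ≤ B ^ 2 * (2 * (‖wderiv f z‖ ^ 2 + ‖wderivBar f z‖ ^ 2)) := by
          gcongr; nlinarith [sq_nonneg (‖wderiv f z‖ - ‖wderivBar f z‖)]
        _ = _ := by ring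
  have := jac_lemma (a := fun z => (f z).re) (b := fun z => (f z).im) (hre.of_le (by simp)) (him.of_le h2)
    (hi 1 (by simp)) (hi I (by simp)) (by simp only [hJ]; exact i1.sub i2)
  simpa only [hJ] using this

lemma CT_bdd {f : ℂ → ℂ} (hf : Cc f) : ∃ B, ∀ z, ‖CT f z‖ ≤ B := by
  obtain ⟨R, hR1, hR⟩ := Cc.ball hf.c
  obtain ⟨M, hM⟩ := (isCompact_closedBall (0 : ℂ) (2 * R)).exists_bound_of_continuousOn (CT_smo hf).continuous.continuousOn
  refine ⟨max M (∫ w, Real.pi⁻¹ * ‖f w‖), fun z => ?_⟩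
  rcases le_or_gt ‖z‖ (2 * R) with hz | hz
  · exact (hM z (by simpa using hz)).trans (le_max_left _ _)
  · refine le_trans ?_ (le_max_right _ _)
    rw [CT_def2]
    refine norm_integral_le_of_norm_le (hf.int.norm.const_mul _) (Eventually.of_forall fun w => ?_)
    rcases le_or_gt R ‖w‖ with hw | hw
    · simp [hR w hw]
    · rw [norm_mul, K_norm]
      have h1 : R ≤ ‖z - w‖ := by linarith [norm_sub_norm_le z w]
      have : ‖z - w‖⁻¹ ≤ 1 := inv_le_one_of_one_le₀ (hR1.trans h1)
      gcongr
      exact mul_le_of_le_one_right (inv_nonneg.2 Real.pi_pos.le) this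

lemma int_fd {f : ℂ → ℂ} (hf : Cc f) (e : ℂ) : ∫ z, fderiv ℝ f z e = 0 := by
  have := integral_smul_fderiv_eq_neg_fderiv_smul_of_integrable (μ := volume) (𝕜 := ℝ) (f := fun _ : ℂ => (1 : ℝ)) (g := f) (v := e)
    (by simp) (by simpa using (hf.fd e).int) (by simpa using hf.int)
    (fun z _ => differentiableAt_const _) (fun z _ => hf.s.da z)
  simpa using this

lemma CT_fd_decay {f : ℂ → ℂ} (hf : Cc f) (e : ℂ) : ∃ A, ∀ z, ‖CT (fun w => fderiv ℝ f w e) z‖ ≤ A * (1 + ‖z‖) ^ (-2 : ℝ) := by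
  obtain ⟨R, hR1, hR⟩ := Cc.ball (hf.fd e).c
  have hg := hf.fd e
  have h0 := int_fd hf e
  set g := fun w => fderiv ℝ f w e
  have hc : Continuous fun z => ‖CT g z‖ * (1 + ‖z‖) ^ 2 := by
    have := (CT_smo hg).continuous
    fun_prop
  obtain ⟨M, hM⟩ := (isCompact_closedBall (0 : ℂ) (2 * R)).exists_bound_of_continuousOn hc.continuousOn
  let D := ∫ w, (2 * R) * ‖g w‖
  refine ⟨max M (4 * D), fun z => ?_⟩
  have hz0 : 0 < 1 + ‖z‖ := by positivity
  rw [show (-2 : ℝ) = -((2 : ℕ) : ℝ) by norm_num, Real.rpow_neg hz0.le, Real.rpow_natCast, ← div_eq_mul_inv,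
    le_div_iff₀ (by positivity)]
  rcases le_or_gt ‖z‖ (2 * R) with hz | hz
  · exact ((le_abs_self _).trans (hM z (by simpa using hz))).trans (le_max_left _ _)
  · refine le_trans ?_ (le_max_right _ _)
    have hz1 : 1 ≤ ‖z‖ := by linarith
    have e1 : CT g z = ∫ w, (K (z - w) - K z) * g w := by
      simp only [sub_mul]
      rw [integral_sub (CT_int2 hg.s.continuous hg.c z) (hg.int.const_mul _), integral_const_mul, h0, CT_def2]
      simp
    have e2 : ‖CT g z‖ ≤ ∫ w, (‖z‖ ^ 2)⁻¹ * ((2 * R) * ‖g w‖) := by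
      rw [e1]
      refine norm_integral_le_of_norm_le ((hg.int.norm.const_mul _).const_mul _) (Eventually.of_forall fun w => ?_)
      rcases le_or_gt R ‖w‖ with hw | hw
      · have : g w = 0 := hR w hw
        simp [this]
      · rw [norm_mul, ← mul_assoc]
        gcongr
        have h1 : ‖z‖ / 2 ≤ ‖z - w‖ := by linarith [norm_sub_norm_le z w]
        have hpos : 0 < ‖z - w‖ := by linarith
        have hzne : z ≠ 0 := norm_pos_iff.1 (by linarith)
        have hzw : z - w ≠ 0 := norm_pos_iff.1 hpos
        have hpi : (Real.pi : ℂ) ≠ 0 := by exact_mod_cast Real.pi_ne_zero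
        have e3 : K (z - w) - K z = w * (K (z - w) * z⁻¹) := by
          simp only [K]; field_simp; ring
        rw [e3, norm_mul, norm_mul, K_norm, norm_inv]
        have h3 : Real.pi⁻¹ ≤ 1 := inv_le_one_of_one_le₀ (by linarith [Real.pi_gt_three])
        have h4 : ‖z - w‖⁻¹ ≤ 2 * ‖z‖⁻¹ := by
          rw [← div_eq_mul_inv, inv_le_comm₀ hpos (by positivity)]
          rw [inv_div]; exact h1
        calc ‖w‖ * (Real.pi⁻¹ * ‖z - w‖⁻¹ * ‖z‖⁻¹) ≤ R * (1 * (2 * ‖z‖⁻¹) * ‖z‖⁻¹) := by gcongr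
          _ = (‖z‖ ^ 2)⁻¹ * (2 * R) := by field_simp
    rw [integral_const_mul] at e2
    have hD : 0 ≤ D := integral_nonneg fun w => by positivity
    calc ‖CT g z‖ * (1 + ‖z‖) ^ 2 ≤ ((‖z‖ ^ 2)⁻¹ * D) * (‖z‖ + ‖z‖) ^ 2 := by gcongr
      _ = 4 * D := by field_simp; ring

lemma CT_fd_sq_int {f : ℂ → ℂ} (hf : Cc f) (e : ℂ) : Integrable (fun z => ‖CT (fun w => fderiv ℝ f w e) z‖ ^ 2) := by
  obtain ⟨A, hA⟩ := CT_fd_decay hf e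
  have hi : Integrable (fun z : ℂ => (1 + ‖z‖) ^ (-4 : ℝ)) := integrable_one_add_norm (by simp; norm_num)
  refine Integrable.mono' (hi.const_mul (A ^ 2)) ((CT_smo (hf.fd e)).continuous.norm.pow 2).aestronglyMeasurable
    (Eventually.of_forall fun z => ?_)
  rw [Real.norm_of_nonneg (sq_nonneg _)]
  have := pow_le_pow_left₀ (norm_nonneg _) (hA z) 2
  refine this.trans_eq ?_
  have hz0 : 0 < 1 + ‖z‖ := by positivity
  rw [mul_pow, ← Real.rpow_natCast ((1 + ‖z‖) ^ (-2 : ℝ)), ← Real.rpow_mul hz0.le]; norm_num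

lemma sq_add_int {u v : ℂ → ℂ} (hu : Continuous u) (hv : Continuous v) (iu : Integrable fun z => ‖u z‖ ^ 2)
    (iv : Integrable fun z => ‖v z‖ ^ 2) (a b : ℂ) : Integrable fun z => ‖a * u z + b * v z‖ ^ 2 := by
  refine Integrable.mono' ((iu.const_mul (2 * ‖a‖ ^ 2)).add (iv.const_mul (2 * ‖b‖ ^ 2))) (by fun_prop)
    (Eventually.of_forall fun z => ?_)
  rw [Real.norm_of_nonneg (sq_nonneg _)]
  have h1 := norm_add_le (a * u z) (b * v z)
  rw [norm_mul, norm_mul] at h1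
  have := pow_le_pow_left₀ (norm_nonneg _) h1 2
  simp only [Pi.add_apply]
  nlinarith [sq_nonneg (‖a‖ * ‖u z‖ - ‖b‖ * ‖v z‖)]

/-- Beurling transform -/
noncomputable def ST (f : ℂ → ℂ) : ℂ → ℂ := wderiv (CT f)

lemma ST_smo {f : ℂ → ℂ} (hf : Cc f) : Smo (ST f) := smo_wd (CT_smo hf)

lemma Cc.sq_int {f : ℂ → ℂ} (hf : Cc f) : Integrable fun z => ‖f z‖ ^ 2 :=
  (hf.s.continuous.norm.pow 2).integrable_of_hasCompactSupport
    (hf.c.mono fun z hz h => hz (by simp [h]))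

lemma ST_sq_int {f : ℂ → ℂ} (hf : Cc f) : Integrable fun z => ‖ST f z‖ ^ 2 := by
  have := sq_add_int (CT_smo (hf.fd 1)).continuous (CT_smo (hf.fd I)).continuous
    (CT_fd_sq_int hf 1) (CT_fd_sq_int hf I) (1 / 2) (- I / 2)
  refine this.congr (Eventually.of_forall fun z => ?_)
  simp only [ST, wderiv, CT_fd hf]
  congr 2; ring

theorem ST_iso {f : ℂ → ℂ} (hf : Cc f) : ∫ z, ‖ST f z‖ ^ 2 = ∫ z, ‖f z‖ ^ 2 := by
  obtain ⟨B, hB⟩ := CT_bdd hf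
  have h := jac_zero (CT_smo hf) hB (ST_sq_int hf) (by simpa only [CT_wdb hf] using hf.sq_int)
  simp only [Jac, CT_wdb hf] at h
  have h2 := integral_sub (ST_sq_int hf) hf.sq_int
  change ∫ z, (‖ST f z‖ ^ 2 - ‖f z‖ ^ 2) = 0 at h
  rw [h] at h2
  linarith

lemma ST_fd {f : ℂ → ℂ} (hf : Cc f) (z e : ℂ) : fderiv ℝ (ST f) z e = ST (fun w => fderiv ℝ f w e) z := by
  rw [ST, fd_wd (CT_smo hf), ST]
  congr 1; ext w; exact CT_fd hf w e

lemma ST_add {f g : ℂ → ℂ} (hf : Cc f) (hg : Cc g) (z : ℂ) :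
    ST (fun w => f w + g w) z = ST f z + ST g z := by
  rw [ST, ST, ST, ← wd_add ((CT_smo hf).da z) ((CT_smo hg).da z)]
  congr 1; ext w; exact CT_add hf hg w

lemma ST_sub {f g : ℂ → ℂ} (hf : Cc f) (hg : Cc g) (z : ℂ) :
    ST (fun w => f w - g w) z = ST f z - ST g z := by
  rw [ST, ST, ST, ← wd_sub ((CT_smo hf).da z) ((CT_smo hg).da z)]
  congr 1; ext w; exact CT_sub hf hg w

end SRM

namespace SRM
open Complex Filter Topology

/-- continuous and square integrable -/
structure L2 (f : ℂ → ℂ) : Prop where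
  c : Continuous f
  m : MemLp f 2 volume

/-- L2 norm -/
noncomputable def N (f : ℂ → ℂ) : ℝ := (eLpNorm f 2 volume).toReal

lemma N_nonneg (f : ℂ → ℂ) : 0 ≤ N f := ENNReal.toReal_nonneg

lemma L2.mk' {f : ℂ → ℂ} (hc : Continuous f) (hi : Integrable fun z => ‖f z‖ ^ 2) : L2 f :=
  ⟨hc, (memLp_two_iff_integrable_sq_norm hc.aestronglyMeasurable).2 hi⟩

lemma L2.int {f : ℂ → ℂ} (h : L2 f) : Integrable fun z => ‖f z‖ ^ 2 :=
  (memLp_two_iff_integrable_sq_norm h.c.aestronglyMeasurable).1 h.m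

lemma L2.N_sq {f : ℂ → ℂ} (h : L2 f) : N f ^ 2 = ∫ z, ‖f z‖ ^ 2 := by
  have h1 := h.m.eLpNorm_eq_integral_rpow_norm (by norm_num) (by norm_num)
  have h0 : 0 ≤ ∫ z, ‖f z‖ ^ 2 := integral_nonneg fun z => by positivity
  rw [N, h1]
  simp only [ENNReal.toReal_ofNat, Real.rpow_ofNat]
  rw [ENNReal.toReal_ofReal (by positivity), ← Real.rpow_natCast, ← Real.rpow_mul h0]
  norm_num

lemma N_congr {f g : ℂ → ℂ} (h : ∀ z, f z = g z) : N f = N g := by rw [funext h]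

lemma L2.add {f g : ℂ → ℂ} (hf : L2 f) (hg : L2 g) : L2 fun z => f z + g z := ⟨hf.c.add hg.c, hf.m.add hg.m⟩
lemma L2.sub {f g : ℂ → ℂ} (hf : L2 f) (hg : L2 g) : L2 fun z => f z - g z := ⟨hf.c.sub hg.c, hf.m.sub hg.m⟩

lemma L2.N_add {f g : ℂ → ℂ} (hf : L2 f) (hg : L2 g) : N (fun z => f z + g z) ≤ N f + N g := by
  rw [N, N, N, ← ENNReal.toReal_add hf.m.2.ne hg.m.2.ne]
  exact ENNReal.toReal_mono (ENNReal.add_ne_top.2 ⟨hf.m.2.ne, hg.m.2.ne⟩)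
    (eLpNorm_add_le hf.m.1 hg.m.1 (by norm_num))

lemma L2.N_sub {f g : ℂ → ℂ} (hf : L2 f) (hg : L2 g) : N (fun z => f z - g z) ≤ N f + N g := by
  rw [N, N, N, ← ENNReal.toReal_add hf.m.2.ne hg.m.2.ne]
  exact ENNReal.toReal_mono (ENNReal.add_ne_top.2 ⟨hf.m.2.ne, hg.m.2.ne⟩)
    (eLpNorm_sub_le hf.m.1 hg.m.1 (by norm_num))

lemma L2.N_le {f g : ℂ → ℂ} {c : ℝ} (hc : 0 ≤ c) (hg : L2 g) (h : ∀ z, ‖f z‖ ≤ c * ‖g z‖) : N f ≤ c * N g := by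
  have := eLpNorm_le_mul_eLpNorm_of_ae_le_mul (μ := volume) (Eventually.of_forall h) 2
  rw [N, N, ← ENNReal.toReal_ofReal hc, ← ENNReal.toReal_mul]
  exact ENNReal.toReal_mono (ENNReal.mul_ne_top ENNReal.ofReal_ne_top hg.m.2.ne) this

lemma L2.mono {f g : ℂ → ℂ} {c : ℝ} (hf : Continuous f) (hg : L2 g) (h : ∀ z, ‖f z‖ ≤ c * ‖g z‖) : L2 f :=
  ⟨hf, hg.m.of_le_mul hf.aestronglyMeasurable (Eventually.of_forall h)⟩

lemma Cc.L2 {f : ℂ → ℂ} (h : Cc f) : L2 f := L2.mk' h.s.continuous h.sq_int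
lemma ST_L2 {f : ℂ → ℂ} (h : Cc f) : L2 (ST f) := L2.mk' (ST_smo h).continuous (ST_sq_int h)
lemma N_ST {f : ℂ → ℂ} (h : Cc f) : N (ST f) = N f := by
  have : N (ST f) ^ 2 = N f ^ 2 := by rw [(ST_L2 h).N_sq, h.L2.N_sq, ST_iso h]
  exact (pow_left_inj₀ (N_nonneg _) (N_nonneg _) (by norm_num)).1 this

lemma Cc.bdd {f : ℂ → ℂ} (h : Cc f) : ∃ C, 0 ≤ C ∧ ∀ z, ‖f z‖ ≤ C := by
  obtain ⟨C, hC⟩ := h.c.exists_bound_of_continuous h.s.continuous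
  exact ⟨C, (norm_nonneg _).trans (hC 0), hC⟩

lemma mulS {m f : ℂ → ℂ} (hm : Cc m) (hf : Cc f) : Cc (fun z => m z * ST f z) := hm.mul_s (ST_smo hf)

lemma N_mulS {m f : ℂ → ℂ} {k : ℝ} (hk0 : 0 ≤ k) (hk : ∀ z, ‖m z‖ ≤ k) (hf : Cc f) :
    N (fun z => m z * ST f z) ≤ k * N f := by
  rw [← N_ST hf]
  refine (ST_L2 hf).N_le hk0 fun z => ?_
  rw [norm_mul]; gcongr; exact hk z

lemma fd_mulS {m f : ℂ → ℂ} (hm : Cc m) (hf : Cc f) (z e : ℂ) :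
    fderiv ℝ (fun z => m z * ST f z) z e =
      m z * ST (fun w => fderiv ℝ f w e) z + fderiv ℝ m z e * ST f z := by
  rw [((hm.s.da z).hasFDerivAt.fun_mul ((ST_smo hf).da z).hasFDerivAt).fderiv]
  simp [← ST_fd hf]; ring

lemma fd_add {f g : ℂ → ℂ} (hf : Smo f) (hg : Smo g) (z e : ℂ) :
    fderiv ℝ (fun z => f z + g z) z e = fderiv ℝ f z e + fderiv ℝ g z e := by
  rw [((hf.da z).hasFDerivAt.fun_add (hg.da z).hasFDerivAt).fderiv]; simp

/-- geometric decay of derivatives -/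
def GP (θ : ℝ) : ℕ → (ℕ → ℂ → ℂ) → Prop
  | 0, f => ∃ C, 0 ≤ C ∧ ∀ j, N (f j) ≤ C * θ ^ j
  | n + 1, f => GP θ n f ∧ ∀ e : ℂ, GP θ n (fun j z => fderiv ℝ (f j) z e)

lemma GP_add {θ : ℝ} (n : ℕ) : ∀ {f g : ℕ → ℂ → ℂ}, (∀ j, Cc (f j)) → (∀ j, Cc (g j)) →
    GP θ n f → GP θ n g → GP θ n (fun j z => f j z + g j z) := by
  induction n with
  | zero =>
    rintro f g hf hg ⟨C, hC, h1⟩ ⟨D, hD, h2⟩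
    refine ⟨C + D, by positivity, fun j => ?_⟩
    have := (hf j).L2.N_add (hg j).L2
    rw [add_mul]; linarith [h1 j, h2 j]
  | succ n ih =>
    rintro f g hf hg ⟨h1, h2⟩ ⟨h3, h4⟩
    refine ⟨ih hf hg h1 h3, fun e => ?_⟩
    have := ih (fun j => (hf j).fd e) (fun j => (hg j).fd e) (h2 e) (h4 e)
    simpa only [fd_add (hf _).s (hg _).s] using this

lemma GP_mulS {θ : ℝ} (n : ℕ) : ∀ {m : ℂ → ℂ} {f : ℕ → ℂ → ℂ}, Cc m → (∀ j, Cc (f j)) →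
    GP θ n f → GP θ n (fun j z => m z * ST (f j) z) := by
  induction n with
  | zero =>
    rintro m f hm hf ⟨C, hC, h1⟩
    obtain ⟨B, hB0, hB⟩ := hm.bdd
    refine ⟨B * C, by positivity, fun j => ?_⟩
    refine (N_mulS hB0 hB (hf j)).trans ?_
    rw [mul_assoc]; gcongr; exact h1 j
  | succ n ih =>
    rintro m f hm hf ⟨h1, h2⟩
    refine ⟨ih hm hf h1, fun e => ?_⟩
    simp only [fd_mulS hm (hf _)]
    exact GP_add n (fun j => mulS hm ((hf j).fd e)) (fun j => mulS (hm.fd e) (hf j))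
      (ih hm (fun j => (hf j).fd e) (h2 e)) (ih (hm.fd e) hf h1)

lemma GP_rec {θ k : ℝ} (hk0 : 0 ≤ k) (hkθ : k < θ) {m : ℂ → ℂ} (hm : Cc m) (hk : ∀ z, ‖m z‖ ≤ k) (n : ℕ) :
    ∀ {f r : ℕ → ℂ → ℂ}, (∀ j, Cc (f j)) → (∀ j, Cc (r j)) →
    (∀ j z, f (j + 1) z = m z * ST (f j) z + r j z) → GP θ n r → GP θ n f := by
  induction n with
  | zero =>
    rintro f r hf hr hrec ⟨C, hC, h1⟩
    have hθ : 0 < θ - k := by linarith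
    have hθ0 : 0 ≤ θ := by linarith
    refine ⟨max (N (f 0)) (C / (θ - k)), le_max_of_le_left (N_nonneg _), fun j => ?_⟩
    set D := max (N (f 0)) (C / (θ - k))
    have hD : C ≤ D * (θ - k) := by
      rw [← div_le_iff₀ hθ]; exact le_max_right _ _
    induction j with
    | zero => rw [pow_zero, mul_one]; exact le_max_left _ _
    | succ j ihj =>
      rw [N_congr (hrec j)]
      refine ((mulS hm (hf j)).L2.N_add (hr j).L2).trans ?_
      have h2 := N_mulS hk0 hk (hf j)
      have h3 : k * N (f j) ≤ k * (D * θ ^ j) := by gcongr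
      have h4 : C * θ ^ j ≤ D * (θ - k) * θ ^ j := by gcongr
      rw [pow_succ]
      linarith [h1 j]
  | succ n ih =>
    rintro f r hf hr hrec ⟨h1, h2⟩
    have h3 := ih hf hr hrec h1
    refine ⟨h3, fun e => ?_⟩
    refine ih (r := fun j z => fderiv ℝ m z e * ST (f j) z + fderiv ℝ (r j) z e) (fun j => (hf j).fd e)
      (fun j => (mulS (hm.fd e) (hf j)).add ((hr j).fd e)) ?_ ?_
    · intro j z
      rw [funext (hrec j), fd_add (mulS hm (hf j)).s (hr j).s, fd_mulS hm (hf j)]; ring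
    · exact GP_add n (fun j => mulS (hm.fd e) (hf j)) (fun j => (hr j).fd e)
        (GP_mulS n (hm.fd e) hf h3) (h2 e)

lemma sobolev1 {f : ℂ → ℂ} (hf : Cc f) (z : ℂ) :
    ‖f z‖ ≤ ∫ w, ‖fderiv ℝ (fun w => fderiv ℝ f w 1) w I‖ := by
  let g := fun w => fderiv ℝ f w 1
  let h := fun w => fderiv ℝ g w I
  have hg : Cc g := hf.fd 1
  have hh : Cc h := hg.fd I
  let E : ℝ → ℝ → ℂ := fun s t => ⟨s, t⟩
  have cE : Continuous fun p : ℝ × ℝ => E p.1 p.2 := equivRealProdCLM.symm.continuous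
  have line : ∀ {F : ℝ → ℂ} {F' : ℝ → ℂ}, (∀ x, HasDerivAt F (F' x) x) → HasCompactSupport F → Continuous F' →
      ∀ x, ‖F x‖ ≤ ∫ y, ‖F' y‖ := by
    intro F F' hF hFc hF' x
    have hd : deriv F = F' := funext fun x => (hF x).deriv
    have hC : ContDiff ℝ 1 F := contDiff_one_iff_deriv.2 ⟨fun x => (hF x).differentiableAt, by rw [hd]; exact hF'⟩
    rw [← hFc.integral_Iic_deriv_eq hC x, hd]
    refine (norm_integral_le_integral_norm _).trans (setIntegral_le_integral ?_ (Eventually.of_forall fun y => norm_nonneg _))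
    rw [← hd]
    exact ((hC.continuous_deriv le_rfl).integrable_of_hasCompactSupport hFc.deriv).norm
  have hE1 : ∀ t s, HasDerivAt (fun s : ℝ => E s t) 1 s := by
    intro t s
    have : (fun s : ℝ => E s t) = fun s : ℝ => (s : ℂ) + t * I := by
      ext s; apply Complex.ext <;> simp [E]
    rw [this]; simpa using (ofRealCLM.hasDerivAt (x := s)).add_const (t * I)
  have hE2 : ∀ s t, HasDerivAt (fun t : ℝ => E s t) I t := by
    intro s t
    have : (fun t : ℝ => E s t) = fun t : ℝ => (s : ℂ) + t * I := by
      ext s; apply Complex.ext <;> simp [E]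
    rw [this]; simpa using ((ofRealCLM.hasDerivAt (x := t)).mul_const I).const_add (s : ℂ)
  have cs1 : ∀ t, HasCompactSupport fun s => f (E s t) := by
    intro t
    obtain ⟨R, hR1, hR⟩ := Cc.ball hf.c
    refine HasCompactSupport.of_support_subset_isCompact (K := Set.Icc (-R) R) isCompact_Icc fun s hs => ?_
    by_contra h
    apply hs; apply hR
    refine le_trans ?_ (abs_re_le_norm _)
    by_contra h'
    exact h ⟨neg_le_of_abs_le (not_le.1 h').le, le_of_abs_le (not_le.1 h').le⟩
  have cs2 : ∀ s, HasCompactSupport fun t => g (E s t) := by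
    intro t
    obtain ⟨R, hR1, hR⟩ := Cc.ball hg.c
    refine HasCompactSupport.of_support_subset_isCompact (K := Set.Icc (-R) R) isCompact_Icc fun s hs => ?_
    by_contra h
    apply hs; apply hR
    refine le_trans ?_ (abs_im_le_norm _)
    by_contra h'
    exact h ⟨neg_le_of_abs_le (not_le.1 h').le, le_of_abs_le (not_le.1 h').le⟩
  have l1 : ‖f z‖ ≤ ∫ s, ‖g (E s z.im)‖ :=
    line (F := fun s => f (E s z.im)) (F' := fun s => g (E s z.im))
      (fun s => ((hf.s.da (E s z.im)).hasFDerivAt).comp_hasDerivAt s (hE1 z.im s)) (cs1 _)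
      (hg.s.continuous.comp (cE.comp (by fun_prop : Continuous fun s : ℝ => (s, z.im)))) z.re
  have l2 : ∀ s, ‖g (E s z.im)‖ ≤ ∫ t, ‖h (E s t)‖ := fun s =>
    line (F := fun t => g (E s t)) (F' := fun t => h (E s t))
      (fun t => ((hg.s.da (E s t)).hasFDerivAt).comp_hasDerivAt t (hE2 s t)) (cs2 _)
      (hh.s.continuous.comp (cE.comp (by fun_prop : Continuous fun t : ℝ => (s, t)))) z.im
  have e1 : ∫ w, ‖h w‖ = ∫ p : ℝ × ℝ, ‖h (E p.1 p.2)‖ :=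
    (volume_preserving_equiv_real_prod.symm.integral_comp measurableEquivRealProd.symm.measurableEmbedding
      (fun w => ‖h w‖)).symm
  have i1 : Integrable (fun p : ℝ × ℝ => ‖h (E p.1 p.2)‖) :=
    (volume_preserving_equiv_real_prod.symm.integrable_comp_emb
      measurableEquivRealProd.symm.measurableEmbedding).2 hh.int.norm
  change ‖f z‖ ≤ ∫ w, ‖h w‖
  rw [e1, Measure.volume_eq_prod, integral_prod _ i1]
  refine l1.trans (integral_mono_of_nonneg (Eventually.of_forall fun s => norm_nonneg _) i1.integral_prod_left
    (Eventually.of_forall l2))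

end SRM

namespace SRM
open Complex Filter Topology

lemma l1_ball (R : ℝ) : ∃ C, 0 ≤ C ∧ ∀ f : ℂ → ℂ, L2 f → ∫ w in Metric.closedBall (0 : ℂ) R, ‖f w‖ ≤ C * N f := by
  let ν := (volume : Measure ℂ).restrict (Metric.closedBall (0 : ℂ) R)
  have hν : ν Set.univ ≠ ⊤ := by
    simp only [ν, Measure.restrict_apply_univ]; exact measure_closedBall_lt_top.ne
  refine ⟨(ν Set.univ ^ (1 / 2 : ℝ)).toReal, ENNReal.toReal_nonneg, fun f hf => ?_⟩
  have h1 := eLpNorm_le_eLpNorm_mul_rpow_measure_univ (μ := ν) (p := 1) (q := 2) (f := f) (by norm_num)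
    hf.c.aestronglyMeasurable
  have h2 : eLpNorm f 2 ν ≤ eLpNorm f 2 volume := eLpNorm_mono_measure _ Measure.restrict_le_self
  rw [integral_norm_eq_lintegral_enorm hf.c.aestronglyMeasurable, ← eLpNorm_one_eq_lintegral_enorm, N,
    ← ENNReal.toReal_mul, mul_comm]
  refine ENNReal.toReal_mono (ENNReal.mul_ne_top hf.m.2.ne (ENNReal.rpow_ne_top_of_nonneg (by norm_num) hν)) ?_
  refine h1.trans ?_
  norm_num
  gcongr

lemma sobolev2 (R : ℝ) : ∃ C, 0 ≤ C ∧ ∀ f : ℂ → ℂ, Cc f → (∀ z, R ≤ ‖z‖ → f z = 0) → ∀ z,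
    ‖f z‖ ≤ C * N (fun w => fderiv ℝ (fun w => fderiv ℝ f w 1) w I) := by
  obtain ⟨C, hC, h⟩ := l1_ball R
  refine ⟨C, hC, fun f hf hR z => ?_⟩
  refine (sobolev1 hf z).trans (le_trans (le_of_eq ?_) (h _ ((hf.fd 1).fd I).L2))
  symm
  apply setIntegral_eq_integral_of_forall_compl_eq_zero
  intro w hw
  rw [Metric.mem_closedBall, dist_zero_right, not_le] at hw
  have hop : IsOpen {z : ℂ | R < ‖z‖} := isOpen_lt continuous_const continuous_norm
  have : f =ᶠ[𝓝 w] fun _ => 0 := by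
    filter_upwards [hop.mem_nhds hw] with y hy using hR y (le_of_lt hy)
  have h1 : (fun w => fderiv ℝ f w 1) =ᶠ[𝓝 w] fun _ => 0 := by
    filter_upwards [this.fderiv (𝕜 := ℝ)] with y hy
    rw [hy]; simp
  rw [h1.fderiv_eq]; simp

/-- nice sequence -/
structure Nice (θ R : ℝ) (f : ℕ → ℂ → ℂ) : Prop where
  cc : ∀ j, Cc (f j)
  su : ∀ j z, R ≤ ‖z‖ → f j z = 0
  gp : ∀ n, GP θ n f

lemma Nice.fd {θ R : ℝ} {f : ℕ → ℂ → ℂ} (h : Nice θ R f) (e : ℂ) :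
    Nice θ (R + 1) (fun j z => fderiv ℝ (f j) z e) := by
  refine ⟨fun j => (h.cc j).fd e, fun j z hz => ?_, fun n => (h.gp (n + 1)).2 e⟩
  have hop : IsOpen {z : ℂ | R < ‖z‖} := isOpen_lt continuous_const continuous_norm
  have : f j =ᶠ[𝓝 z] fun _ => 0 := by
    filter_upwards [hop.mem_nhds (show R < ‖z‖ by linarith)] with y hy using h.su j y (le_of_lt hy)
  rw [this.fderiv_eq]; simp

lemma Nice.bd {θ R : ℝ} {f : ℕ → ℂ → ℂ} (h : Nice θ R f) : ∃ C, 0 ≤ C ∧ ∀ j z, ‖f j z‖ ≤ C * θ ^ j := by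
  obtain ⟨C, hC, hs⟩ := sobolev2 R
  obtain ⟨D, hD, hg⟩ := ((h.gp 2).2 1).2 I
  refine ⟨C * D, by positivity, fun j z => ?_⟩
  refine (hs (f j) (h.cc j) (h.su j) z).trans ?_
  rw [mul_assoc]; gcongr; exact hg j

lemma norm_fd_le' (f : ℂ → ℂ) (z : ℂ) : ‖fderiv ℝ f z‖ ≤ ‖fderiv ℝ f z 1‖ + ‖fderiv ℝ f z I‖ := by
  refine (norm_fd_le f z).trans ?_
  have h1 : ‖wderiv f z‖ ≤ (‖fderiv ℝ f z 1‖ + ‖fderiv ℝ f z I‖) / 2 := by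
    rw [wderiv, norm_div]
    have := norm_sub_le (fderiv ℝ f z 1) (I * fderiv ℝ f z I)
    rw [norm_mul, norm_I, one_mul] at this
    norm_num; linarith
  have h2 : ‖wderivBar f z‖ ≤ (‖fderiv ℝ f z 1‖ + ‖fderiv ℝ f z I‖) / 2 := by
    rw [wderivBar, norm_div]
    have := norm_add_le (fderiv ℝ f z 1) (I * fderiv ℝ f z I)
    rw [norm_mul, norm_I, one_mul] at this
    norm_num; linarith
  linarith

lemma Nice.hasFD {θ R : ℝ} (h0 : 0 ≤ θ) (h1 : θ < 1) {f : ℕ → ℂ → ℂ} (h : Nice θ R f) :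
    (∀ z, Summable fun j => f j z) ∧ (∀ z, Summable fun j => fderiv ℝ (f j) z) ∧
    ∀ z, HasFDerivAt (fun z => ∑' j, f j z) (∑' j, fderiv ℝ (f j) z) z := by
  obtain ⟨C, hC, hb⟩ := h.bd
  obtain ⟨C1, hC1, hb1⟩ := (h.fd 1).bd
  obtain ⟨C2, hC2, hb2⟩ := (h.fd I).bd
  have hs := summable_geometric_of_lt_one h0 h1
  have hbd : ∀ j z, ‖fderiv ℝ (f j) z‖ ≤ (C1 + C2) * θ ^ j := by
    intro j z
    refine (norm_fd_le' _ z).trans ?_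
    rw [add_mul]; exact add_le_add (hb1 j z) (hb2 j z)
  refine ⟨fun z => (hs.mul_left C).of_norm_bounded (fun j => hb j z),
    fun z => (hs.mul_left (C1 + C2)).of_norm_bounded (fun j => hbd j z), fun z => ?_⟩
  exact hasFDerivAt_tsum (hs.mul_left (C1 + C2)) (fun j z => ((h.cc j).s.da z).hasFDerivAt) hbd
    ((hs.mul_left C).of_norm_bounded (fun j => hb j 0)) z

lemma Nice.smo {θ : ℝ} (h0 : 0 ≤ θ) (h1 : θ < 1) (n : ℕ) : ∀ {R : ℝ} {f : ℕ → ℂ → ℂ}, Nice θ R f →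
    ContDiff ℝ n (fun z => ∑' j, f j z) := by
  induction n with
  | zero =>
    intro R f h
    obtain ⟨-, -, hd⟩ := h.hasFD h0 h1
    exact contDiff_zero.2 (continuous_iff_continuousAt.2 fun z => (hd z).continuousAt)
  | succ n ih =>
    intro R f h
    obtain ⟨-, hs, hd⟩ := h.hasFD h0 h1
    push_cast
    rw [contDiff_succ_iff_fderiv]
    refine ⟨fun z => (hd z).differentiableAt, by simp, ?_⟩
    rw [contDiff_clm_apply_iff]
    intro e
    have : (fun z => fderiv ℝ (fun z => ∑' j, f j z) z e) = fun z => ∑' j, fderiv ℝ (f j) z e := by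
      ext z
      rw [(hd z).fderiv]
      exact (ContinuousLinearMap.apply ℝ ℂ e).map_tsum (hs z)
    rw [this]
    exact ih (h.fd e)

theorem solve {m g : ℂ → ℂ} {k : ℝ} (hm : Cc m) (hk : ∀ z, ‖m z‖ ≤ k) (hk1 : k < 1) (hg : Cc g) :
    ∃ q, Cc q ∧ ∀ z, q z = m z * ST q z + g z := by
  have hk0 : 0 ≤ k := (norm_nonneg _).trans (hk 0)
  obtain ⟨θ, hkθ, hθ1⟩ := exists_between hk1
  have hθ0 : 0 ≤ θ := by linarith
  let f : ℕ → ℂ → ℂ := fun j => Nat.rec g (fun _ u => fun z => m z * ST u z) j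
  have hf0 : f 0 = g := rfl
  have hfs : ∀ j, f (j + 1) = fun z => m z * ST (f j) z := fun j => rfl
  have hcc : ∀ j, Cc (f j) := by
    intro j
    induction j with
    | zero => exact hg
    | succ j ih => rw [hfs]; exact mulS hm ih
  obtain ⟨R1, hR11, hR1⟩ := Cc.ball hm.c
  obtain ⟨R2, hR21, hR2⟩ := Cc.ball hg.c
  have hsu : ∀ j z, max R1 R2 ≤ ‖z‖ → f j z = 0 := by
    intro j z hz
    cases j with
    | zero => exact hR2 z ((le_max_right _ _).trans hz)
    | succ j => rw [hfs]; simp [hR1 z ((le_max_left _ _).trans hz)]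
  have gz : ∀ n, GP θ n (fun _ _ => (0 : ℂ)) := by
    intro n
    induction n with
    | zero => exact ⟨0, le_rfl, fun j => by simp [N, show (fun _ : ℂ => (0 : ℂ)) = 0 from rfl]⟩
    | succ n ih => exact ⟨ih, fun e => by simpa using ih⟩
  have hN : Nice θ (max R1 R2) f := ⟨hcc, hsu, fun n =>
    GP_rec hk0 hkθ hm hk n hcc (fun _ => Cc.zero) (fun j z => by rw [hfs]; simp) (gz n)⟩
  obtain ⟨s1, s2, hd⟩ := hN.hasFD hθ0 hθ1
  let q := fun z => ∑' j, f j z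
  have hq : Cc q := by
    refine ⟨contDiff_infty.2 fun n => Nice.smo hθ0 hθ1 n hN, ?_⟩
    refine HasCompactSupport.of_support_subset_isCompact (isCompact_closedBall (0 : ℂ) (max R1 R2)) fun z hz => ?_
    by_contra h
    apply hz
    have : ∀ j, f j z = 0 := fun j => hsu j z (by simpa using (not_le.1 (by simpa using h : ¬ ‖z‖ ≤ max R1 R2)).le)
    simp [q, this]
  have hwd : ∀ z, HasSum (fun j => wderiv (f j) z) (wderiv q z) := by
    intro z
    have h1 : ∀ e, HasSum (fun j => fderiv ℝ (f j) z e) (fderiv ℝ q z e) := by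
      intro e
      have := (ContinuousLinearMap.apply ℝ ℂ e).hasSum (s2 z).hasSum
      simpa [q, (hd z).fderiv] using this
    exact (((h1 1).sub ((h1 I).mul_left I)).div_const 2)
  have hST : ∀ z, HasSum (fun j => ST (f j) z) (ST q z) := by
    intro z
    simp only [ST, CT_wd hq, CT_wd (hcc _), CT_def]
    obtain ⟨C1, hC1, hb1⟩ := (hN.fd 1).bd
    obtain ⟨C2, hC2, hb2⟩ := (hN.fd I).bd
    obtain ⟨χ, hχ⟩ : ∃ χ : ℂ → ℂ, Cc χ ∧ ∀ w, ‖w‖ ≤ max R1 R2 + 1 → χ w = 1 := by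
      have hpos : 0 < max R1 R2 + 1 := by linarith [le_max_left R1 R2]
      let b : ContDiffBump (0 : ℂ) := ⟨max R1 R2 + 1, max R1 R2 + 2, hpos, by linarith⟩
      refine ⟨fun w => ((b w : ℝ) : ℂ), ⟨ofRealCLM.contDiff.comp b.contDiff, ?_⟩, fun w hw => ?_⟩
      · exact b.hasCompactSupport.comp_left (g := ofReal) (by simp)
      · show ((b w : ℝ) : ℂ) = 1
        rw [b.one_of_mem_closedBall (by simpa using hw)]; simp
    have hint := (CT_int hχ.1.s.continuous hχ.1.c z).norm
    have hsm := summable_geometric_of_lt_one hθ0 hθ1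
    refine hasSum_integral_of_dominated_convergence
      (fun j w => ‖K w * χ (z - w)‖ * ((C1 + C2) * θ ^ j)) ?_ ?_ ?_ ?_ ?_
    · intro j
      exact (CT_int (hcc j).wd.s.continuous (hcc j).wd.c z).aestronglyMeasurable
    · intro j
      refine Eventually.of_forall fun w => ?_
      have h1 := (hN.fd 1).su j (z - w)
      have h2 := (hN.fd I).su j (z - w)
      rw [norm_mul, norm_mul, mul_assoc]
      gcongr
      rcases le_or_gt (max R1 R2 + 1) ‖z - w‖ with h | h
      · rw [wderiv, h1 h, h2 h]; simp; positivity
      · rw [hχ.2 _ h.le, norm_one, one_mul]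
        rw [wderiv, norm_div]
        have h3 := norm_sub_le (fderiv ℝ (f j) (z - w) 1) (I * fderiv ℝ (f j) (z - w) I)
        rw [norm_mul, norm_I, one_mul] at h3
        have := hb1 j (z - w)
        have := hb2 j (z - w)
        norm_num; nlinarith [norm_nonneg (fderiv ℝ (f j) (z - w) 1), norm_nonneg (fderiv ℝ (f j) (z - w) I)]
    · exact Eventually.of_forall fun w => (hsm.mul_left _).mul_left _
    · simp only [tsum_mul_left]
      exact hint.mul_const _
    · exact Eventually.of_forall fun w => (hwd _).mul_left _
  refine ⟨q, hq, fun z => ?_⟩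
  have h1 : q z = f 0 z + ∑' j, f (j + 1) z := (s1 z).tsum_eq_zero_add
  rw [h1, hf0, add_comm]
  congr 1
  simp only [hfs]
  exact ((hST z).mul_left (m z)).tsum_eq

lemma solve_N {m g q : ℂ → ℂ} {k : ℝ} (hm : Cc m) (hk : ∀ z, ‖m z‖ ≤ k) (hk1 : k < 1) (hg : L2 g) (hq : Cc q)
    (h : ∀ z, q z = m z * ST q z + g z) : N q ≤ N g / (1 - k) := by
  have hk0 : 0 ≤ k := (norm_nonneg _).trans (hk 0)
  have h1 := (mulS hm hq).L2.N_add hg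
  rw [← N_congr h] at h1
  have h2 := N_mulS hk0 hk hq
  rw [le_div_iff₀ (by linarith)]
  linarith

end SRM

namespace SRM
open Complex Filter Topology

lemma poincare {A B : ℂ → ℂ} (hA : Smo A) (hB : Smo B) (h : ∀ z, wderivBar A z = wderiv B z) :
    ∃ f, Smo f ∧ f 0 = 0 ∧ ∀ z, wderiv f z = A z ∧ wderivBar f z = B z := by
  let ω : ℂ → ℂ →L[ℝ] ℂ := fun z => A z • (ContinuousLinearMap.id ℝ ℂ) + B z • (conjCLE : ℂ →L[ℝ] ℂ)
  have hω : Smo ω := by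
    exact (hA.smul contDiff_const).add (hB.smul contDiff_const)
  have happ : ∀ z y, ω z y = A z * y + B z * (starRingEnd ℂ) y := by
    intro z y; simp [ω]
  have hne : ((⊤ : ℕ∞) : WithTop ℕ∞) ≠ 0 := by simp
  have hd : ∀ a x y, fderiv ℝ ω a x y = fderiv ℝ A a x * y + fderiv ℝ B a x * (starRingEnd ℂ) y := by
    intro a x y
    have h1 : HasFDerivAt (fun z => ω z y) ((fderiv ℝ ω a).flip y) a :=
      ((hω.differentiable hne) a).hasFDerivAt.clm_apply (hasFDerivAt_const y a) |>.congr_fderiv (by ext; simp)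
    have h2 : HasFDerivAt (fun z => A z * y + B z * (starRingEnd ℂ) y) _ a :=
      ((hA.da a).hasFDerivAt.mul_const y).fun_add ((hB.da a).hasFDerivAt.mul_const ((starRingEnd ℂ) y))
    have h3 := (h1.congr_of_eventuallyEq (Eventually.of_forall fun z => (happ z y).symm)).unique h2
    have := congrArg (fun L : ℂ →L[ℝ] ℂ => L x) h3
    simpa [mul_comm] using this
  obtain ⟨f, hf⟩ := convex_univ.exists_forall_hasFDerivAt_of_fderiv_symmetric isOpen_univ (ω := ω)
    (hω.differentiable hne).differentiableOn (by
      intro a _ x y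
      rw [hd, hd, fd_eq, fd_eq, fd_eq, fd_eq, h a]; ring)
  have hf' : ∀ a, HasFDerivAt (fun z => f z - f 0) (ω a) a := fun a => (hf a trivial).sub_const _
  refine ⟨fun z => f z - f 0, ?_, by simp, fun z => ?_⟩
  · rw [contDiff_infty_iff_fderiv]
    refine ⟨fun a => (hf' a).differentiableAt, ?_⟩
    have : fderiv ℝ (fun z => f z - f 0) = ω := funext fun a => (hf' a).fderiv
    rw [this]; exact hω
  · rw [wd_of (hf' z), wdb_of (hf' z), happ, happ]
    have := I_mul_I
    constructor
    · simp; linear_combination (-(1:ℂ)/2) * (A z - B z) * this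
    · simp; linear_combination ((1:ℂ)/2) * (A z - B z) * this

/-- derivative as an equivalence -/
noncomputable def fdE (f : ℂ → ℂ) (h : ∀ z, Jac f z ≠ 0) (z : ℂ) : ℂ ≃L[ℝ] ℂ :=
  (fderiv ℝ f z).toContinuousLinearEquivOfDetNeZero (by rw [det_fd]; exact h z)

lemma fdE_coe (f : ℂ → ℂ) (h : ∀ z, Jac f z ≠ 0) (z : ℂ) : ((fdE f h z : ℂ ≃L[ℝ] ℂ) : ℂ →L[ℝ] ℂ) = fderiv ℝ f z := by
  ext <;> simp [fdE]

lemma loc_homeo {f : ℂ → ℂ} (hf : Smo f) (hJ : ∀ z, Jac f z ≠ 0) : IsLocalHomeomorph f := by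
  refine IsLocalHomeomorph.mk f fun x => ?_
  have hs : HasStrictFDerivAt f ((fdE f hJ x : ℂ ≃L[ℝ] ℂ) : ℂ →L[ℝ] ℂ) x := by
    rw [fdE_coe]
    exact hf.contDiffAt.hasStrictFDerivAt (by simp)
  exact ⟨hs.toOpenPartialHomeomorph f, hs.mem_toOpenPartialHomeomorph_source, fun y _ => rfl⟩

lemma diffeo_inv {f : ℂ → ℂ} (hf : Smo f) (hJ : ∀ z, Jac f z ≠ 0) (hb : Function.Bijective f) :
    ∃ Ψ, Smo Ψ ∧ (∀ z, Ψ (f z) = z) ∧ ∀ w, f (Ψ w) = w := by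
  let e : ℂ ≃ₜ ℂ := (loc_homeo hf hJ).toHomeomorphOfBijective hb
  have he : ∀ z, e z = f z := fun z => rfl
  refine ⟨e.symm, ?_, fun z => ?_, fun w => ?_⟩
  · refine e.contDiff_symm (f₀' := fdE f hJ) (fun a => ?_) hf
    rw [fdE_coe]; exact (hf.da a).hasFDerivAt
  · rw [← he, e.symm_apply_apply]
  · rw [← he, e.apply_symm_apply]

lemma proper_bij {f : ℂ → ℂ} (hf : Smo f) (hJ : ∀ z, Jac f z ≠ 0)
    (hp : Tendsto f (cocompact ℂ) (cocompact ℂ)) : Function.Bijective f := by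
  have hl := loc_homeo hf hJ
  have hP : IsProperMap f := isProperMap_iff_tendsto_cocompact.2 ⟨hf.continuous, hp⟩
  have hfin : ∀ x : ℂ, (f ⁻¹' {x}).Finite := fun x => by
    refine (hP.isCompact_preimage isCompact_singleton).finite (.of_openPartialHomeomorph f subset_rfl fun e he => ?_)
    obtain ⟨φ, h1, h2⟩ := hl e
    exact ⟨φ, h1, h2.symm⟩
  have hc : IsCoveringMapOn f Set.univ := hP.isClosedMap.isCoveringMapOn_of_isLocalHomeomorphOn (fun x _ => hfin x)
    (by simpa using hl.isLocalHomeomorphOn)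
  obtain ⟨Ψ, ⟨h0, h1⟩, -⟩ := hc.existsUnique_continuousMap_lifts (ContinuousMap.id ℂ) (a₀ := f 0) (e₀ := 0) rfl (by simp)
  have hr : ∀ w, f (Ψ w) = w := fun w => congrFun h1 w
  obtain ⟨_, _, hu⟩ := hc.existsUnique_continuousMap_lifts ⟨f, hf.continuous⟩ (a₀ := 0) (e₀ := 0) rfl (by simp)
  have e1 := hu (ContinuousMap.id ℂ) ⟨rfl, rfl⟩
  have e2 := hu (Ψ.comp ⟨f, hf.continuous⟩) ⟨h0, by ext z; exact hr _⟩
  have e3 : ∀ z, Ψ (f z) = z := fun z => by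
    have := congrArg (fun g : C(ℂ, ℂ) => g z) (e2.trans e1.symm)
    simpa using this
  exact ⟨Function.LeftInverse.injective e3, Function.RightInverse.surjective hr⟩

lemma CT_decay {f : ℂ → ℂ} (hf : Cc f) : ∃ A, 0 ≤ A ∧ ∀ z, ‖CT f z‖ ≤ A / (1 + ‖z‖) := by
  obtain ⟨R, hR1, hR⟩ := Cc.ball hf.c
  obtain ⟨B, hB⟩ := CT_bdd hf
  have hB0 : 0 ≤ B := (norm_nonneg _).trans (hB 0)
  set J := ∫ w, Real.pi⁻¹ * ‖f w‖
  have hJ : 0 ≤ J := integral_nonneg fun w => by have := Real.pi_pos; positivity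
  refine ⟨B * (1 + 2 * R) + 4 * J, by positivity, fun z => ?_⟩
  rw [le_div_iff₀ (by positivity)]
  rcases le_or_gt ‖z‖ (2 * R) with hz | hz
  · have : ‖CT f z‖ * (1 + ‖z‖) ≤ B * (1 + 2 * R) := by
      gcongr
      exact hB z
    linarith
  · have hz0 : 0 < ‖z‖ := by linarith
    have : ‖CT f z‖ ≤ (2 / ‖z‖) * J := by
      rw [CT_def2, ← integral_const_mul]
      refine norm_integral_le_of_norm_le ((hf.int.norm.const_mul _).const_mul _) (Eventually.of_forall fun w => ?_)
      rcases le_or_gt R ‖w‖ with hw | hw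
      · simp [hR w hw]
      · rw [norm_mul, K_norm]
        have h1 : ‖z‖ / 2 ≤ ‖z - w‖ := by linarith [norm_sub_norm_le z w]
        have h2 : ‖z - w‖⁻¹ ≤ 2 / ‖z‖ := by
          rw [← inv_div]; exact inv_anti₀ (by positivity) h1
        have h3 : 0 ≤ Real.pi⁻¹ := inv_nonneg.2 Real.pi_pos.le
        calc Real.pi⁻¹ * ‖z - w‖⁻¹ * ‖f w‖ ≤ Real.pi⁻¹ * (2 / ‖z‖) * ‖f w‖ := by gcongr
          _ = _ := by ring
    have h4 : ‖CT f z‖ * (1 + ‖z‖) ≤ (2 / ‖z‖) * J * (2 * ‖z‖) := by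
      gcongr
      linarith
    have h5 : (2 / ‖z‖) * J * (2 * ‖z‖) = 4 * J := by field_simp; ring
    have : 0 ≤ B * (1 + 2 * R) := by positivity
    linarith

/-- chart data -/
structure Chart (m Φ Ψ : ℂ → ℂ) : Prop where
  s : Smo Φ
  z0 : Φ 0 = 0
  b : ∀ z, wderivBar Φ z = m z * wderiv Φ z
  n : ∀ z, wderiv Φ z ≠ 0
  si : Smo Ψ
  l : ∀ z, Ψ (Φ z) = z
  r : ∀ w, Φ (Ψ w) = w
  lin : ∃ A, 0 ≤ A ∧ ∀ z, ‖Φ z‖ ≤ A * (1 + ‖z‖)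

lemma Jac_ne {f : ℂ → ℂ} {z m : ℂ} (hm : ‖m‖ < 1) (h : wderivBar f z = m * wderiv f z) (h0 : wderiv f z ≠ 0) :
    0 < Jac f z := by
  rw [Jac, h, norm_mul, mul_pow]
  have h1 : 0 < ‖wderiv f z‖ ^ 2 := by positivity
  have h2 : ‖m‖ ^ 2 < 1 := by nlinarith [norm_nonneg m]
  nlinarith

lemma lip_bd {f : ℂ → ℂ} (hf : Smo f) {C : ℝ} (hC : ∀ z, ‖fderiv ℝ f z‖ ≤ C) (z : ℂ) : ‖f z - f 0‖ ≤ C * ‖z‖ := by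
  have := Convex.norm_image_sub_le_of_norm_fderiv_le (𝕜 := ℝ) (s := Set.univ) (f := f) (fun x _ => hf.da x) (fun x _ => hC x)
    convex_univ (Set.mem_univ 0) (Set.mem_univ z)
  simpa using this

theorem exists_chart {m : ℂ → ℂ} {k : ℝ} (hm : Cc m) (hk : ∀ z, ‖m z‖ ≤ k) (hk1 : k < 1) : ∃ Φ Ψ, Chart m Φ Ψ := by
  obtain ⟨q, hq, hqe⟩ := solve hm hk hk1 hm.wd
  set σ := CT q with hσ
  have hs : Smo σ := CT_smo hq
  have hA : Smo fun z => exp (σ z) := hs.cexp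
  have hwd : ∀ z, wderiv (fun z => exp (σ z)) z = exp (σ z) * wderiv σ z := fun z =>
    wd_comp (φ := exp) (hasDerivAt_exp _) (hs.da z)
  have hwdb : ∀ z, wderivBar (fun z => exp (σ z)) z = exp (σ z) * wderivBar σ z := fun z =>
    wdb_comp (φ := exp) (hasDerivAt_exp _) (hs.da z)
  obtain ⟨Φ, hΦ, h0, hd⟩ := poincare hA (B := fun z => m z * exp (σ z)) (hm.s.mul hA) (by
    intro z
    rw [hwdb, wd_mul (hm.s.da z) (hA.da z), hwd, hσ, CT_wdb hq, hqe z, ST]; ring)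
  have hb : ∀ z, wderivBar Φ z = m z * wderiv Φ z := fun z => by rw [(hd z).1, (hd z).2]
  have hn : ∀ z, wderiv Φ z ≠ 0 := fun z => by rw [(hd z).1]; exact exp_ne_zero _
  have hJ : ∀ z, Jac Φ z ≠ 0 := fun z => (Jac_ne ((hk z).trans_lt hk1) (hb z) (hn z)).ne'
  obtain ⟨A, hA0, hAd⟩ := CT_decay hq
  -- bounded derivative
  have hfdb : ∀ z, ‖fderiv ℝ Φ z‖ ≤ 2 * Real.exp A := fun z => by
    refine (norm_fd_le _ _).trans ?_
    have h1 : ‖wderiv Φ z‖ ≤ Real.exp A := by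
      rw [(hd z).1, norm_exp]
      refine Real.exp_le_exp.2 ((re_le_norm _).trans ((hAd z).trans ?_))
      exact div_le_self hA0 (by linarith [norm_nonneg z])
    have h2 : ‖wderivBar Φ z‖ ≤ ‖wderiv Φ z‖ := by
      rw [hb, norm_mul]; exact mul_le_of_le_one_left (norm_nonneg _) ((hk z).trans hk1.le)
    linarith
  have hlin : ∀ z, ‖Φ z‖ ≤ 2 * Real.exp A * (1 + ‖z‖) := fun z => by
    have := lip_bd hΦ hfdb z
    rw [h0, sub_zero] at this
    nlinarith [Real.exp_pos A]
  -- properness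
  obtain ⟨R0, hR01, hR0⟩ := Cc.ball hm.c
  obtain ⟨R, hR, hRd⟩ : ∃ R, R0 ≤ R ∧ ∀ z, R ≤ ‖z‖ → ‖exp (σ z) - 1‖ ≤ 1 / 2 := by
    refine ⟨max R0 (4 * A), le_max_left _ _, fun z hz => ?_⟩
    have h1 : 4 * A ≤ ‖z‖ := (le_max_right _ _).trans hz
    have h2 : ‖σ z‖ ≤ 1 / 4 := by
      refine (hAd z).trans ?_
      rw [div_le_iff₀ (by positivity)]; linarith
    have := norm_exp_sub_one_le (x := σ z) (by linarith)
    linarith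
  have hfd2 : ∀ z, ‖fderiv ℝ (fun z => Φ z - z) z‖ ≤ 1/2 + (if ‖z‖ < R then 2 * Real.exp A + 1 else 0) := by
    intro z
    have hfe : HasFDerivAt (fun z => Φ z - z) (fderiv ℝ Φ z - ContinuousLinearMap.id ℝ ℂ) z :=
      (hΦ.da z).hasFDerivAt.fun_sub (hasFDerivAt_id z)
    rw [hfe.fderiv]
    split_ifs with h
    · refine (norm_sub_le _ _).trans ?_
      have := ContinuousLinearMap.norm_id_le (𝕜 := ℝ) (E := ℂ)
      linarith [hfdb z]
    · rw [not_lt] at h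
      refine ContinuousLinearMap.opNorm_le_bound _ (by norm_num) fun w => ?_
      have : (fderiv ℝ Φ z - ContinuousLinearMap.id ℝ ℂ) w = (exp (σ z) - 1) * w := by
        simp [fd_eq, (hd z).1, hb, hR0 z (hR.trans h)]; ring
      rw [this, norm_mul]
      have := hRd z h
      gcongr; linarith
  have hR0' : 0 < R := by linarith
  have key : ∀ z, ‖z‖ / 2 - (2 * Real.exp A + 2) * R ≤ ‖Φ z‖ := by
    intro z
    have hE := Real.exp_pos A
    rcases le_or_gt ‖z‖ R with hz | hz
    · nlinarith [norm_nonneg (Φ z), norm_nonneg z]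
    · -- the ray
      set p : ℂ := (R / ‖z‖ : ℝ) * z with hp
      have hz0 : 0 < ‖z‖ := hR0'.trans hz
      have hpn : ‖p‖ = R := by
        rw [hp, norm_mul, norm_real, Real.norm_of_nonneg (by positivity)]; field_simp
      have h1 : ‖(Φ z - z) - (Φ p - p)‖ ≤ 1 / 2 * ‖z - p‖ := by
        refine Convex.norm_image_sub_le_of_norm_fderiv_le (𝕜 := ℝ) (s := segment ℝ p z) (f := fun z => Φ z - z)
          (fun x _ => (hΦ.da x).sub differentiableAt_id) (fun x hx => ?_) (convex_segment _ _)
          (left_mem_segment _ _ _) (right_mem_segment _ _ _)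
        refine (hfd2 x).trans ?_
        have : ¬ ‖x‖ < R := by
          rw [not_lt]
          obtain ⟨a, b, ha, hb, hab, rfl⟩ := hx
          have : a • p + b • z = ((a * (R / ‖z‖) + b : ℝ) : ℂ) * z := by
            rw [hp]; simp; ring
          rw [this, norm_mul, norm_real, Real.norm_of_nonneg (by positivity), add_mul]
          have e1 : a * (R / ‖z‖) * ‖z‖ = a * R := by field_simp
          rw [e1]; nlinarith
        simp [this]
      have h2 : ‖z - p‖ ≤ ‖z‖ := by
        have : z - p = ((1 - R / ‖z‖ : ℝ) : ℂ) * z := by rw [hp]; push_cast; ring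
        have hq1 : R / ‖z‖ ≤ 1 := (div_le_one hz0).2 hz.le
        have hq2 : 0 ≤ R / ‖z‖ := by positivity
        rw [this, norm_mul, norm_real, Real.norm_of_nonneg (by linarith)]
        exact mul_le_of_le_one_left hz0.le (by linarith)
      have h3 : ‖Φ p‖ ≤ 2 * Real.exp A * R := by
        have := lip_bd hΦ hfdb p
        rwa [h0, sub_zero, hpn] at this
      have h4 : ‖z‖ ≤ ‖Φ z‖ + ‖(Φ z - z) - (Φ p - p)‖ + ‖Φ p‖ + ‖p‖ := by
        calc ‖z‖ = ‖Φ z - ((Φ z - z) - (Φ p - p)) - Φ p + p‖ := by congr 1; ring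
          _ ≤ _ := (norm_add_le _ _).trans (by gcongr; exact (norm_sub_le _ _).trans (by gcongr; exact norm_sub_le _ _))
      rw [hpn] at h4
      nlinarith
  have hprop : Tendsto Φ (cocompact ℂ) (cocompact ℂ) := by
    rw [← Metric.cobounded_eq_cocompact, ← tendsto_norm_atTop_iff_cobounded]
    refine tendsto_atTop_mono key (tendsto_atTop_add_const_right _ _ ?_)
    exact tendsto_norm_cobounded_atTop.atTop_div_const (by norm_num)
  obtain ⟨Ψ, h1, h2, h3⟩ := diffeo_inv hΦ hJ (proper_bij hΦ hJ hprop)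
  exact ⟨Φ, Ψ, hΦ, h0, hb, hn, h1, h2, h3, _, by positivity, hlin⟩

end SRM

namespace SRM
open Complex Filter Topology

lemma Chart.hol {m Φ Ψ : ℂ → ℂ} (hC : Chart m Φ Ψ) {f : ℂ → ℂ} {w : ℂ} (hf : DifferentiableAt ℝ f (Ψ w))
    (hb : wderivBar f (Ψ w) = m (Ψ w) * wderiv f (Ψ w)) :
    HasDerivAt (fun w => f (Ψ w)) (wderiv f (Ψ w) / wderiv Φ (Ψ w)) w := by
  set c := wderiv f (Ψ w) / wderiv Φ (Ψ w) with hc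
  have h1 : HasFDerivAt (fun w => f (Ψ w)) _ w := hf.hasFDerivAt.comp w (hC.si.da w).hasFDerivAt
  have h2 : HasFDerivAt (fun w => Φ (Ψ w)) _ w := (hC.s.da _).hasFDerivAt.comp w (hC.si.da w).hasFDerivAt
  have h3 : HasFDerivAt (fun w => Φ (Ψ w)) (ContinuousLinearMap.id ℝ ℂ) w :=
    (hasFDerivAt_id w).congr_of_eventuallyEq (Eventually.of_forall hC.r)
  have h4 := h2.unique h3
  have hn := hC.n (Ψ w)
  refine hasDerivAt_iff_hasFDerivAt.2 (hasFDerivAt_of_restrictScalars ℝ h1 ?_)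
  ext v
  have h5 : fderiv ℝ Φ (Ψ w) (fderiv ℝ Ψ w v) = v := by
    have := congrArg (fun L : ℂ →L[ℝ] ℂ => L v) h4
    simpa using this
  have h6 : fderiv ℝ f (Ψ w) (fderiv ℝ Ψ w v) = c * fderiv ℝ Φ (Ψ w) (fderiv ℝ Ψ w v) := by
    generalize fderiv ℝ Ψ w v = u
    rw [fd_eq, fd_eq, hb, hC.b, hc]; field_simp
  rw [h5] at h6
  simp [h6, mul_comm]

lemma smoAt_of_hol {f : ℂ → ℂ} {s : Set ℂ} (hs : IsOpen s) (hf : DifferentiableOn ℂ f s) {z : ℂ} (hz : z ∈ s) :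
    ContDiffAt ℝ ((⊤ : ℕ∞) : WithTop ℕ∞) f z :=
  ((hf.contDiffOn hs).contDiffAt (hs.mem_nhds hz)).restrict_scalars ℝ

lemma wdb_hol {f : ℂ → ℂ} {z : ℂ} (hf : DifferentiableAt ℂ f z) : wderivBar f z = 0 := by
  have h := hf.hasFDerivAt.restrictScalars ℝ
  rw [wdb_of h]
  have : fderiv ℂ f z I = I * fderiv ℂ f z 1 := by
    rw [← smul_eq_mul, ← map_smul]; simp
  simp only [ContinuousLinearMap.coe_restrictScalars', this]
  rw [← mul_assoc, I_mul_I]; ring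

lemma lemA0 {δ : ℝ} (hδ : 0 < δ) : ∃ C, 0 ≤ C ∧ ∀ f : ℂ → ℂ, DifferentiableOn ℂ f (Metric.ball 0 δ) →
    IntegrableOn (fun w => ‖f w‖ ^ 2) (Metric.ball 0 δ) →
    ‖f 0‖ ≤ C * (1 + ∫ w in Metric.ball 0 δ, ‖f w‖ ^ 2) := by
  let b : ContDiffBump (0 : ℂ) := ⟨δ / 3, δ / 2, by positivity, by linarith⟩
  let β : ℂ → ℂ := fun w => ((b w : ℝ) : ℂ)
  have hβ : Cc β := ⟨ofRealCLM.contDiff.comp b.contDiff, b.hasCompactSupport.comp_left (g := ofReal) (by simp)⟩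
  have hβ1 : ∀ w, ‖w‖ < δ / 3 → β w = 1 := fun w hw => by
    show ((b w : ℝ) : ℂ) = 1
    rw [b.one_of_mem_closedBall (by simpa using hw.le)]; simp
  have hβ0 : ∀ w, δ / 2 < ‖w‖ → β w = 0 := fun w hw => by
    show ((b w : ℝ) : ℂ) = 0
    rw [b.zero_of_le_dist (by simpa using hw.le)]; simp
  obtain ⟨B, hB0, hB⟩ := hβ.wdb.bdd
  have hπ := Real.pi_pos
  set D := Real.pi⁻¹ * (δ / 3)⁻¹ * B with hD
  have hD0 : 0 ≤ D := by positivity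
  set V := (volume : Measure ℂ).real (Metric.ball 0 δ) with hV
  refine ⟨D * (1 + V), by positivity, fun f hf hi => ?_⟩
  set I := ∫ w in Metric.ball 0 δ, ‖f w‖ ^ 2 with hI
  have hI0 : 0 ≤ I := integral_nonneg fun w => by positivity
  have hfar : ∀ w, δ / 2 < ‖w‖ → ∀ᶠ y in 𝓝 w, β y = 0 := fun w hw => by
    filter_upwards [(isOpen_lt continuous_const continuous_norm).mem_nhds hw] with y hy using hβ0 y hy
  have hh : Cc fun w => β w * f w := by
    refine ⟨contDiff_iff_contDiffAt.2 fun w => ?_, hβ.c.mul_right⟩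
    rcases lt_or_ge ‖w‖ δ with hw | hw
    · exact hβ.s.contDiffAt.mul (smoAt_of_hol Metric.isOpen_ball hf (by simpa using hw))
    · refine (contDiffAt_const (c := (0:ℂ))).congr_of_eventuallyEq ?_
      filter_upwards [hfar w (by linarith)] with y hy
      simp [hy]
  have h0 : f 0 = ∫ w, K (0 - w) * wderivBar (fun w => β w * f w) w := by
    rw [← CT_def2, CT_of_wdb hh, hβ1 0 (by simpa using by positivity), one_mul]
  rw [h0]
  have hpt : ∀ w, ‖K (0 - w) * wderivBar (fun w => β w * f w) w‖ ≤
      (Metric.ball 0 δ).indicator (fun w => D * (1 + ‖f w‖ ^ 2)) w := by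
    intro w
    rcases lt_or_ge ‖w‖ δ with hw | hw
    · have hmem : w ∈ Metric.ball (0:ℂ) δ := by simpa using hw
      rw [Set.indicator_of_mem hmem]
      have hda : DifferentiableAt ℂ f w := hf.differentiableAt (Metric.isOpen_ball.mem_nhds hmem)
      rw [wdb_mul (hβ.s.da w) (hda.restrictScalars ℝ), wdb_hol hda, mul_zero, zero_add]
      rcases lt_or_ge ‖w‖ (δ / 3) with hw3 | hw3
      · have : wderivBar β w = 0 := by
          rw [wdb_congr (g := fun _ => 1), wdb_const]
          filter_upwards [(isOpen_lt continuous_norm continuous_const).mem_nhds hw3] with y hy using hβ1 y hy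
        rw [this]; simp; positivity
      · rw [norm_mul, norm_mul, K_norm, zero_sub, norm_neg]
        have e1 : ‖w‖⁻¹ ≤ (δ / 3)⁻¹ := inv_anti₀ (by positivity) hw3
        have e2 : ‖f w‖ ≤ 1 + ‖f w‖ ^ 2 := by nlinarith [sq_nonneg (‖f w‖ - 1), norm_nonneg (f w)]
        have e3 := hB w
        have e4 : 0 ≤ Real.pi⁻¹ := by positivity
        calc Real.pi⁻¹ * ‖w‖⁻¹ * (‖wderivBar β w‖ * ‖f w‖) ≤ Real.pi⁻¹ * (δ / 3)⁻¹ * (B * (1 + ‖f w‖ ^ 2)) := by gcongr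
          _ = _ := by rw [hD]; ring
    · have : wderivBar (fun w => β w * f w) w = 0 := by
        rw [wdb_congr (g := fun _ => 0), wdb_const]
        filter_upwards [hfar w (by linarith)] with y hy
        simp [hy]
      rw [this, mul_zero, norm_zero]
      exact Set.indicator_nonneg (fun w _ => by positivity) w
  have hfin : volume (Metric.ball (0:ℂ) δ) ≠ ⊤ := measure_ball_lt_top.ne
  have hi1 : IntegrableOn (fun _ : ℂ => (1:ℝ)) (Metric.ball 0 δ) := integrableOn_const hfin
  have hi2 : IntegrableOn (fun w => D * (1 + ‖f w‖ ^ 2)) (Metric.ball 0 δ) := (hi1.add hi).const_mul D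
  refine (norm_integral_le_of_norm_le ((integrable_indicator_iff measurableSet_ball).2 hi2)
    (Eventually.of_forall hpt)).trans ?_
  rw [integral_indicator measurableSet_ball, integral_const_mul, integral_add hi1 hi]
  simp only [setIntegral_const, smul_eq_mul, mul_one]
  rw [← hV, ← hI, mul_assoc D]
  refine mul_le_mul_of_nonneg_left ?_ hD0
  have : 0 ≤ V := by positivity
  nlinarith

lemma lemA {δ : ℝ} (hδ : 0 < δ) : ∃ C, 0 ≤ C ∧ ∀ (f : ℂ → ℂ) (a : ℂ), DifferentiableOn ℂ f (Metric.ball a δ) →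
    Integrable (fun w => ‖f w‖ ^ 2) →
    ‖f a‖ ≤ C * (1 + ∫ w, ‖f w‖ ^ 2) := by
  obtain ⟨C, hC, h⟩ := lemA0 hδ
  refine ⟨C, hC, fun f a hf hi => ?_⟩
  have hi' : Integrable fun w => ‖f (w + a)‖ ^ 2 := hi.comp_add_right a
  have := h (fun w => f (w + a)) (by
    refine hf.comp (by fun_prop) fun w hw => ?_
    simpa [dist_eq_norm] using hw) hi'.integrableOn
  rw [zero_add] at this
  refine this.trans ?_
  gcongr
  rw [← integral_add_right_eq_self (fun w => ‖f w‖ ^ 2) a]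
  exact setIntegral_le_integral hi' (Eventually.of_forall fun w => by positivity)

lemma grad_bd {m Φ Ψ : ℂ → ℂ} (hC : Chart m Φ Ψ) (hm : ∀ z, ‖m z‖ ≤ 1) {R R' : ℝ} (hR : R < R') :
    ∃ C, 0 ≤ C ∧ ∀ d, Smo d → (∀ z, ‖z‖ < R' → wderivBar d z = m z * wderiv d z) →
      Integrable (fun z => ‖wderiv d z‖ ^ 2) → ∀ z, ‖z‖ ≤ R → ‖fderiv ℝ d z‖ ≤ C * (1 + ∫ z, ‖wderiv d z‖ ^ 2) := by
  have hVo : IsOpen (Ψ ⁻¹' Metric.ball 0 R') := Metric.isOpen_ball.preimage hC.si.continuous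
  obtain ⟨δ, hδ, hsub⟩ := ((isCompact_closedBall (0:ℂ) R).image hC.s.continuous).exists_thickening_subset_open hVo (by
    rintro _ ⟨z, hz, rfl⟩
    rw [Set.mem_preimage, hC.l]
    exact Metric.closedBall_subset_ball hR hz)
  obtain ⟨C, hC0, hA⟩ := lemA hδ
  obtain ⟨B, hB⟩ := (isCompact_closedBall (0 : ℂ) R).exists_bound_of_continuousOn (smo_wd hC.s).continuous.continuousOn
  refine ⟨2 * (C * max B 0), by positivity, fun d hd hdb hdi z hz => ?_⟩
  set f : ℂ → ℂ := fun w => wderiv d (Ψ w) / wderiv Φ (Ψ w) with hf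
  have hder : ∀ w ∈ Ψ ⁻¹' Metric.ball 0 R', HasDerivAt (fun w => d (Ψ w)) (f w) w := fun w hw =>
    hC.hol (hd.da _) (hdb _ (by simpa using hw))
  have hfd : DifferentiableOn ℂ f (Ψ ⁻¹' Metric.ball 0 R') := by
    have h1 : DifferentiableOn ℂ (fun w => d (Ψ w)) (Ψ ⁻¹' Metric.ball 0 R') := fun w hw =>
      (hder w hw).differentiableAt.differentiableWithinAt
    exact (h1.deriv hVo).congr fun w hw => (hder w hw).deriv.symm
  have hinj : Set.InjOn Φ Set.univ := (Function.LeftInverse.injective hC.l).injOn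
  have himg : Φ '' Set.univ = Set.univ := by
    rw [Set.image_univ]; exact (Function.RightInverse.surjective hC.r).range_eq
  have hfd' : ∀ x ∈ Set.univ, HasFDerivWithinAt Φ (fderiv ℝ Φ x) Set.univ x := fun x _ => (hC.s.da x).hasFDerivAt.hasFDerivWithinAt
  have hcont : Continuous f := by
    refine ((smo_wd hd).continuous.comp hC.si.continuous).div ((smo_wd hC.s).continuous.comp hC.si.continuous) fun w => hC.n _
  have hle : ∀ x, |(fderiv ℝ Φ x).det| • ‖f (Φ x)‖ ^ 2 ≤ ‖wderiv d x‖ ^ 2 := by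
    intro x
    have hn : 0 < ‖wderiv Φ x‖ := norm_pos_iff.2 (hC.n x)
    rw [det_fd, abs_of_nonneg (Jac_nonneg (hm x) (hC.b x)), hf]
    simp only [hC.l, norm_div, div_pow, smul_eq_mul]
    rw [mul_div_assoc', div_le_iff₀ (by positivity), mul_comm]
    gcongr
    rw [Jac]; nlinarith [sq_nonneg ‖wderivBar Φ x‖]
  have hint1 : Integrable fun x => |(fderiv ℝ Φ x).det| • ‖f (Φ x)‖ ^ 2 := by
    refine hdi.mono' ?_ (Eventually.of_forall fun x => ?_)
    · have h1 : Continuous fun x => |(fderiv ℝ Φ x).det| := by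
        have : Continuous (fun x => Jac Φ x) := by
          unfold Jac
          have := (smo_wd hC.s).continuous
          have := (smo_wdb hC.s).continuous
          fun_prop
        simp_rw [det_fd]; exact this.abs
      have h2 := hC.s.continuous
      exact (h1.smul ((hcont.comp h2).norm.pow 2)).aestronglyMeasurable
    · rw [Real.norm_of_nonneg (by positivity)]; exact hle x
  have hint2 : Integrable fun w => ‖f w‖ ^ 2 := by
    rw [← integrableOn_univ, ← himg, integrableOn_image_iff_integrableOn_abs_det_fderiv_smul volume MeasurableSet.univ hfd' hinj]
    exact hint1.integrableOn
  have hI : ∫ w, ‖f w‖ ^ 2 ≤ ∫ z, ‖wderiv d z‖ ^ 2 := by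
    rw [← setIntegral_univ, ← himg, integral_image_eq_integral_abs_det_fderiv_smul volume MeasurableSet.univ hfd' hinj, setIntegral_univ]
    exact integral_mono hint1 hdi hle
  have hzm : Φ z ∈ Φ '' Metric.closedBall 0 R := ⟨z, by simpa using hz, rfl⟩
  have h1 := hA f (Φ z) (hfd.mono ((Metric.ball_subset_thickening hzm δ).trans hsub)) hint2
  have h2 : wderiv d z = f (Φ z) * wderiv Φ z := by
    simp only [hf, hC.l]; field_simp [hC.n z]
  have h3 : ‖wderiv d z‖ ≤ C * (1 + ∫ z, ‖wderiv d z‖ ^ 2) * max B 0 := by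
    rw [h2, norm_mul]
    have := hB z (by simpa using hz)
    have h4 : ‖wderiv Φ z‖ ≤ max B 0 := this.trans (le_max_left _ _)
    have h5 : 0 ≤ ∫ w, ‖f w‖ ^ 2 := integral_nonneg fun w => by positivity
    gcongr
    refine h1.trans ?_
    gcongr
  have h4 : ‖wderivBar d z‖ ≤ ‖wderiv d z‖ := by
    rw [hdb z (hz.trans_lt hR), norm_mul]; exact mul_le_of_le_one_left (norm_nonneg _) (hm z)
  calc ‖fderiv ℝ d z‖ ≤ ‖wderiv d z‖ + ‖wderivBar d z‖ := norm_fd_le _ _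
    _ ≤ 2 * (C * (1 + ∫ z, ‖wderiv d z‖ ^ 2) * max B 0) := by linarith
    _ = _ := by ring

end SRM

namespace SRM
open Complex Filter Topology

structure Dat (μ : ℂ → ℂ) (k : ℝ) (χ g : ℂ → ℂ) (m Φ Ψ v : ℕ → ℂ → ℂ) (E : ℝ) : Prop where
  mb : ∀ n z, ‖m n z‖ ≤ k
  mμ : ∀ (n : ℕ) (z : ℂ), ‖z‖ ≤ n + 1 → m n z = μ z
  ch : ∀ n, Chart (m n) (Φ n) (Ψ n)
  χs : Smo χ
  χ1 : ∀ z, ‖z‖ ≤ 1 / 4 → χ z = 1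
  χ0 : ∀ z, 1 / 2 ≤ ‖z‖ → χ z = 0
  gs : Smo g
  gΦ : ∀ z, g z * Φ 0 z = - (wderivBar χ z - μ z * wderiv χ z)
  vs : ∀ n, Smo (v n)
  vb : ∀ n z, wderivBar (v n) z = m n z * wderiv (v n) z + g z
  vi : ∀ n, Integrable fun z => ‖wderiv (v n) z‖ ^ 2
  vE : ∀ n, ∫ z, ‖wderiv (v n) z‖ ^ 2 ≤ E
  vd : ∀ n, ∃ A, 0 ≤ A ∧ ∀ z, ‖v n z‖ ≤ A / (1 + ‖z‖)

lemma Chart.ne {m Φ Ψ : ℂ → ℂ} (hC : Chart m Φ Ψ) {z : ℂ} (hz : z ≠ 0) : Φ z ≠ 0 := fun h => hz <| by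
  have := hC.l 0
  rw [← hC.l z, h]; rwa [hC.z0] at this

lemma exists_dat {μ : ℂ → ℂ} {k : ℝ} (hμ : Smo μ) (hk : ∀ z, ‖μ z‖ ≤ k) (hk1 : k < 1) :
    ∃ χ g m Φ Ψ v E, Dat μ k χ g m Φ Ψ v E := by
  obtain ⟨η, C, hC, hs, h1, h01, hcs, -, -, -⟩ := exists_cutoffs
  obtain ⟨η0, hs0, h10, h00, -, hc0⟩ := exists_cutoff
  let m : ℕ → ℂ → ℂ := fun n z => (η n z : ℂ) * μ z
  have hm : ∀ n, Cc (m n) := fun n =>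
    ⟨(ofRealCLM.contDiff.comp (hs n)).mul hμ, ((hcs n).comp_left (g := ofReal) (by simp)).mul_right⟩
  have hmk : ∀ n z, ‖m n z‖ ≤ k := fun n z => by
    show ‖(η n z : ℂ) * μ z‖ ≤ k
    rw [norm_mul, norm_real, Real.norm_of_nonneg (h01 n z).1]
    exact (mul_le_of_le_one_left (norm_nonneg _) (h01 n z).2).trans (hk z)
  have hmμ : ∀ (n : ℕ) (z : ℂ), ‖z‖ ≤ n + 1 → m n z = μ z := fun n z hz => by
    show (η n z : ℂ) * μ z = μ z
    rw [h1 n z hz]; simp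
  choose Φ Ψ hch using fun n => exists_chart (hm n) (hmk n) hk1
  let χ : ℂ → ℂ := fun z => (η0 (4 * z) : ℂ)
  have hχs : Smo χ := ofRealCLM.contDiff.comp (hs0.comp (contDiff_const.mul contDiff_id))
  have hχ1 : ∀ z, ‖z‖ ≤ 1 / 4 → χ z = 1 := fun z hz => by
    show (η0 (4 * z) : ℂ) = 1
    rw [h10 _ (by rw [norm_mul]; norm_num; linarith)]; simp
  have hχ0 : ∀ z, 1 / 2 ≤ ‖z‖ → χ z = 0 := fun z hz => by
    show (η0 (4 * z) : ℂ) = 0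
    rw [h00 _ (by rw [norm_mul]; norm_num; linarith)]; simp
  have hχc : HasCompactSupport χ := HasCompactSupport.intro (isCompact_closedBall 0 (1/2)) fun z hz => hχ0 z (by
    simp at hz; linarith)
  have hχC : Cc χ := ⟨hχs, hχc⟩
  let g : ℂ → ℂ := fun z => - (wderivBar χ z - μ z * wderiv χ z) * (Φ 0 z)⁻¹
  have hev : ∀ z : ℂ, ‖z‖ < 1 / 4 → wderivBar χ z - μ z * wderiv χ z = 0 := fun z hz => by
    have : χ =ᶠ[𝓝 z] fun _ => 1 := by
      filter_upwards [(isOpen_lt continuous_norm continuous_const).mem_nhds hz] with y hy using hχ1 y (le_of_lt hy)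
    rw [wdb_congr this, wd_congr this, wd_const, wdb_const]; simp
  have hnum : Cc fun z => wderivBar χ z - μ z * wderiv χ z := hχC.wdb.sub (Cc.s_mul hμ hχC.wd)
  have hg : Cc g := by
    refine ⟨contDiff_iff_contDiffAt.2 fun z => ?_, HasCompactSupport.mul_right ?_⟩
    · by_cases hz : z = 0
      · refine (contDiffAt_const (c := (0:ℂ))).congr_of_eventuallyEq ?_
        have : ‖z‖ < 1 / 4 := by rw [hz]; simp
        filter_upwards [(isOpen_lt continuous_norm continuous_const).mem_nhds this] with y hy
        show - (wderivBar χ y - μ y * wderiv χ y) * (Φ 0 y)⁻¹ = 0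
        rw [hev y hy]; simp
      · exact hnum.s.neg.contDiffAt.mul ((hch 0).s.contDiffAt.inv ((hch 0).ne hz))
    · exact hnum.c.neg
  have hgΦ : ∀ z, g z * Φ 0 z = - (wderivBar χ z - μ z * wderiv χ z) := fun z => by
    by_cases hz : z = 0
    · rw [hev z (by rw [hz]; simp)]
      show - (wderivBar χ z - μ z * wderiv χ z) * (Φ 0 z)⁻¹ * Φ 0 z = _
      rw [hev z (by rw [hz]; simp)]; simp
    · show - (wderivBar χ z - μ z * wderiv χ z) * (Φ 0 z)⁻¹ * Φ 0 z = _
      rw [inv_mul_cancel_right₀ ((hch 0).ne hz)]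
  choose q hq hqe using fun n => solve (hm n) (hmk n) hk1 hg
  refine ⟨χ, g, m, Φ, Ψ, fun n => CT (q n), (N g / (1 - k)) ^ 2, hmk, hmμ, hch, hχs, hχ1, hχ0, hg.s, hgΦ,
    fun n => CT_smo (hq n), fun n z => ?_, fun n => ST_sq_int (hq n), fun n => ?_, fun n => CT_decay (hq n)⟩
  · rw [CT_wdb (hq n)]; exact hqe n z
  · have h1 : ∫ z, ‖ST (q n) z‖ ^ 2 = N (q n) ^ 2 := by rw [← (ST_L2 (hq n)).N_sq, N_ST (hq n)]
    show ∫ z, ‖ST (q n) z‖ ^ 2 ≤ _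
    rw [h1]
    have := N_nonneg (q n)
    gcongr
    exact solve_N (hm n) (hmk n) hk1 hg.L2 (hq n) (hqe n)

lemma F_hol {χ Φ0 v : ℂ → ℂ} {z c γ : ℂ} (hχ : Smo χ) (hΦ : Smo Φ0) (hv : DifferentiableAt ℝ v z) (h0 : Φ0 z ≠ 0)
    (h1 : χ z * (wderivBar Φ0 z - c * wderiv Φ0 z) = 0) (h2 : γ * Φ0 z = - (wderivBar χ z - c * wderiv χ z))
    (h3 : wderivBar v z = c * wderiv v z + γ) :
    DifferentiableAt ℝ (fun z => χ z * (Φ0 z)⁻¹ + v z) z ∧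
    wderivBar (fun z => χ z * (Φ0 z)⁻¹ + v z) z = c * wderiv (fun z => χ z * (Φ0 z)⁻¹ + v z) z := by
  have d1 : DifferentiableAt ℝ (fun z => (Φ0 z)⁻¹) z := (hΦ.da z).inv h0
  have d2 : DifferentiableAt ℝ (fun z => χ z * (Φ0 z)⁻¹) z := (hχ.da z).mul d1
  refine ⟨d2.add hv, ?_⟩
  have hi := hasDerivAt_inv h0
  rw [wd_add d2 hv, wdb_add d2 hv, wd_mul (hχ.da z) d1, wdb_mul (hχ.da z) d1,
    wd_comp (φ := fun x => x⁻¹) hi (hΦ.da z), wdb_comp (φ := fun x => x⁻¹) hi (hΦ.da z), h3]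
  field_simp
  linear_combination Φ0 z * h2 - h1

namespace Dat
variable {μ : ℂ → ℂ} {k : ℝ} {χ g : ℂ → ℂ} {m Φ Ψ v : ℕ → ℂ → ℂ} {E : ℝ}

lemma fh (D : Dat μ k χ g m Φ Ψ v E) {u : ℂ → ℂ} {z c : ℂ} (hz : z ≠ 0) (hu : DifferentiableAt ℝ u z)
    (hc : ‖z‖ ≤ 1 → c = μ z) (h : wderivBar u z = c * wderiv u z + g z) :
    DifferentiableAt ℝ (fun z => χ z * (Φ 0 z)⁻¹ + u z) z ∧
    wderivBar (fun z => χ z * (Φ 0 z)⁻¹ + u z) z = c * wderiv (fun z => χ z * (Φ 0 z)⁻¹ + u z) z := by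
  refine F_hol D.χs (D.ch 0).s hu ((D.ch 0).ne hz) ?_ ?_ h
  · rcases le_or_gt ‖z‖ 1 with h | h
    · rw [(D.ch 0).b, D.mμ 0 z (by simpa using h), hc h]; ring
    · rw [D.χ0 z (by linarith)]; ring
  · rw [D.gΦ]
    rcases le_or_gt ‖z‖ 1 with h | h
    · rw [hc h]
    · have : χ =ᶠ[𝓝 z] fun _ => 0 := by
        filter_upwards [(isOpen_lt continuous_const continuous_norm).mem_nhds h] with y hy
        exact D.χ0 y (by have : 1 < ‖y‖ := hy; linarith)
      rw [wdb_congr this, wd_congr this, wd_const, wdb_const]; simp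

lemma ident (D : Dat μ k χ g m Φ Ψ v E) (n : ℕ) {z : ℂ} (hz : z ≠ 0) :
    χ z * (Φ 0 z)⁻¹ + v n z = wderiv (Φ n) 0 / wderiv (Φ 0) 0 * (Φ n z)⁻¹ := by
  set F : ℂ → ℂ := fun z => χ z * (Φ 0 z)⁻¹ + v n z with hF
  have hC := D.ch n
  have hC0 := D.ch 0
  have hΨ0 : Ψ n 0 = 0 := by
    have := hC.l 0
    rwa [hC.z0] at this
  set b := wderiv (Φ 0) 0 / wderiv (Φ n) 0 with hb
  have hb0 : b ≠ 0 := div_ne_zero (hC0.n 0) (hC.n 0)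
  have hne : ∀ w, w ≠ 0 → Ψ n w ≠ 0 := fun w hw h => hw (by rw [← hC.r w, h, hC.z0])
  have hT : HasDerivAt (fun w => Φ 0 (Ψ n w)) b 0 := by
    have := hC.hol (f := Φ 0) (w := 0) (hC0.s.da _) (by
      rw [hΨ0, hC0.b, D.mμ n 0 (by simp; positivity), D.mμ 0 0 (by simp)])
    rwa [hΨ0] at this
  set f : ℂ → ℂ := fun w => w * F (Ψ n w) with hf
  have hlim : Tendsto f (𝓝[≠] 0) (𝓝 b⁻¹) := by
    have h1 := (hasDerivAt_iff_tendsto_slope.1 hT).inv₀ hb0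
    have h2 : Tendsto (fun w => χ (Ψ n w) + Φ 0 (Ψ n w) * v n (Ψ n w)) (𝓝[≠] 0) (𝓝 1) := by
      have hc : Continuous fun w => χ (Ψ n w) + Φ 0 (Ψ n w) * v n (Ψ n w) := by
        have := D.χs.continuous
        have := hC.si.continuous
        have := hC0.s.continuous
        have := (D.vs n).continuous
        fun_prop
      have := hc.tendsto 0
      rw [hΨ0, hC0.z0, D.χ1 0 (by simp)] at this
      simpa using this.mono_left nhdsWithin_le_nhds
    have h3 := h1.mul h2
    rw [mul_one] at h3
    refine h3.congr' ?_
    filter_upwards [self_mem_nhdsWithin] with w hw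
    have hw' : Ψ n w ≠ 0 := hne w hw
    have := hC0.ne hw'
    simp only [slope_def_field, hf, hF, hΨ0, hC0.z0, sub_zero, inv_div]
    field_simp
  set P := Function.update f 0 b⁻¹ with hP
  have hPne : ∀ w, w ≠ 0 → P w = f w := fun w hw => Function.update_of_ne hw _ _
  have hPc : ContinuousAt P 0 := continuousAt_update_same.2 hlim
  have hPd : Differentiable ℂ P := by
    rw [← differentiableOn_univ]
    refine (Complex.differentiableOn_compl_singleton_and_continuousAt_iff (c := 0) univ_mem).1 ⟨fun w hw => ?_, hPc⟩
    have hw0 : w ≠ 0 := by simpa using hw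
    obtain ⟨h1, h2⟩ := D.fh (u := v n) (c := m n (Ψ n w)) (hne w hw0) ((D.vs n).da _)
      (fun h => D.mμ n _ (by have : (0:ℝ) ≤ n := by positivity
                             linarith)) (D.vb n _)
    have h3 : DifferentiableAt ℂ f w := differentiableAt_id.mul (hC.hol h1 h2).differentiableAt
    refine (h3.congr_of_eventuallyEq ?_).differentiableWithinAt
    filter_upwards [isOpen_ne.mem_nhds hw0] with y hy using hPne y hy
  have hbd : ∃ B, ∀ w, ‖P w‖ ≤ B := by
    obtain ⟨A, hA0, hA⟩ := hC.lin
    obtain ⟨A', hA'0, hA'⟩ := D.vd n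
    obtain ⟨B, hB⟩ := ((isCompact_closedBall (0:ℂ) (1/2)).image hC.s.continuous).exists_bound_of_continuousOn hPd.continuous.continuousOn
    refine ⟨max B (A * A'), fun w => ?_⟩
    rcases le_or_gt ‖Ψ n w‖ (1 / 2) with h | h
    · exact (hB w ⟨Ψ n w, by simpa using h, hC.r w⟩).trans (le_max_left _ _)
    · refine le_trans ?_ (le_max_right _ _)
      have hw : w ≠ 0 := fun h0 => by rw [h0, hΨ0] at h; norm_num at h
      rw [hPne w hw]
      simp only [hf, hF, D.χ0 _ h.le, zero_mul, zero_add, norm_mul]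
      have h1 := hA (Ψ n w)
      rw [hC.r] at h1
      calc ‖w‖ * ‖v n (Ψ n w)‖ ≤ (A * (1 + ‖Ψ n w‖)) * (A' / (1 + ‖Ψ n w‖)) := by
            gcongr; exact hA' _
        _ = A * A' := by field_simp
  obtain ⟨B, hB⟩ := hbd
  have hconst : ∀ w, P w = b⁻¹ := fun w => by
    have := hPd.apply_eq_apply_of_bounded (isBounded_iff_forall_norm_le.2 ⟨B, by rintro _ ⟨y, rfl⟩; exact hB y⟩) w 0
    rw [this, hP]; simp
  rw [← inv_div, ← hb]
  have h1 := hconst (Φ n z)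
  have h2 := hC.ne hz
  rw [hPne _ h2] at h1
  simp only [hf, hC.l] at h1
  show F z = _
  rw [← h1]; field_simp

end Dat
end SRM

namespace SRM
open Complex Filter Topology
namespace Dat
variable {μ : ℂ → ℂ} {k : ℝ} {χ g : ℂ → ℂ} {m Φ Ψ v : ℕ → ℂ → ℂ} {E : ℝ}

lemma diff_hol (D : Dat μ k χ g m Φ Ψ v E) {n N : ℕ} (hn : N ≤ n) {z : ℂ} (hz : ‖z‖ ≤ N + 1) :
    wderivBar (fun z => v n z - v N z) z = m N z * wderiv (fun z => v n z - v N z) z := by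
  rw [wd_sub ((D.vs n).da z) ((D.vs N).da z), wdb_sub ((D.vs n).da z) ((D.vs N).da z), D.vb, D.vb]
  have : (N : ℝ) ≤ n := by exact_mod_cast hn
  rw [D.mμ n z (by linarith), D.mμ N z hz]; ring

lemma loc_grad (D : Dat μ k χ g m Φ Ψ v E) (hk : k < 1) {R : ℝ} {N : ℕ} (hR : R < N + 1) :
    ∃ C, 0 ≤ C ∧ ∀ n, N ≤ n → ∀ z, ‖z‖ ≤ R → ‖fderiv ℝ (v n) z‖ ≤ C := by
  obtain ⟨C, hC, h⟩ := grad_bd (D.ch N) (fun z => (D.mb N z).trans hk.le) hR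
  obtain ⟨B, hB⟩ := (isCompact_closedBall (0 : ℂ) R).exists_bound_of_continuousOn
    ((D.vs N).continuous_fderiv (by simp)).continuousOn
  have hE : 0 ≤ E := (integral_nonneg fun z => by positivity).trans (D.vE 0)
  refine ⟨C * (1 + 4 * E) + max B 0, by positivity, fun n hn z hz => ?_⟩
  have hsm : Smo (fun z => v n z - v N z) := (D.vs n).sub (D.vs N)
  have hle : ∀ z, ‖wderiv (fun z => v n z - v N z) z‖ ^ 2 ≤ 2 * (‖wderiv (v n) z‖ ^ 2 + ‖wderiv (v N) z‖ ^ 2) := fun z => by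
    rw [wd_sub ((D.vs n).da z) ((D.vs N).da z)]
    have := norm_sub_le (wderiv (v n) z) (wderiv (v N) z)
    have h2 := pow_le_pow_left₀ (norm_nonneg _) this 2
    nlinarith [sq_nonneg (‖wderiv (v n) z‖ - ‖wderiv (v N) z‖)]
  have hI : Integrable fun z => 2 * (‖wderiv (v n) z‖ ^ 2 + ‖wderiv (v N) z‖ ^ 2) := ((D.vi n).add (D.vi N)).const_mul 2
  have hi : Integrable fun z => ‖wderiv (fun z => v n z - v N z) z‖ ^ 2 :=
    hI.mono' ((smo_wd hsm).continuous.norm.pow 2).aestronglyMeasurable (Eventually.of_forall fun z => by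
      rw [Real.norm_of_nonneg (by positivity)]; exact hle z)
  have h1 := h _ hsm (fun z hz => D.diff_hol hn hz.le) hi z hz
  have h2 : ∫ z, ‖wderiv (fun z => v n z - v N z) z‖ ^ 2 ≤ 4 * E := by
    refine (integral_mono hi hI hle).trans ?_
    rw [integral_const_mul, integral_add (D.vi n) (D.vi N)]
    linarith [D.vE n, D.vE N]
  have h3 : fderiv ℝ (v n) z = fderiv ℝ (fun z => v n z - v N z) z + fderiv ℝ (v N) z := by
    rw [fderiv_fun_sub ((D.vs n).da z) ((D.vs N).da z)]; simp
  rw [h3]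
  refine (norm_add_le _ _).trans (add_le_add (h1.trans ?_) ((hB z (by simpa using hz)).trans (le_max_left _ _)))
  gcongr

lemma lip {f : ℂ → ℂ} {C R : ℝ} (hf : Smo f) (h : ∀ z, ‖z‖ ≤ R → ‖fderiv ℝ f z‖ ≤ C) {x y : ℂ} (hx : ‖x‖ ≤ R) (hy : ‖y‖ ≤ R) :
    ‖f x - f y‖ ≤ C * ‖x - y‖ :=
  Convex.norm_image_sub_le_of_norm_fderiv_le (𝕜 := ℝ) (s := Metric.closedBall 0 R) (f := f) (fun x _ => hf.da x)
    (fun x hx => h x (by simpa using hx)) (convex_closedBall _ _) (by simpa using hy) (by simpa using hx)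

lemma v0_bd (D : Dat μ k χ g m Φ Ψ v E) (hk : k < 1) : ∃ B, ∀ n, ‖v n 0‖ ≤ B := by
  obtain ⟨C, hC, hg⟩ := D.loc_grad hk (R := 1/4) (N := 0) (by norm_num)
  have hC0 := D.ch 0
  have hΨ0 : Ψ 0 0 = 0 := by
    have := hC0.l 0
    rwa [hC0.z0] at this
  have hev : ∀ᶠ w in 𝓝 (0:ℂ), ‖Ψ 0 w‖ < 1 / 4 := by
    have h := (hC0.si.continuous.norm.tendsto 0)
    rw [hΨ0, norm_zero] at h
    exact h.eventually (gt_mem_nhds (by norm_num))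
  obtain ⟨r, hr, hrb⟩ := Metric.eventually_nhds_iff_ball.1 hev
  refine ⟨3 / (r / 2) + C * (1 / 4), fun n => ?_⟩
  have hCn := D.ch n
  set a := wderiv (Φ n) 0 / wderiv (Φ 0) 0 with ha
  have ha0 : 0 < ‖a‖ := norm_pos_iff.2 (div_ne_zero (hCn.n 0) (hC0.n 0))
  have hd : ∀ w ∈ Metric.ball (0:ℂ) r, HasDerivAt (fun w => Φ n (Ψ 0 w)) (wderiv (Φ n) (Ψ 0 w) / wderiv (Φ 0) (Ψ 0 w)) w := by
    intro w hw
    refine hC0.hol (hCn.s.da _) ?_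
    have := hrb w hw
    have hn0 : (0:ℝ) ≤ n := by positivity
    rw [hCn.b, D.mμ n _ (by linarith), D.mμ 0 _ (by simp; linarith)]
  have hda : deriv (fun w => Φ n (Ψ 0 w)) 0 = a := by
    rw [(hd 0 (by simpa using hr)).deriv, hΨ0]
  have hex : ∃ w ∈ Metric.sphere (0:ℂ) (r / 2), r / 4 * ‖a‖ ≤ ‖Φ n (Ψ 0 w)‖ := by
    by_contra! hcon
    have h1 : DiffContOnCl ℂ (fun w => Φ n (Ψ 0 w)) (Metric.ball 0 (r / 2)) := by
      refine DifferentiableOn.diffContOnCl fun w hw => (hd w ?_).differentiableAt.differentiableWithinAt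
      have := Metric.closure_ball_subset_closedBall hw
      simp at this ⊢; linarith
    have h2 := norm_deriv_le_of_forall_mem_sphere_norm_le (by positivity) h1 fun z hz => (hcon z hz).le
    rw [hda, le_div_iff₀ (by positivity)] at h2
    nlinarith
  obtain ⟨w, hw, hwa⟩ := hex
  have hwn : ‖w‖ = r / 2 := by simpa using hw
  have hz4 := hrb w (by simp; linarith)
  have hw0 : w ≠ 0 := norm_pos_iff.1 (by rw [hwn]; positivity)
  set z := Ψ 0 w with hz
  have hz0 : z ≠ 0 := fun h => hw0 (by rw [← hC0.r w, ← hz, h, hC0.z0])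
  have h1 := D.ident n hz0
  rw [D.χ1 z hz4.le, ← ha, hz, hC0.r, ← hz] at h1
  have h2 : ‖v n z‖ ≤ 3 / (r / 2) := by
    have e : v n z = a * (Φ n z)⁻¹ - 1 * w⁻¹ := by rw [← h1]; ring
    rw [e]
    refine (norm_sub_le _ _).trans ?_
    rw [one_mul, norm_inv, hwn, norm_mul, norm_inv]
    have hp : 0 < ‖Φ n z‖ := norm_pos_iff.2 (hCn.ne hz0)
    have : ‖a‖ * ‖Φ n z‖⁻¹ ≤ 4 / r := by
      rw [← div_eq_mul_inv, div_le_div_iff₀ hp hr]; linarith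
    have e2 : (3 : ℝ) / (r / 2) = 4 / r + (r / 2)⁻¹ := by field_simp; norm_num
    linarith
  have h3 := lip (D.vs n) (hg n (Nat.zero_le n)) (x := 0) (y := z) (by simp) hz4.le
  have h4 : ‖v n 0‖ ≤ ‖v n 0 - v n z‖ + ‖v n z‖ := by simpa using norm_add_le (v n 0 - v n z) (v n z)
  have h5 : C * ‖0 - z‖ ≤ C * (1 / 4) := by gcongr; simpa using hz4.le
  linarith

lemma loc_bd (D : Dat μ k χ g m Φ Ψ v E) (hk : k < 1) {R : ℝ} {N : ℕ} (hR0 : 0 ≤ R) (hR : R < N + 1) :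
    ∃ C, 0 ≤ C ∧ ∀ n, N ≤ n → ∀ z, ‖z‖ ≤ R → ‖v n z‖ ≤ C := by
  obtain ⟨C, hC, hg⟩ := D.loc_grad hk hR
  obtain ⟨B, hB⟩ := D.v0_bd hk
  have hB0 : 0 ≤ B := (norm_nonneg _).trans (hB 0)
  refine ⟨C * R + B, by positivity, fun n hn z hz => ?_⟩
  have h3 := lip (D.vs n) (hg n hn) (x := z) (y := 0) hz (by simpa using hR0)
  have h4 : ‖v n z‖ ≤ ‖v n z - v n 0‖ + ‖v n 0‖ := by simpa using norm_add_le (v n z - v n 0) (v n 0)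
  have h5 : C * ‖z - 0‖ ≤ C * R := by gcongr; simpa using hz
  linarith [hB n]

lemma exists_lim (D : Dat μ k χ g m Φ Ψ v E) (hk : k < 1) : ∃ u, Smo u ∧
    (∀ z, wderivBar u z = μ z * wderiv u z + g z) ∧ ∃ U : Filter ℕ, U.NeBot ∧ U ≤ atTop ∧
      ∀ R, TendstoUniformlyOn v u U (Metric.closedBall 0 R) := by
  let U : Filter ℕ := (hyperfilter ℕ : Filter ℕ)
  have hU : U ≤ atTop := by rw [← Nat.cofinite_eq_atTop]; exact hyperfilter_le_cofinite
  have hlim : ∀ z, ∃ y, Tendsto (fun n => v n z) U (𝓝 y) := by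
    intro z
    obtain ⟨N, hN⟩ := exists_nat_gt ‖z‖
    obtain ⟨C, hC, h⟩ := D.loc_bd hk (norm_nonneg z) (N := N) (by linarith)
    obtain ⟨y, -, hy⟩ := (isCompact_closedBall (0:ℂ) C).ultrafilter_le_nhds ((hyperfilter ℕ).map fun n => v n z) (by
      rw [le_principal_iff]
      refine hU ?_
      filter_upwards [eventually_ge_atTop N] with n hn
      simpa using h n hn z le_rfl)
    exact ⟨y, hy⟩
  choose u hu using hlim
  have hunif : ∀ R, TendstoUniformlyOn v u U (Metric.closedBall 0 R) := by
    intro R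
    rw [Metric.tendstoUniformlyOn_iff]
    intro ε hε
    obtain ⟨N, hN⟩ := exists_nat_gt R
    obtain ⟨C, hC, h⟩ := D.loc_grad hk (R := R) (N := N) (by linarith)
    have hL : ∀ n, N ≤ n → ∀ x y, ‖x‖ ≤ R → ‖y‖ ≤ R → ‖v n x - v n y‖ ≤ C * ‖x - y‖ := fun n hn x y hx hy =>
      lip (D.vs n) (h n hn) hx hy
    have hLu : ∀ x y, ‖x‖ ≤ R → ‖y‖ ≤ R → ‖u x - u y‖ ≤ C * ‖x - y‖ := fun x y hx hy => by
      refine le_of_tendsto ((hu x).sub (hu y)).norm (hU ?_)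
      filter_upwards [eventually_ge_atTop N] with n hn using hL n hn x y hx hy
    obtain ⟨t, hts, htf, hcov⟩ := (isCompact_closedBall (0:ℂ) R).finite_cover_balls (e := ε / (4 * (C + 1))) (by positivity)
    have h1 : ∀ᶠ n in U, ∀ x ∈ t, ‖v n x - u x‖ < ε / 4 := (htf.eventually_all).2 fun x _ => by
      have := (Metric.tendsto_nhds.1 (hu x)) (ε / 4) (by positivity)
      simpa [dist_eq_norm] using this
    filter_upwards [h1, hU (eventually_ge_atTop N)] with n hn hnN z hz
    obtain ⟨x, hxt, hxz⟩ := Set.mem_iUnion₂.1 (hcov hz)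
    have hxR : ‖x‖ ≤ R := by simpa using hts hxt
    have hzR : ‖z‖ ≤ R := by simpa using hz
    have e1 := hL n hnN x z hxR hzR
    have e2 := hLu z x hzR hxR
    have e3 := hn x hxt
    have e4 : ‖z - x‖ < ε / (4 * (C + 1)) := by simpa [dist_eq_norm] using hxz
    have e5 : C * ‖z - x‖ ≤ ε / 4 := by
      calc C * ‖z - x‖ ≤ (C + 1) * (ε / (4 * (C + 1))) := by gcongr; linarith
        _ = ε / 4 := by field_simp
    rw [norm_sub_rev x z] at e1
    rw [dist_eq_norm]
    calc ‖u z - v n z‖ = ‖(u z - u x) + -(v n x - u x) + (v n x - v n z)‖ := by congr 1; ring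
      _ ≤ ‖u z - u x‖ + ‖v n x - u x‖ + ‖v n x - v n z‖ := by
        refine (norm_add_le _ _).trans ?_
        gcongr
        refine (norm_add_le _ _).trans ?_
        rw [norm_neg]
      _ < ε := by linarith
  have hloc : ∀ z, ContDiffAt ℝ ((⊤ : ℕ∞) : WithTop ℕ∞) u z ∧ wderivBar u z = μ z * wderiv u z + g z := by
    intro z
    obtain ⟨N, hN⟩ := exists_nat_gt ‖z‖
    have hC := D.ch N
    set V := Ψ N ⁻¹' Metric.ball 0 N with hV
    have hVo : IsOpen V := Metric.isOpen_ball.preimage hC.si.continuous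
    have hd : DifferentiableOn ℂ (fun w => u (Ψ N w) - v N (Ψ N w)) V := by
      have h1 : TendstoLocallyUniformlyOn (fun n w => v n (Ψ N w) - v N (Ψ N w)) (fun w => u (Ψ N w) - v N (Ψ N w)) U V := by
        have h2 : TendstoUniformlyOn (fun n w => v n (Ψ N w)) (fun w => u (Ψ N w)) U V :=
          ((hunif N).comp (Ψ N)).mono fun w hw => Metric.ball_subset_closedBall hw
        refine TendstoUniformlyOn.tendstoLocallyUniformlyOn ?_
        rw [Metric.tendstoUniformlyOn_iff] at h2 ⊢
        intro ε hε
        filter_upwards [h2 ε hε] with n hn w hw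
        simpa [dist_eq_norm] using hn w hw
      refine h1.differentiableOn (hU ?_) hVo
      filter_upwards [eventually_ge_atTop N] with n hn w hw
      refine DifferentiableAt.differentiableWithinAt ?_
      have hw' : ‖Ψ N w‖ < N := by simpa [hV] using hw
      exact (hC.hol (((D.vs n).sub (D.vs N)).da _) (D.diff_hol hn (by linarith))).differentiableAt
    have hzV : Φ N z ∈ V := by
      rw [hV, Set.mem_preimage, hC.l]; simpa using hN
    set Q : ℂ → ℂ := fun w => u (Ψ N w) - v N (Ψ N w) with hQ
    have hueq : u = fun y => v N y + Q (Φ N y) := by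
      funext y; simp [hQ, hC.l]
    have hQd : DifferentiableAt ℂ Q (Φ N z) := hd.differentiableAt (hVo.mem_nhds hzV)
    have hQs : ContDiffAt ℝ ((⊤ : ℕ∞) : WithTop ℕ∞) (fun y => Q (Φ N y)) z :=
      (smoAt_of_hol hVo hd hzV).comp z hC.s.contDiffAt
    have hQr : DifferentiableAt ℝ (fun y => Q (Φ N y)) z := hQs.differentiableAt (by simp)
    rw [hueq]
    refine ⟨(D.vs N).contDiffAt.add hQs, ?_⟩
    rw [wd_add ((D.vs N).da z) hQr, wdb_add ((D.vs N).da z) hQr, wd_comp hQd.hasDerivAt (hC.s.da z),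
      wdb_comp hQd.hasDerivAt (hC.s.da z), D.vb, hC.b, D.mμ N z (by linarith)]
    ring
  exact ⟨u, contDiff_iff_contDiffAt.2 fun z => (hloc z).1, fun z => (hloc z).2, U, inferInstanceAs (NeBot (hyperfilter ℕ : Filter ℕ)), hU, hunif⟩

end Dat
end SRM

namespace SRM
open Complex Filter Topology

lemma hurwitz {U : Filter ℕ} [U.NeBot] {V : Set ℂ} (hV : IsOpen V) {fn : ℕ → ℂ → ℂ} {f : ℂ → ℂ}
    (hl : TendstoLocallyUniformlyOn fn f U V) (hd : ∀ᶠ n in U, DifferentiableOn ℂ (fn n) V) {a : ℂ} (ha : a ∈ V)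
    (hc : ¬ ∀ᶠ z in 𝓝 a, f z = f a) {p : ℕ → ℂ} (hp : Tendsto p U (𝓝 (f a))) {s : Set ℂ} (hs : s ∈ 𝓝 a) :
    ∀ᶠ n in U, ∃ z ∈ s ∩ V, fn n z = p n := by
  have hfd : DifferentiableOn ℂ f V := hl.differentiableOn hd hV
  have han : AnalyticAt ℂ f a := hfd.analyticAt (hV.mem_nhds ha)
  have hne := (han.eventually_eq_or_eventually_ne (analyticAt_const (v := f a))).resolve_left hc
  rw [eventually_nhdsWithin_iff] at hne
  obtain ⟨r, hr, hrs⟩ := Metric.nhds_basis_closedBall.mem_iff.1 (inter_mem (inter_mem hs (hV.mem_nhds ha)) hne)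
  have hsub : Metric.closedBall a r ⊆ V := fun z hz => (hrs hz).1.2
  have hsp : (Metric.sphere a r).Nonempty := NormedSpace.sphere_nonempty.2 hr.le
  obtain ⟨z0, hz0, hmin⟩ := (isCompact_sphere a r).exists_isMinOn hsp
    (f := fun z => ‖f z - f a‖) (((hfd.continuousOn.mono (Metric.sphere_subset_closedBall.trans hsub)).sub continuousOn_const).norm)
  set e := ‖f z0 - f a‖ with he
  have he0 : 0 < e := norm_pos_iff.2 (sub_ne_zero.2 ((hrs (Metric.sphere_subset_closedBall hz0)).2
    (Metric.ne_of_mem_sphere hz0 hr.ne')))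
  have hu := (tendstoLocallyUniformlyOn_iff_forall_isCompact hV).1 hl _ hsub (isCompact_closedBall a r)
  have hu2 := Metric.tendstoUniformlyOn_iff.1 hu (e / 8) (by positivity)
  have hp2 := Metric.tendsto_nhds.1 hp (e / 8) (by positivity)
  filter_upwards [hu2, hp2, hd] with n h1 h2 h3
  have haa : a ∈ Metric.closedBall a r := Metric.mem_closedBall_self hr.le
  have h1a := h1 a haa
  rw [dist_eq_norm] at h1a h2
  have hlow : ∀ z ∈ Metric.sphere a r, e / 2 ≤ ‖fn n z - fn n a‖ := fun z hz => by
    have h4 := h1 z (Metric.sphere_subset_closedBall hz)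
    rw [dist_eq_norm] at h4
    have h5 : e ≤ ‖f z - f a‖ := hmin hz
    have h6 : f z - f a = (f z - fn n z) + (fn n z - fn n a) + -(f a - fn n a) := by ring
    have h7 := norm_add₃_le (a := f z - fn n z) (b := fn n z - fn n a) (c := -(f a - fn n a))
    rw [← h6, norm_neg] at h7
    linarith
  have hfr : ∃ᶠ z in 𝓝 a, fn n z ≠ fn n a := by
    intro h
    simp only [not_not] at h
    have hA : AnalyticOnNhd ℂ (fn n) (Metric.closedBall a r) := fun z hz => h3.analyticAt (hV.mem_nhds (hsub hz))
    have := hA.eqOn_of_preconnected_of_eventuallyEq (fun z _ => analyticAt_const (v := fn n a))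
      (convex_closedBall a r).isPreconnected haa h (Metric.sphere_subset_closedBall hz0)
    have h8 := hlow z0 hz0
    simp only at this
    rw [this, sub_self, norm_zero] at h8
    linarith
  have hdc : DiffContOnCl ℂ (fn n) (Metric.ball a r) :=
    (h3.mono (by rw [closure_ball _ hr.ne']; exact hsub)).diffContOnCl
  have hin := hdc.ball_subset_image_closedBall hr hlow hfr
  obtain ⟨z, hz, hzz⟩ := hin (show p n ∈ Metric.ball (fn n a) (e / 2 / 2) by
    rw [Metric.mem_ball, dist_eq_norm]
    have h6 : p n - fn n a = (p n - f a) + (f a - fn n a) := by ring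
    rw [h6]
    exact (norm_add_le _ _).trans_lt (by linarith))
  exact ⟨z, ⟨(hrs hz).1.1, hsub hz⟩, hzz⟩

/-- the candidate for the reciprocal of the solution -/
noncomputable def FF (χ P u : ℂ → ℂ) (z : ℂ) : ℂ := χ z * (P z)⁻¹ + u z

namespace Dat
variable {μ : ℂ → ℂ} {k : ℝ} {χ g : ℂ → ℂ} {m Φ Ψ v : ℕ → ℂ → ℂ} {E : ℝ}

/-- chart domain -/
def VV (P : ℂ → ℂ) (N : ℕ) : Set ℂ := {w | w ≠ 0 ∧ ‖P w‖ < N + 1}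

lemma VV_open (D : Dat μ k χ g m Φ Ψ v E) (N : ℕ) : IsOpen (VV (Ψ N) N) :=
  isOpen_ne.inter (isOpen_lt (D.ch N).si.continuous.norm continuous_const)

lemma ps0 (D : Dat μ k χ g m Φ Ψ v E) {N : ℕ} {w : ℂ} (hw : w ≠ 0) : Ψ N w ≠ 0 := fun h => hw <| by
  rw [← (D.ch N).r w, h, (D.ch N).z0]

lemma hF (D : Dat μ k χ g m Φ Ψ v E) {u : ℂ → ℂ} (N : ℕ) {w : ℂ} (hw : w ∈ VV (Ψ N) N) (us : Smo u)
    (ub : wderivBar u (Ψ N w) = μ (Ψ N w) * wderiv u (Ψ N w) + g (Ψ N w)) :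
    HasDerivAt (fun w => FF χ (Φ 0) u (Ψ N w)) (wderiv (FF χ (Φ 0) u) (Ψ N w) / wderiv (Φ N) (Ψ N w)) w := by
  have h := D.fh (D.ps0 (N := N) hw.1) (us.da _) (fun _ => rfl) ub
  refine (D.ch N).hol h.1 ?_
  rw [D.mμ N _ hw.2.le]
  exact h.2

lemma hFn (D : Dat μ k χ g m Φ Ψ v E) {N n : ℕ} (hn : N ≤ n) {w : ℂ} (hw : w ∈ VV (Ψ N) N) :
    HasDerivAt (fun w => FF χ (Φ 0) (v n) (Ψ N w)) (wderiv (FF χ (Φ 0) (v n)) (Ψ N w) / wderiv (Φ N) (Ψ N w)) w := by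
  refine D.hF N hw (D.vs n) ?_
  have : (N : ℝ) ≤ n := by exact_mod_cast hn
  rw [D.vb, D.mμ n _ (by linarith [hw.2])]

lemma exists_N (D : Dat μ k χ g m Φ Ψ v E) {z : ℂ} (hz : z ≠ 0) : ∃ N : ℕ, ∃ w ∈ VV (Ψ N) N, Ψ N w = z := by
  obtain ⟨N, hN⟩ := exists_nat_gt ‖z‖
  refine ⟨N, Φ N z, ⟨(D.ch N).ne hz, ?_⟩, (D.ch N).l z⟩
  rw [(D.ch N).l]; linarith

lemma FFn_eq (D : Dat μ k χ g m Φ Ψ v E) (n : ℕ) {z : ℂ} (hz : z ≠ 0) :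
    FF χ (Φ 0) (v n) z = wderiv (Φ n) 0 / wderiv (Φ 0) 0 * (Φ n z)⁻¹ := D.ident n hz

lemma a_ne (D : Dat μ k χ g m Φ Ψ v E) (n : ℕ) : wderiv (Φ n) 0 / wderiv (Φ 0) 0 ≠ 0 :=
  div_ne_zero ((D.ch n).n 0) ((D.ch 0).n 0)

lemma FFn_wd (D : Dat μ k χ g m Φ Ψ v E) (n : ℕ) {z : ℂ} (hz : z ≠ 0) : wderiv (FF χ (Φ 0) (v n)) z ≠ 0 := by
  have h0 := (D.ch n).ne hz
  rw [wd_congr (g := fun z => wderiv (Φ n) 0 / wderiv (Φ 0) 0 * (Φ n z)⁻¹)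
    (by filter_upwards [isOpen_ne.mem_nhds hz] with y hy using D.FFn_eq n hy),
    wd_comp (φ := fun y => wderiv (Φ n) 0 / wderiv (Φ 0) 0 * y⁻¹) ((hasDerivAt_inv h0).const_mul _) ((D.ch n).s.da z)]
  exact mul_ne_zero (mul_ne_zero (D.a_ne n) (neg_ne_zero.2 (inv_ne_zero (pow_ne_zero _ h0)))) ((D.ch n).n z)

lemma dich (D : Dat μ k χ g m Φ Ψ v E) {u : ℂ → ℂ} (us : Smo u)
    (ub : ∀ z, wderivBar u z = μ z * wderiv u z + g z) {z : ℂ} (hz : z ≠ 0) :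
    (∀ᶠ y in 𝓝 z, wderiv (FF χ (Φ 0) u) y = 0) ∨ (∀ᶠ y in 𝓝[≠] z, wderiv (FF χ (Φ 0) u) y ≠ 0) := by
  obtain ⟨N, w, hw, rfl⟩ := D.exists_N hz
  have hO := (D.VV_open N)
  set f := fun w => FF χ (Φ 0) u (Ψ N w) with hf
  have hd : ∀ w ∈ VV (Ψ N) N, HasDerivAt f _ w := fun w hw => D.hF N hw us (ub _)
  have hfd : DifferentiableOn ℂ f (VV (Ψ N) N) := fun w hw => (hd w hw).differentiableAt.differentiableWithinAt
  have han : AnalyticAt ℂ (deriv f) w := (hfd.analyticAt (hO.mem_nhds hw)).deriv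
  have hT : Tendsto (Φ N) (𝓝 (Ψ N w)) (𝓝 w) := by
    have := (D.ch N).s.continuous.tendsto (Ψ N w)
    rwa [(D.ch N).r] at this
  have key : ∀ᶠ y in 𝓝 (Ψ N w), deriv f (Φ N y) = wderiv (FF χ (Φ 0) u) y / wderiv (Φ N) y := by
    filter_upwards [hT.eventually (hO.mem_nhds hw)] with y hy
    rw [(hd _ hy).deriv, (D.ch N).l]
  rcases han.eventually_eq_zero_or_eventually_ne_zero with h | h
  · left
    filter_upwards [key, hT.eventually h] with y h1 h2
    rw [h2] at h1
    exact (div_eq_zero_iff.1 h1.symm).resolve_right ((D.ch N).n y)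
  · right
    rw [eventually_nhdsWithin_iff] at h ⊢
    filter_upwards [key, hT.eventually h] with y h1 h2 h3 h4
    rw [h4, zero_div] at h1
    refine h2 (fun h5 => h3 ?_) h1
    rw [← (D.ch N).l y, h5]; rfl

lemma nonconst (D : Dat μ k χ g m Φ Ψ v E) {u : ℂ → ℂ} (us : Smo u)
    (ub : ∀ z, wderivBar u z = μ z * wderiv u z + g z) {z : ℂ} (hz : z ≠ 0) :
    ∀ᶠ y in 𝓝[≠] z, wderiv (FF χ (Φ 0) u) y ≠ 0 := by
  refine (D.dich us ub hz).resolve_left fun hz1 => ?_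
  set A := interior {y | wderiv (FF χ (Φ 0) u) y = 0} with hA
  have hAm : ∀ y, y ∈ A ↔ ∀ᶠ y in 𝓝 y, wderiv (FF χ (Φ 0) u) y = 0 := fun y => mem_interior_iff_mem_nhds
  have hAo : IsOpen A := isOpen_interior
  have hcov : ({0}ᶜ : Set ℂ) ⊆ A ∪ (closure A)ᶜ := by
    intro y hy
    rcases D.dich us ub hy with h | h
    · exact Or.inl ((hAm y).2 h)
    · right
      rw [eventually_nhdsWithin_iff] at h
      intro hcl
      obtain ⟨x, hx1, hx2⟩ := mem_closure_iff_nhds.1 hcl _ h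
      have hx0 := interior_subset hx2
      have hxy : x = y := by
        by_contra hne
        exact hx1 hne hx0
      subst hxy
      have h5 := (hAm x).1 hx2
      have h6 : ∀ᶠ y in 𝓝 x, ¬ y ∈ ({x}ᶜ : Set ℂ) := by
        filter_upwards [h, h5] with y h1 h2 h3 using h1 h3 h2
      have h7 : ∃ᶠ y in 𝓝 x, y ∈ ({x}ᶜ : Set ℂ) := by
        rw [frequently_mem_iff_neBot]; exact (inferInstance : (𝓝[≠] x).NeBot)
      exact h7 h6
  have hpc : IsPreconnected ({0}ᶜ : Set ℂ) := (isConnected_compl_singleton_of_one_lt_rank (by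
    rw [Complex.rank_real_complex]; norm_num) (0 : ℂ)).isPreconnected
  have hall : ({0}ᶜ : Set ℂ) ⊆ A := hpc.subset_left_of_subset_union hAo isClosed_closure.isOpen_compl
    ((disjoint_compl_right (a := closure A)).mono_left subset_closure) hcov ⟨z, hz, (hAm z).2 hz1⟩
  have hnear : ∀ᶠ y in 𝓝[≠] (0 : ℂ), wderiv (Φ 0) y = Φ 0 y ^ 2 * wderiv u y := by
    have hb : ∀ᶠ y : ℂ in 𝓝[≠] (0 : ℂ), ‖y‖ < 1 / 4 :=
      eventually_nhdsWithin_of_eventually_nhds ((isOpen_lt continuous_norm continuous_const).mem_nhds (by simp))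
    filter_upwards [hb, self_mem_nhdsWithin] with y hy hy0
    have hP := (D.ch 0).ne hy0
    have h1 : wderiv (FF χ (Φ 0) u) y = 0 := ((hAm y).1 (hall hy0)).self_of_nhds
    rw [wd_congr (g := fun z => (Φ 0 z)⁻¹ + u z) (by
      filter_upwards [(isOpen_lt continuous_norm continuous_const).mem_nhds hy] with x hx
      rw [FF, D.χ1 x (le_of_lt hx), one_mul])] at h1
    have hPd : DifferentiableAt ℝ (fun z => (Φ 0 z)⁻¹) y := ((D.ch 0).s.da y).inv hP
    rw [wd_add hPd (us.da y), wd_comp (hasDerivAt_inv hP) ((D.ch 0).s.da y)] at h1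
    have h2 : wderiv u y = (Φ 0 y ^ 2)⁻¹ * wderiv (Φ 0) y := by linear_combination h1
    rw [h2]; field_simp
  have t1 : Tendsto (wderiv (Φ 0)) (𝓝[≠] 0) (𝓝 (wderiv (Φ 0) 0)) :=
    ((smo_wd (D.ch 0).s).continuous.tendsto 0).mono_left nhdsWithin_le_nhds
  have t2 : Tendsto (fun y => Φ 0 y ^ 2 * wderiv u y) (𝓝[≠] 0) (𝓝 (Φ 0 0 ^ 2 * wderiv u 0)) :=
    ((((D.ch 0).s.continuous.pow 2).mul (smo_wd us).continuous).tendsto 0).mono_left nhdsWithin_le_nhds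
  have := tendsto_nhds_unique (t1.congr' hnear) t2
  rw [(D.ch 0).z0] at this
  exact (D.ch 0).n 0 (by rw [this]; simp)

lemma conv (D : Dat μ k χ g m Φ Ψ v E) {u : ℂ → ℂ} {U : Filter ℕ}
    (hl : ∀ R, TendstoUniformlyOn v u U (Metric.closedBall 0 R)) (N : ℕ) :
    TendstoLocallyUniformlyOn (fun n w => FF χ (Φ 0) (v n) (Ψ N w)) (fun w => FF χ (Φ 0) u (Ψ N w)) U (VV (Ψ N) N) := by
  refine TendstoUniformlyOn.tendstoLocallyUniformlyOn ?_
  rw [Metric.tendstoUniformlyOn_iff]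
  intro e he
  filter_upwards [Metric.tendstoUniformlyOn_iff.1 (hl (N + 1)) e he] with n hn w hw
  have := hn (Ψ N w) (by simpa using hw.2.le)
  simpa [FF] using this

lemma hurw (D : Dat μ k χ g m Φ Ψ v E) {u : ℂ → ℂ} (us : Smo u)
    (ub : ∀ z, wderivBar u z = μ z * wderiv u z + g z) {U : Filter ℕ} (hU : U.NeBot) (hUa : U ≤ atTop)
    (hl : ∀ R, TendstoUniformlyOn v u U (Metric.closedBall 0 R)) {z : ℂ} (hz : z ≠ 0) {p : ℕ → ℂ}
    (hp : Tendsto p U (𝓝 (FF χ (Φ 0) u z))) {s : Set ℂ} (hs : s ∈ 𝓝 z) :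
    ∃ n, ∃ y ∈ s, y ≠ 0 ∧ FF χ (Φ 0) (v n) y = p n := by
  have hnc := D.nonconst us ub hz
  obtain ⟨N, w, hw, rfl⟩ := D.exists_N hz
  have hO := (D.VV_open N)
  have hev : ∀ᶠ n in U, N ≤ n := hUa (eventually_ge_atTop N)
  have := hurwitz hO (D.conv hl N) (hev.mono fun n hn w hw => (D.hFn hn hw).differentiableAt.differentiableWithinAt)
    hw ?_ hp (s := Ψ N ⁻¹' s) ((D.ch N).si.continuous.continuousAt hs)
  · obtain ⟨n, y, ⟨hy, hy2⟩, h⟩ := this.exists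
    exact ⟨n, Ψ N y, hy, D.ps0 hy2.1, h⟩
  · intro hc
    have hT : Tendsto (Φ N) (𝓝 (Ψ N w)) (𝓝 w) := by
      have := (D.ch N).s.continuous.tendsto (Ψ N w)
      rwa [(D.ch N).r] at this
    have h1 : ∀ᶠ y in 𝓝 w, wderiv (FF χ (Φ 0) u) (Ψ N y) = 0 := by
      filter_upwards [hc.eventually_nhds, hO.mem_nhds hw] with y h2 h3
      have h4 := (D.hF N h3 us (ub _)).deriv
      rw [EventuallyEq.deriv_eq (f := fun _ => FF χ (Φ 0) u (Ψ N w)) h2] at h4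
      simp only [deriv_const] at h4
      exact (div_eq_zero_iff.1 h4.symm).resolve_right ((D.ch N).n _)
    have h2 := hT.eventually h1
    have h3 := (hnc.and (eventually_nhdsWithin_of_eventually_nhds h2)).exists
    obtain ⟨y, h4, h5⟩ := h3
    rw [(D.ch N).l] at h5
    exact h4 h5

lemma hurw_d (D : Dat μ k χ g m Φ Ψ v E) {u : ℂ → ℂ} (us : Smo u)
    (ub : ∀ z, wderivBar u z = μ z * wderiv u z + g z) {U : Filter ℕ} (hU : U.NeBot) (hUa : U ≤ atTop)
    (hl : ∀ R, TendstoUniformlyOn v u U (Metric.closedBall 0 R)) {z : ℂ} (hz : z ≠ 0) :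
    wderiv (FF χ (Φ 0) u) z ≠ 0 := by
  intro h0
  have hnc := D.nonconst us ub hz
  obtain ⟨N, w, hw, rfl⟩ := D.exists_N hz
  have hO := (D.VV_open N)
  have hev : ∀ᶠ n in U, N ≤ n := hUa (eventually_ge_atTop N)
  have hdf : ∀ᶠ n in U, DifferentiableOn ℂ (fun w => FF χ (Φ 0) (v n) (Ψ N w)) (VV (Ψ N) N) :=
    hev.mono fun n hn w hw => (D.hFn hn hw).differentiableAt.differentiableWithinAt
  have hd0 : deriv (fun w => FF χ (Φ 0) u (Ψ N w)) w = 0 := by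
    rw [(D.hF N hw us (ub _)).deriv, h0, zero_div]
  have := hurwitz hO ((D.conv hl N).deriv hdf hO) (hdf.mono fun n hn => hn.deriv hO)
    hw (p := fun _ => 0) ?_ (by rw [hd0]; exact tendsto_const_nhds) univ_mem
  · obtain ⟨n, ⟨y, ⟨-, hy2⟩, h⟩, hn⟩ := (this.and hev).exists
    simp only [Function.comp_apply] at h
    rw [(D.hFn hn hy2).deriv] at h
    exact D.FFn_wd n (D.ps0 hy2.1) ((div_eq_zero_iff.1 h).resolve_right ((D.ch N).n _))
  · intro hc
    rw [hd0] at hc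
    have hT : Tendsto (Φ N) (𝓝 (Ψ N w)) (𝓝 w) := by
      have := (D.ch N).s.continuous.tendsto (Ψ N w)
      rwa [(D.ch N).r] at this
    have h1 : ∀ᶠ y in 𝓝 w, wderiv (FF χ (Φ 0) u) (Ψ N y) = 0 := by
      filter_upwards [hc, hO.mem_nhds hw] with y h2 h3
      rw [(D.hF N h3 us (ub _)).deriv] at h2
      exact (div_eq_zero_iff.1 h2).resolve_right ((D.ch N).n _)
    obtain ⟨y, h4, h5⟩ := (hnc.and (eventually_nhdsWithin_of_eventually_nhds (hT.eventually h1))).exists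
    rw [(D.ch N).l] at h5
    exact h4 h5

lemma F_ne (D : Dat μ k χ g m Φ Ψ v E) {u : ℂ → ℂ} (us : Smo u)
    (ub : ∀ z, wderivBar u z = μ z * wderiv u z + g z) {U : Filter ℕ} (hU : U.NeBot) (hUa : U ≤ atTop)
    (hl : ∀ R, TendstoUniformlyOn v u U (Metric.closedBall 0 R)) {z : ℂ} (hz : z ≠ 0) :
    FF χ (Φ 0) u z ≠ 0 := by
  intro h0
  obtain ⟨n, y, -, hy, h⟩ := D.hurw us ub hU hUa hl hz (p := fun _ => 0) (by rw [h0]; exact tendsto_const_nhds) univ_mem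
  rw [D.FFn_eq n hy] at h
  exact mul_ne_zero (D.a_ne n) (inv_ne_zero ((D.ch n).ne hy)) h

lemma F_inj (D : Dat μ k χ g m Φ Ψ v E) {u : ℂ → ℂ} (us : Smo u)
    (ub : ∀ z, wderivBar u z = μ z * wderiv u z + g z) {U : Filter ℕ} (hU : U.NeBot) (hUa : U ≤ atTop)
    (hl : ∀ R, TendstoUniformlyOn v u U (Metric.closedBall 0 R)) {z y : ℂ} (hz : z ≠ 0) (hy : y ≠ 0)
    (h : FF χ (Φ 0) u z = FF χ (Φ 0) u y) : z = y := by
  by_contra hne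
  obtain ⟨n, x, hx, hx0, hxx⟩ := D.hurw us ub hU hUa hl hz (p := fun n => FF χ (Φ 0) (v n) y) (by
    rw [h]
    have := (hl ‖y‖).tendsto_at (x := y) (by simp)
    simpa [FF] using this.const_add _) (isOpen_ne.mem_nhds hne)
  rw [D.FFn_eq n hx0, D.FFn_eq n hy] at hxx
  have := inv_injective (mul_left_cancel₀ (D.a_ne n) hxx)
  exact hx (by rw [← (D.ch n).l x, this, (D.ch n).l])
end Dat
end SRM

namespace SRM
open Complex Filter Topology

lemma exists_inj {μ : ℂ → ℂ} {k : ℝ} (hμ : Smo μ) (hk : ∀ z, ‖μ z‖ ≤ k) (hk1 : k < 1) :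
    ∃ P, Smo P ∧ P 0 = 0 ∧ (∀ z, wderivBar P z = μ z * wderiv P z) ∧ (∀ z, wderiv P z ≠ 0) ∧ Function.Injective P := by
  obtain ⟨χ, g, m, Φ, Ψ, v, E, D⟩ := exists_dat hμ hk hk1
  obtain ⟨u, us, ub, U, hU, hUa, hl⟩ := D.exists_lim hk1
  have Fne : ∀ z, z ≠ 0 → FF χ (Φ 0) u z ≠ 0 := fun z hz => D.F_ne us ub hU hUa hl hz
  have Finj : ∀ z y, z ≠ 0 → y ≠ 0 → FF χ (Φ 0) u z = FF χ (Φ 0) u y → z = y :=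
    fun z y hz hy h => D.F_inj us ub hU hUa hl hz hy h
  have C := D.ch 0
  have hM : ∀ z, z ≠ 0 → χ z + Φ 0 z * u z = Φ 0 z * FF χ (Φ 0) u z := fun z hz => by
    have := C.ne hz
    rw [FF]; field_simp
  have hM0 : χ 0 = 1 := D.χ1 0 (by norm_num)
  have hMn : ∀ z, χ z + Φ 0 z * u z ≠ 0 := fun z => by
    by_cases hz : z = 0
    · subst hz; rw [C.z0, hM0]; norm_num
    · rw [hM z hz]; exact mul_ne_zero (C.ne hz) (Fne z hz)
  have hMs : Smo (fun z => χ z + Φ 0 z * u z) := D.χs.add (C.s.mul us)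
  have hPs : Smo (fun z => Φ 0 z * (χ z + Φ 0 z * u z)⁻¹) := C.s.mul (hMs.inv hMn)
  set P := fun z => Φ 0 z * (χ z + Φ 0 z * u z)⁻¹ with hP
  have hPF : ∀ z, z ≠ 0 → P z = (FF χ (Φ 0) u z)⁻¹ := fun z hz => by
    simp only [hP]; rw [hM z hz, mul_inv, mul_inv_cancel_left₀ (C.ne hz)]
  have P0 : P 0 = 0 := by simp [hP, C.z0]
  have hfh : ∀ z, z ≠ 0 → DifferentiableAt ℝ (FF χ (Φ 0) u) z ∧
      wderivBar (FF χ (Φ 0) u) z = μ z * wderiv (FF χ (Φ 0) u) z := fun z hz =>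
    D.fh hz (us.da z) (fun _ => rfl) (ub z)
  have hw : ∀ z, z ≠ 0 → wderiv P z = -(FF χ (Φ 0) u z ^ 2)⁻¹ * wderiv (FF χ (Φ 0) u) z := fun z hz => by
    rw [wd_congr (g := fun z => (FF χ (Φ 0) u z)⁻¹) (by filter_upwards [isOpen_ne.mem_nhds hz] with y hy using hPF y hy),
      wd_comp (hasDerivAt_inv (Fne z hz)) (hfh z hz).1]
  have hwb : ∀ z, z ≠ 0 → wderivBar P z = -(FF χ (Φ 0) u z ^ 2)⁻¹ * wderivBar (FF χ (Φ 0) u) z := fun z hz => by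
    rw [wdb_congr (g := fun z => (FF χ (Φ 0) u z)⁻¹) (by filter_upwards [isOpen_ne.mem_nhds hz] with y hy using hPF y hy),
      wdb_comp (hasDerivAt_inv (Fne z hz)) (hfh z hz).1]
  have hb0 : ∀ z, z ≠ 0 → wderivBar P z = μ z * wderiv P z := fun z hz => by
    rw [hw z hz, hwb z hz, (hfh z hz).2]; ring
  refine ⟨P, hPs, P0, ?_, ?_, ?_⟩
  · have h1 : Continuous (wderivBar P) := (smo_wdb hPs).continuous
    have h2 : Continuous (fun z => μ z * wderiv P z) := hμ.continuous.mul (smo_wd hPs).continuous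
    have hd : Dense ({0}ᶜ : Set ℂ) := dense_compl_singleton 0
    exact fun z => congrFun (h1.ext_on hd h2 fun z hz => hb0 z hz) z
  · intro z
    by_cases hz : z = 0
    · subst hz
      have : wderiv P 0 = wderiv (Φ 0) 0 := by
        have hI : Smo (fun z => (χ z + Φ 0 z * u z)⁻¹) := hMs.inv hMn
        have e := wd_mul (C.s.da 0) (hI.da 0)
        rw [C.z0, hM0, zero_mul, zero_mul, add_zero, zero_add, inv_one, mul_one] at e
        exact e
      rw [this]; exact C.n 0
    · rw [hw z hz]
      exact mul_ne_zero (neg_ne_zero.2 (inv_ne_zero (pow_ne_zero _ (Fne z hz)))) (D.hurw_d us ub hU hUa hl hz)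
  · have hPn : ∀ z, z ≠ 0 → P z ≠ 0 := fun z hz => by rw [hPF z hz]; exact inv_ne_zero (Fne z hz)
    intro z y h
    by_cases hz : z = 0
    · by_cases hy : y = 0
      · rw [hz, hy]
      · exact absurd (by rw [← h, hz, P0]) (hPn y hy)
    · by_cases hy : y = 0
      · exact absurd (by rw [h, hy, P0]) (hPn z hz)
      · rw [hPF z hz, hPF y hy] at h
        exact Finj z y hz hy (inv_injective h)

lemma no_bdd_inj {μ G : ℂ → ℂ} {k B : ℝ} (hk : ∀ z, ‖μ z‖ ≤ k) (hk1 : k < 1) (hG : Smo G) (hB : ∀ z, ‖G z‖ ≤ B)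
    (hb : ∀ z, wderivBar G z = μ z * wderiv G z) (hn : ∀ z, wderiv G z ≠ 0) (hi : Function.Injective G) : False := by
  have hJ : ∀ z, 0 < Jac G z := fun z => Jac_ne ((hk z).trans_lt hk1) (hb z) (hn z)
  have hk0 : 0 ≤ k := (norm_nonneg _).trans (hk 0)
  have hfin : volume (G '' Set.univ) < ⊤ := (measure_mono (by
    rintro _ ⟨z, -, rfl⟩; simpa using hB z : G '' Set.univ ⊆ Metric.closedBall 0 B)).trans_lt measure_closedBall_lt_top
  have hJc : Continuous (Jac G) := by
    unfold Jac
    exact ((smo_wd hG).continuous.norm.pow 2).sub ((smo_wdb hG).continuous.norm.pow 2)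
  have hJi : Integrable (Jac G) := by
    have h1 := (integrableOn_image_iff_integrableOn_abs_det_fderiv_smul volume MeasurableSet.univ
      (fun z _ => ((hG.da z).hasFDerivAt).hasFDerivWithinAt) hi.injOn (fun _ => (1 : ℝ))).1
      (integrableOn_const hfin.ne)
    rw [integrableOn_univ] at h1
    refine h1.congr (Eventually.of_forall fun z => ?_)
    simp only [smul_eq_mul, mul_one]
    rw [det_fd, abs_of_pos (hJ z)]
  have hk2 : 0 < 1 - k ^ 2 := by nlinarith
  have i1 : Integrable (fun z => ‖wderiv G z‖ ^ 2) := by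
    refine (hJi.const_mul (1 - k ^ 2)⁻¹).mono' ((smo_wd hG).continuous.norm.pow 2).aestronglyMeasurable
      (Eventually.of_forall fun z => ?_)
    rw [Real.norm_of_nonneg (by positivity), ← div_eq_inv_mul, le_div_iff₀ hk2, Jac, hb z, norm_mul, mul_pow]
    have := pow_le_pow_left₀ (norm_nonneg _) (hk z) 2
    nlinarith [sq_nonneg ‖wderiv G z‖]
  have i2 : Integrable (fun z => ‖wderivBar G z‖ ^ 2) := by
    refine i1.mono' ((smo_wdb hG).continuous.norm.pow 2).aestronglyMeasurable (Eventually.of_forall fun z => ?_)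
    rw [Real.norm_of_nonneg (by positivity)]
    have := hJ z
    rw [Jac] at this; linarith
  have h0 := jac_zero hG hB i1 i2
  rw [integral_eq_zero_iff_of_nonneg (fun z => (hJ z).le) hJi] at h0
  have h1 := (hJc.ae_eq_iff_eq volume (continuous_zero)).1 h0
  exact (hJ 0).ne' (congrFun h1 0)

lemma surj {μ P : ℂ → ℂ} {k : ℝ} (hk : ∀ z, ‖μ z‖ ≤ k) (hk1 : k < 1) (hP : Smo P)
    (hb : ∀ z, wderivBar P z = μ z * wderiv P z) (hn : ∀ z, wderiv P z ≠ 0) (hi : Function.Injective P) :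
    Function.Surjective P := by
  by_contra hsu
  simp only [Function.Surjective, not_forall, not_exists] at hsu
  obtain ⟨c, hc⟩ := hsu
  have hc' : ∀ z, P z - c ≠ 0 := fun z => sub_ne_zero.2 (hc z)
  have hIs : Smo (fun z => (P z - c)⁻¹) := (hP.sub contDiff_const).inv hc'
  have hIw : ∀ z, wderiv (fun z => (P z - c)⁻¹) z = -((P z - c) ^ 2)⁻¹ * wderiv P z ∧
      wderivBar (fun z => (P z - c)⁻¹) z = -((P z - c) ^ 2)⁻¹ * wderivBar P z := fun z => by
    have hd : HasDerivAt (fun y : ℂ => (y - c)⁻¹) (-((P z - c) ^ 2)⁻¹) (P z) := by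
      have := (hasDerivAt_inv (hc' z)).comp (P z) ((hasDerivAt_id' (P z)).sub_const c)
      rwa [mul_one] at this
    exact ⟨wd_comp hd (hP.da z), wdb_comp hd (hP.da z)⟩
  obtain ⟨L, hL, L0, hLd⟩ := poincare (A := fun z => wderiv P z * (P z - c)⁻¹) (B := fun z => wderivBar P z * (P z - c)⁻¹)
    ((smo_wd hP).mul hIs) ((smo_wdb hP).mul hIs) (fun z => by
      rw [wdb_mul ((smo_wd hP).da z) (hIs.da z), wd_mul ((smo_wdb hP).da z) (hIs.da z), (hIw z).1, (hIw z).2, wdb_wd hP]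
      ring)
  have eder : ∀ (a x : ℂ), HasDerivAt (fun y => Complex.exp (a * y)) (Complex.exp (a * x) * a) x := fun a x => by
    simpa using ((hasDerivAt_id x).const_mul a).cexp
  have esmo : ∀ a : ℂ, Smo (fun z => Complex.exp (a * L z)) := fun a => (contDiff_const.mul hL).cexp
  have ew : ∀ a z, wderiv (fun z => Complex.exp (a * L z)) z = Complex.exp (a * L z) * a * (wderiv P z * (P z - c)⁻¹) :=
    fun a z => by rw [wd_comp (eder a (L z)) (hL.da z), (hLd z).1]
  have ewb : ∀ a z, wderivBar (fun z => Complex.exp (a * L z)) z = Complex.exp (a * L z) * a * (wderivBar P z * (P z - c)⁻¹) :=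
    fun a z => by rw [wdb_comp (eder a (L z)) (hL.da z), (hLd z).2]
  have hconst : ∀ z, (P z - c) * Complex.exp (-1 * L z) = P 0 - c := by
    have hQs : Smo (fun z => (P z - c) * Complex.exp (-1 * L z)) := (hP.sub contDiff_const).mul (esmo (-1))
    have hz : ∀ z, fderiv ℝ (fun z => (P z - c) * Complex.exp (-1 * L z)) z = 0 := fun z => by
      have hPc : Smo (fun z => P z - c) := hP.sub contDiff_const
      have w1 : wderiv (fun z => P z - c) z = wderiv P z := by
        rw [wd_sub (hP.da z) (differentiableAt_const c), wd_const, sub_zero]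
      have w2 : wderivBar (fun z => P z - c) z = wderivBar P z := by
        rw [wdb_sub (hP.da z) (differentiableAt_const c), wdb_const, sub_zero]
      have hcz := hc' z
      refine fd_eq_zero ?_ ?_
      · rw [wd_mul (hPc.da z) ((esmo (-1)).da z), ew, w1]; field_simp; ring
      · rw [wdb_mul (hPc.da z) ((esmo (-1)).da z), ewb, w2]; field_simp; ring
    intro z
    have := is_const_of_fderiv_eq_zero (hQs.differentiable (by simp)) hz z 0
    simpa [L0] using this
  have hPe : ∀ z, P z - c = (P 0 - c) * Complex.exp ((1 / 2) * L z) ^ 2 := fun z => by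
    rw [← hconst z, ← Complex.exp_nat_mul, mul_assoc, ← Complex.exp_add]
    ring_nf; simp
  set G := fun z => Complex.exp ((1 / 2) * L z) with hG
  have hGs : Smo G := esmo _
  have Ginj : ∀ z y, G z ^ 2 = G y ^ 2 → z = y := fun z y h => hi (by
    have : P z - c = P y - c := by rw [hPe z, hPe y]; simp only [hG] at h; rw [h]
    simpa using this)
  have Gne : ∀ z, G z ≠ 0 := fun z => Complex.exp_ne_zero _
  have Gw : ∀ z, wderiv G z ≠ 0 := fun z => by
    rw [ew]; exact mul_ne_zero (mul_ne_zero (Complex.exp_ne_zero _) (by norm_num)) (mul_ne_zero (hn z) (inv_ne_zero (hc' z)))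
  have Gb : ∀ z, wderivBar G z = μ z * wderiv G z := fun z => by rw [ew, ewb, hb]; ring
  have Gneg : ∀ z y, G z ≠ -G y := fun z y h => by
    have := Ginj z y (by rw [h]; ring)
    subst this
    exact Gne z (self_eq_neg.1 h)
  have hopen : IsOpenMap G := (loc_homeo hGs fun z => (Jac_ne ((hk z).trans_lt hk1) (Gb z) (Gw z)).ne').isOpenMap
  have hmem : Set.range G ∈ 𝓝 (G 0) := hopen.isOpen_range.mem_nhds ⟨0, rfl⟩
  obtain ⟨r, hr, hrs⟩ := Metric.mem_nhds_iff.1 hmem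
  have hlow : ∀ z, r ≤ ‖G z + G 0‖ := fun z => by
    by_contra hlt
    push Not at hlt
    obtain ⟨y, hy⟩ := hrs (show -G z ∈ Metric.ball (G 0) r by
      rw [Metric.mem_ball, dist_eq_norm, ← norm_neg]; have e : -(-G z - G 0) = G z + G 0 := by ring
      rwa [e])
    exact Gneg y z hy
  have hne : ∀ z, G z + G 0 ≠ 0 := fun z h => by
    have := hlow z; rw [h, norm_zero] at this; linarith
  have hd : ∀ z, HasDerivAt (fun y : ℂ => (y + G 0)⁻¹) (-((G z + G 0) ^ 2)⁻¹) (G z) := fun z => by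
    have := (hasDerivAt_inv (hne z)).comp (G z) ((hasDerivAt_id' (G z)).add_const (G 0))
    rwa [mul_one] at this
  refine no_bdd_inj (G := fun z => (G z + G 0)⁻¹) (B := r⁻¹) hk hk1 ((hGs.add contDiff_const).inv hne) ?_ ?_ ?_ ?_
  · intro z
    rw [norm_inv]; exact inv_anti₀ hr (hlow z)
  · intro z
    rw [wd_comp (hd z) (hGs.da z), wdb_comp (hd z) (hGs.da z), Gb z]; ring
  · intro z
    rw [wd_comp (hd z) (hGs.da z)]
    exact mul_ne_zero (neg_ne_zero.2 (inv_ne_zero (pow_ne_zero _ (hne z)))) (Gw z)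
  · intro z y h
    have h2 : G z = G y := by simpa using h
    exact Ginj z y (by rw [h2])
end SRM

/-- **Integrability of smooth bounded almost complex structures on `ℂ`.**
For every `C^∞` function `μ : ℂ → ℂ` with `sup |μ| < 1` there is a `C^∞`
diffeomorphism `Φ : ℂ → ℂ` fixing `0` and `1` with `∂Φ/∂z̄ = μ ∂Φ/∂z` and
`∂Φ/∂z ≠ 0` everywhere. -/
theorem smooth_riemann_mapping
    (μ : ℂ → ℂ) (hμ : ContDiff ℝ (⊤ : ℕ∞) μ)
    (k : ℝ) (hk : k < 1) (hbound : ∀ z : ℂ, ‖μ z‖ ≤ k) :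
    ∃ Φ : ℂ → ℂ, ContDiff ℝ (⊤ : ℕ∞) Φ ∧ Function.Bijective Φ ∧
      ContDiff ℝ (⊤ : ℕ∞) (Function.invFun Φ) ∧ Φ 0 = 0 ∧ Φ 1 = 1 ∧
      ∀ z : ℂ, wderivBar Φ z = μ z * wderiv Φ z ∧ wderiv Φ z ≠ 0 := by
  obtain ⟨P, hP, P0, hb, hn, hi⟩ := SRM.exists_inj hμ hbound hk
  have hs := SRM.surj hbound hk hP hb hn hi
  have h1 : P 1 ≠ 0 := fun h => one_ne_zero (hi (h.trans P0.symm))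
  have hd : ∀ z, HasDerivAt (fun y : ℂ => (P 1)⁻¹ * y) (P 1)⁻¹ (P z) := fun z => by
    simpa using (hasDerivAt_id (P z)).const_mul (P 1)⁻¹
  have w1 : ∀ z, wderiv (fun z => (P 1)⁻¹ * P z) z = (P 1)⁻¹ * wderiv P z := fun z => SRM.wd_comp (hd z) (hP.da z)
  have w2 : ∀ z, wderivBar (fun z => (P 1)⁻¹ * P z) z = (P 1)⁻¹ * wderivBar P z := fun z => SRM.wdb_comp (hd z) (hP.da z)
  have hQ : ContDiff ℝ (⊤ : ℕ∞) (fun z => (P 1)⁻¹ * P z) := contDiff_const.mul hP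
  have hbij : Function.Bijective (fun z => (P 1)⁻¹ * P z) :=
    ⟨fun z y h => hi (mul_left_cancel₀ (inv_ne_zero h1) h), fun w => by
      obtain ⟨z, hz⟩ := hs (P 1 * w)
      exact ⟨z, by simp only [hz]; field_simp⟩⟩
  have hbb : ∀ z, wderivBar (fun z => (P 1)⁻¹ * P z) z = μ z * wderiv (fun z => (P 1)⁻¹ * P z) z := fun z => by
    rw [w1, w2, hb]; ring
  have hnn : ∀ z, wderiv (fun z => (P 1)⁻¹ * P z) z ≠ 0 := fun z => by
    rw [w1]; exact mul_ne_zero (inv_ne_zero h1) (hn z)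
  refine ⟨fun z => (P 1)⁻¹ * P z, hQ, hbij, ?_, by simp [P0], by simp [h1], fun z => ⟨hbb z, hnn z⟩⟩
  obtain ⟨Q, hQs, hl, hr⟩ := SRM.diffeo_inv hQ (fun z => (SRM.Jac_ne ((hbound z).trans_lt hk) (hbb z) (hnn z)).ne') hbij
  have : Function.invFun (fun z => (P 1)⁻¹ * P z) = Q := by
    funext w
    refine hbij.1 ?_
    exact (Function.invFun_eq (hbij.2 w)).trans (hr w).symm
  rw [this]; exact hQs
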